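/- arXiv:0901.2392 — 2 statements merged into one kernel-verified Lean document; each statement's English description precedes it below -/
import Mathlib

section
/- Let (R,m) be a Noetherian local domain whose m-adic completion is an integral domain (i.e. R is analytically irreducible). Then for each nonzero α ∈ ℤ^N_{≥0} there exists c ∈ ℕ, not depending on n, such that for every n ∈ ℕ and every a ∈ R^N with a^α ∈ m^{cn}, there exists b ∈ R^N with b^α = 0 and a ≡ b (mod m^n R^N); that is, β_n(X^α) ≤ cn for all n. -/
set_option linter.unusedSectionVars false

namespace Izumi

/-- The analytic input about the base ring `S` inside a complete field `F`. -/
structure Base (S F : Type*) [CommRing S] [NontriviallyNormedField F] [Algebra S F]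
    (v : S → ℕ) : Prop where
  norm_eq : ∀ s : S, s ≠ 0 → ‖algebraMap S F s‖ = (1/2 : ℝ) ^ (v s)
  dense : ∀ h : F, h ≠ 0 → ∃ u w : S, w ≠ 0 ∧
    ‖algebraMap S F w * h - algebraMap S F u‖ < ‖algebraMap S F w * h‖
  complete : ∀ s : ℕ → S, (∀ n, ‖algebraMap S F (s (n+1) - s n)‖ ≤ (1/2 : ℝ) ^ n) →
    ∃ l : S, ∀ n, ‖algebraMap S F (l - s n)‖ ≤ (1/2 : ℝ) ^ n
  dich : ∀ u w : S, u ≠ 0 → w ≠ 0 →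
    (∃ z : S, ‖algebraMap S F (u - z * w)‖ < ‖algebraMap S F u‖) ∨
    (∀ (T G : S) (s : ℕ), T ≠ 0 →
      ‖algebraMap S F (T * u ^ s - G * w ^ s)‖ < ‖algebraMap S F (T * u ^ s)‖ → s ≤ v T)

section Ultra

variable {F : Type*} [NormedField F] [IsUltrametricDist F]

lemma nsub_le_max (x y : F) : ‖x - y‖ ≤ max ‖x‖ ‖y‖ := by
  have := IsUltrametricDist.norm_add_le_max x (-y)
  rwa [norm_neg, ← sub_eq_add_neg] at this

lemma norm_pow_sub_lt {x y : F} (h : ‖x - y‖ < ‖x‖) {s : ℕ} (hs : s ≠ 0) :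
    ‖x ^ s - y ^ s‖ < ‖x‖ ^ s := by
  have hy : ‖y‖ ≤ ‖x‖ := by
    have : y = x - (x - y) := by ring
    rw [this]
    refine (Izumi.nsub_le_max _ _).trans (max_le le_rfl h.le)
  have hx : 0 < ‖x‖ := (norm_nonneg _).trans_lt h
  obtain ⟨s, rfl⟩ := Nat.exists_eq_succ_of_ne_zero hs
  rw [← Commute.mul_geom_sum₂ (Commute.all x y), norm_mul, Nat.succ_eq_add_one, pow_succ, mul_comm]
  have : ‖∑ i ∈ Finset.range (s+1), x ^ i * y ^ (s + 1 - 1 - i)‖ ≤ ‖x‖ ^ s := by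
    refine IsUltrametricDist.norm_sum_le_of_forall_le_of_nonneg (by positivity) ?_
    intro i hi
    have hi' : i ≤ s := by simpa [Nat.lt_succ_iff] using hi
    rw [norm_mul, norm_pow, norm_pow]
    calc ‖x‖ ^ i * ‖y‖ ^ (s + 1 - 1 - i) ≤ ‖x‖ ^ i * ‖x‖ ^ (s + 1 - 1 - i) := by gcongr
      _ = ‖x‖ ^ s := by rw [← pow_add]; congr 1; omega
  calc _ ≤ ‖x‖ ^ s * ‖x - y‖ := by gcongr
    _ < ‖x‖ ^ s * ‖x‖ := by gcongr

lemma norm_pow_sub_le {x y : F} (hx : ‖x‖ ≤ 1) (hy : ‖y‖ ≤ 1) (s : ℕ) :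
    ‖x ^ s - y ^ s‖ ≤ ‖x - y‖ := by
  rw [← Commute.mul_geom_sum₂ (Commute.all x y), norm_mul]
  have : ‖∑ i ∈ Finset.range s, x ^ i * y ^ (s - 1 - i)‖ ≤ 1 := by
    refine IsUltrametricDist.norm_sum_le_of_forall_le_of_nonneg (by positivity) ?_
    intro i hi
    rw [norm_mul, norm_pow, norm_pow]
    exact mul_le_one₀ (pow_le_one₀ (norm_nonneg _) hx) (by positivity)
      (pow_le_one₀ (norm_nonneg _) hy)
  calc _ ≤ ‖x - y‖ * 1 := by gcongr
    _ = _ := mul_one _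

lemma norm_eq_of_sub_lt {x y : F} (h : ‖x - y‖ < ‖x‖) : ‖y‖ = ‖x‖ := by
  have : y = x + (-(x - y)) := by ring
  rw [this]
  rw [IsUltrametricDist.norm_add_eq_max_of_norm_ne_norm]
  · rw [norm_neg]; exact max_eq_left h.le
  · rw [norm_neg]; exact h.ne'

lemma norm_le_one_of_isIntegral {S : Type*} [CommRing S] [Algebra S F]
    (hS : ∀ s : S, ‖algebraMap S F s‖ ≤ 1) {h : F} (hi : IsIntegral S h) : ‖h‖ ≤ 1 := by
  obtain ⟨P, hP, hP0⟩ := hi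
  by_contra! hlt
  have h0 : h ≠ 0 := by rintro rfl; simp at hlt; linarith
  set J := P.natDegree with hJ
  have hJ0 : J ≠ 0 := by
    intro hJ1
    have : P = 1 := hP.natDegree_eq_zero.1 (hJ ▸ hJ1)
    simp [this] at hP0
  have e : h ^ J = -∑ i ∈ Finset.range J, algebraMap S F (P.coeff i) * h ^ i := by
    rw [Polynomial.eval₂_eq_sum_range, Finset.sum_range_succ, ← hJ] at hP0
    have : P.coeff J = 1 := hP
    rw [this, map_one, one_mul] at hP0
    linear_combination hP0
  have : ‖h ^ J‖ ≤ ‖h‖ ^ (J - 1) := by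
    rw [e, norm_neg]
    refine IsUltrametricDist.norm_sum_le_of_forall_le_of_nonneg (by positivity) ?_
    intro i hi
    have hi' : i < J := by simpa using hi
    rw [norm_mul, norm_pow]
    calc _ ≤ 1 * ‖h‖ ^ i := by gcongr; exact hS _
      _ ≤ ‖h‖ ^ (J - 1) := by rw [one_mul]; exact pow_le_pow_right₀ hlt.le (by omega)
  rw [norm_pow] at this
  have h3 := pow_lt_pow_right₀ hlt (show J - 1 < J by omega)
  linarith

end Ultra

namespace Base

variable {S F : Type*} [CommRing S] [IsDomain S] [NontriviallyNormedField F]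
  [IsUltrametricDist F] [Algebra S F] {v : S → ℕ} (B : Base S F v)

include B

lemma norm_le_one (s : S) : ‖algebraMap S F s‖ ≤ 1 := by
  by_cases h : s = 0
  · simp [h]
  · rw [B.norm_eq s h]; exact pow_le_one₀ (by norm_num) (by norm_num)

lemma map_ne_zero {s : S} (h : s ≠ 0) : algebraMap S F s ≠ 0 := by
  rw [← norm_pos_iff, B.norm_eq s h]; positivity

lemma v_pow {t : S} (h : t ≠ 0) (J : ℕ) : v (t ^ J) = J * v t := by
  have h1 := B.norm_eq (t ^ J) (pow_ne_zero _ h)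
  rw [map_pow, norm_pow, B.norm_eq t h, ← pow_mul, mul_comm] at h1
  exact (pow_right_injective₀ (by norm_num : (0:ℝ) < 1/2) (by norm_num) h1).symm

lemma norm_zpow {h : F} (h0 : h ≠ 0) : ∃ k : ℤ, ‖h‖ = (1/2 : ℝ) ^ k := by
  obtain ⟨u, w, hw, h1⟩ := B.dense h h0
  have h2 := norm_eq_of_sub_lt h1
  have hw' := B.map_ne_zero hw
  have hu : u ≠ 0 := by
    rintro rfl
    rw [map_zero, norm_zero] at h2
    exact mul_ne_zero hw' h0 (norm_eq_zero.1 h2.symm)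
  rw [norm_mul, B.norm_eq u hu, B.norm_eq w hw] at h2
  refine ⟨(v u : ℤ) - v w, ?_⟩
  rw [zpow_sub₀ (by norm_num), zpow_natCast, zpow_natCast, h2]
  field_simp

lemma norm_integral_le_one {h : F} (hi : IsIntegral S h) : ‖h‖ ≤ 1 :=
  norm_le_one_of_isIntegral B.norm_le_one hi

lemma improve {h : F} (h0 : h ≠ 0) (hi : IsIntegral S h)
    (happ : ∀ C : ℕ, ∃ t g : S, t ≠ 0 ∧
      ‖algebraMap S F t * h - algebraMap S F g‖ ≤ (1/2 : ℝ) ^ (C * v t + C)) :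
    ∃ z : S, ‖h - algebraMap S F z‖ < ‖h‖ := by
  obtain ⟨u, w, hw, h1⟩ := B.dense h h0
  have h2 := norm_eq_of_sub_lt h1
  have hw' := B.map_ne_zero hw
  have hwn : 0 < ‖algebraMap S F w‖ := norm_pos_iff.2 hw'
  have hu : u ≠ 0 := by
    rintro rfl
    rw [map_zero, norm_zero] at h2
    exact mul_ne_zero hw' h0 (norm_eq_zero.1 h2.symm)
  rcases B.dich u w hu hw with ⟨z, hz⟩ | hs
  · refine ⟨z, ?_⟩
    rw [h2] at hz
    have : ‖algebraMap S F w * (h - algebraMap S F z)‖ < ‖algebraMap S F w * h‖ := by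
      have e : algebraMap S F w * (h - algebraMap S F z)
        = (algebraMap S F w * h - algebraMap S F u) + algebraMap S F (u - z * w) := by
        simp only [map_sub, map_mul]; ring
      rw [e]
      exact (IsUltrametricDist.norm_add_le_max _ _).trans_lt (max_lt h1 hz)
    rw [norm_mul, norm_mul] at this
    exact lt_of_mul_lt_mul_left this hwn.le
  · exfalso
    have hle := B.norm_integral_le_one hi
    obtain ⟨k, hk⟩ := B.norm_zpow h0
    have hk0 : 0 ≤ k := by
      by_contra! hk'
      rw [hk] at hle
      have : (1:ℝ) < (1/2) ^ k := one_lt_zpow_of_neg₀ (by norm_num) (by norm_num) hk'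
      linarith
    lift k to ℕ using hk0
    rw [zpow_natCast] at hk
    obtain ⟨P, hP, hP0⟩ := hi
    set J := P.natDegree with hJ
    obtain ⟨t, g, ht, htg⟩ := happ (J * (1 + k) + k + 1)
    set s := J * v t + 1 with hsdef
    set r := (Polynomial.X ^ s : Polynomial S) %ₘ P with hr
    have hrh : h ^ s = Polynomial.aeval h r := by
      rw [hr]
      rw [Polynomial.aeval_modByMonic_eq_self_of_root (by simpa [Polynomial.aeval_def] using hP0)]
      simp
    have hJ0 : J ≠ 0 := by
      intro hJ1
      have : P = 1 := hP.natDegree_eq_zero.1 (hJ ▸ hJ1)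
      simp [this] at hP0
    have hrdeg : r.natDegree < J := by
      apply Polynomial.natDegree_modByMonic_lt _ hP
      rintro rfl
      simp at hP0
    set G : S := ∑ j ∈ Finset.range J, r.coeff j * t ^ (J - j) * g ^ j with hG
    have ht' := B.map_ne_zero ht
    have htn : ‖algebraMap S F t‖ = _ := B.norm_eq t ht
    have key : ‖algebraMap S F (t ^ J) * h ^ s - algebraMap S F G‖ ≤
        ‖algebraMap S F t * h - algebraMap S F g‖ := by
      have e : algebraMap S F (t ^ J) * h ^ s - algebraMap S F G =
        ∑ j ∈ Finset.range J, algebraMap S F (r.coeff j * t ^ (J - j)) *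
          ((algebraMap S F t * h) ^ j - (algebraMap S F g) ^ j) := by
        rw [hrh, Polynomial.aeval_eq_sum_range' hrdeg, hG, map_sum, Finset.mul_sum,
          ← Finset.sum_sub_distrib]
        refine Finset.sum_congr rfl fun j hj => ?_
        have hj' : j ≤ J := by have := Finset.mem_range.1 hj; omega
        have : t ^ J = t ^ (J - j) * t ^ j := by rw [← pow_add]; congr 1; omega
        rw [this, Algebra.smul_def]
        simp only [map_mul, map_pow, mul_pow]
        ring
      rw [e]
      refine IsUltrametricDist.norm_sum_le_of_forall_le_of_nonneg (by positivity) ?_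
      intro j _
      rw [norm_mul]
      calc _ ≤ 1 * ‖algebraMap S F t * h - algebraMap S F g‖ := by
            gcongr
            · exact B.norm_le_one _
            · apply norm_pow_sub_le
              · rw [norm_mul]
                exact mul_le_one₀ (B.norm_le_one _) (norm_nonneg _) hle
              · exact B.norm_le_one _
        _ = _ := one_mul _
    have hth : ‖algebraMap S F (t ^ J) * h ^ s‖ = (1/2 : ℝ) ^ (J * (1 + k) * v t + k) := by
      rw [norm_mul, map_pow, norm_pow, norm_pow, htn, hk, ← pow_mul, ← pow_mul, ← pow_add]
      congr 1
      rw [hsdef]; ring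
    have key2 : ‖algebraMap S F (t ^ J) * h ^ s - algebraMap S F G‖ <
        ‖algebraMap S F (t ^ J) * h ^ s‖ := by
      refine (key.trans htg).trans_lt ?_
      rw [hth]
      apply pow_lt_pow_right_of_lt_one₀ (by norm_num) (by norm_num)
      nlinarith [Nat.zero_le (k * v t), Nat.zero_le (J * (1+k)), Nat.zero_le (v t)]
    have hus : ‖algebraMap S F (t ^ J * u ^ s)‖ =
      ‖algebraMap S F (t ^ J) * (algebraMap S F w * h) ^ s‖ := by
      rw [map_mul, norm_mul, norm_mul, map_pow _ u, norm_pow, norm_pow, h2]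
    have := hs (t ^ J) G s (pow_ne_zero _ ht) (by
      have e : algebraMap S F (t ^ J * u ^ s - G * w ^ s) =
        -(algebraMap S F (t ^ J) * ((algebraMap S F w * h) ^ s - (algebraMap S F u) ^ s))
        + algebraMap S F w ^ s * (algebraMap S F (t ^ J) * h ^ s - algebraMap S F G) := by
        simp only [map_sub, map_mul, map_pow]; ring
      rw [e, hus]
      refine (IsUltrametricDist.norm_add_le_max _ _).trans_lt (max_lt ?_ ?_)
      · rw [norm_neg, norm_mul, norm_mul, norm_pow]
        have := norm_pow_sub_lt h1 (s := s) (by omega)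
        have h5 : 0 < ‖algebraMap S F (t ^ J)‖ := norm_pos_iff.2 (B.map_ne_zero (pow_ne_zero _ ht))
        gcongr
      · have e2 : algebraMap S F (t ^ J) * (algebraMap S F w * h) ^ s =
          algebraMap S F w ^ s * (algebraMap S F (t ^ J) * h ^ s) := by ring
        rw [e2, norm_mul, norm_mul]
        have h5 : 0 < ‖algebraMap S F w ^ s‖ := by rw [norm_pow]; positivity
        gcongr)
    rw [B.v_pow ht] at this
    omega

/-- The Liouville lemma. -/
lemma liouville {h : F} (hi : IsIntegral S h)
    (happ : ∀ C : ℕ, ∃ t g : S, t ≠ 0 ∧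
      ‖algebraMap S F t * h - algebraMap S F g‖ ≤ (1/2 : ℝ) ^ (C * v t + C)) :
    ∃ z : S, algebraMap S F z = h := by
  have P : ∀ n : ℕ, ∃ z : S, ‖h - algebraMap S F z‖ ≤ (1/2 : ℝ) ^ n := by
    intro n
    induction n with
    | zero => exact ⟨0, by simpa using B.norm_integral_le_one hi⟩
    | succ n ih =>
      obtain ⟨z, hz⟩ := ih
      by_cases h0 : h - algebraMap S F z = 0
      · exact ⟨z, by rw [h0, norm_zero]; positivity⟩
      obtain ⟨z', hz'⟩ := B.improve h0 (hi.sub isIntegral_algebraMap) (by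
        intro C
        obtain ⟨t, g, ht, htg⟩ := happ C
        refine ⟨t, g - t * z, ht, ?_⟩
        convert htg using 2
        simp only [map_sub, map_mul]; ring)
      refine ⟨z + z', ?_⟩
      have e : h - algebraMap S F (z + z') = h - algebraMap S F z - algebraMap S F z' := by
        rw [map_add]; ring
      rw [e]
      set y := h - algebraMap S F z - algebraMap S F z'
      by_cases hy : y = 0
      · rw [hy, norm_zero]; positivity
      obtain ⟨k, hk⟩ := B.norm_zpow hy
      have := hz'.trans_le hz
      rw [hk, ← zpow_natCast] at this
      rw [hk, ← zpow_natCast]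
      have h3 : (n : ℤ) < k := by
        by_contra! hc
        have := zpow_le_zpow_right_of_le_one₀ (by norm_num : (0:ℝ) < 1/2) (by norm_num) hc
        linarith
      apply zpow_le_zpow_right_of_le_one₀ (by norm_num) (by norm_num)
      push_cast; omega
  choose s hs using P
  obtain ⟨l, hl⟩ := B.complete s (by
    intro n
    have e : algebraMap S F (s (n+1) - s n) =
      (h - algebraMap S F (s n)) - (h - algebraMap S F (s (n+1))) := by rw [map_sub]; ring
    rw [e]
    refine (Izumi.nsub_le_max _ _).trans (max_le (hs n) ((hs _).trans ?_))
    exact pow_le_pow_of_le_one (by norm_num) (by norm_num) (by omega))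
  refine ⟨l, ?_⟩
  have hn : ∀ n : ℕ, ‖h - algebraMap S F l‖ ≤ (1/2 : ℝ) ^ n := by
    intro n
    have e : h - algebraMap S F l = (h - algebraMap S F (s n)) - algebraMap S F (l - s n) := by
      rw [map_sub]; ring
    rw [e]
    exact (Izumi.nsub_le_max _ _).trans (max_le (hs n) (hl n))
  have : ‖h - algebraMap S F l‖ ≤ 0 :=
    ge_of_tendsto' (tendsto_pow_atTop_nhds_zero_of_lt_one (by norm_num) (by norm_num)) hn
  have := norm_le_zero_iff.1 this
  rw [sub_eq_zero] at this
  exact this.symm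

end Base

end Izumi

set_option linter.unusedSectionVars false

namespace Izumi

open Polynomial

section PolyNorm

variable {Ω : Type*} [NormedField Ω] [IsUltrametricDist Ω]

lemma coeff_mul_le {p q : Polynomial Ω} {a b : ℝ} (ha : 0 ≤ a) (hb : 0 ≤ b) (hp : ∀ i, ‖p.coeff i‖ ≤ a)
    (hq : ∀ i, ‖q.coeff i‖ ≤ b) (i : ℕ) : ‖(p * q).coeff i‖ ≤ a * b := by
  rw [coeff_mul]
  refine IsUltrametricDist.norm_sum_le_of_forall_le_of_nonneg (by positivity) ?_
  intro x _
  rw [norm_mul]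
  exact mul_le_mul (hp _) (hq _) (norm_nonneg _) ha

lemma coeff_X_sub_le {z : Ω} (hz : ‖z‖ ≤ 1) (i : ℕ) : ‖(X - C z).coeff i‖ ≤ 1 := by
  rw [coeff_sub]
  refine (nsub_le_max _ _).trans (max_le ?_ ?_)
  · rw [coeff_X]; split_ifs <;> simp
  · rw [coeff_C]; split_ifs <;> simp [hz]

lemma coeff_prod_le (s : Multiset Ω) (hs : ∀ z ∈ s, ‖z‖ ≤ 1) (i : ℕ) :
    ‖((s.map fun z => X - C z).prod).coeff i‖ ≤ 1 := by
  induction s using Multiset.induction generalizing i with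
  | empty => 
    simp only [Multiset.map_zero, Multiset.prod_zero, coeff_one]; split_ifs <;> simp
  | cons a s ih =>
    rw [Multiset.map_cons, Multiset.prod_cons]
    have := coeff_mul_le zero_le_one zero_le_one (coeff_X_sub_le (hs a (by simp)))
      (fun i => ih (fun z hz => hs z (by simp [hz])) i) i
    simpa using this

lemma coeff_prod_small {ε : ℝ} (hε0 : 0 ≤ ε) (hε : ε ≤ 1) (s : Multiset Ω)
    (hs : ∀ z ∈ s, ‖z‖ ≤ ε) (i : ℕ) :
    ‖((s.map fun z => X - C z).prod - X ^ (Multiset.card s)).coeff i‖ ≤ ε := by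
  induction s using Multiset.induction generalizing i with
  | empty => simpa using hε0
  | cons a s ih =>
    rw [Multiset.map_cons, Multiset.prod_cons, Multiset.card_cons]
    set Q := (s.map fun z => X - C z).prod with hQ
    have e : (X - C a) * Q - X ^ (Multiset.card s + 1) = X * (Q - X ^ (Multiset.card s)) - C a * Q := by
      ring
    rw [e, coeff_sub]
    refine (nsub_le_max _ _).trans (max_le ?_ ?_)
    · cases i with
      | zero => simpa using hε0
      | succ i =>
        rw [coeff_X_mul]; exact ih (fun z hz => hs z (by simp [hz])) i
    · rw [coeff_C_mul, norm_mul]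
      calc _ ≤ ε * 1 := by
            gcongr
            · exact hs a (by simp)
            · exact coeff_prod_le s (fun z hz => (hs z (by simp [hz])).trans hε) i
        _ = ε := mul_one _

lemma le_norm_prod {δ : ℝ} (hδ : 0 ≤ δ) (s : Multiset Ω) (hs : ∀ z ∈ s, δ ≤ ‖z‖) :
    δ ^ (Multiset.card s) ≤ ‖((s.map fun z => X - C z).prod).coeff 0‖ := by
  induction s using Multiset.induction with
  | empty => simp
  | cons a s ih =>
    rw [Multiset.map_cons, Multiset.prod_cons, mul_coeff_zero, Multiset.card_cons, norm_mul,
      pow_succ, mul_comm]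
    gcongr
    · simpa using hs a (by simp)
    · exact ih (fun z hz => hs z (by simp [hz]))

end PolyNorm

section Sep

variable {S F K L Ω : Type*} [CommRing S] [IsDomain S] [NontriviallyNormedField F]
  [IsUltrametricDist F] [Algebra S F] {v : S → ℕ} (B : Base S F v)
  [Field K] [Algebra S K] [IsFractionRing S K] [Algebra K F] [IsScalarTower S K F]
  [Field L] [Algebra K L] [FiniteDimensional K L] [Algebra.IsSeparable K L]
  [Algebra S L] [IsScalarTower S K L]
  [NormedField Ω] [IsUltrametricDist Ω] [NormedAlgebra F Ω] [IsAlgClosed Ω] [Normal F Ω]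
  [Algebra K Ω] [IsScalarTower K F Ω] [Algebra S Ω] [IsScalarTower S K Ω] [IsScalarTower S F Ω]
  (hgal : ∀ (g : Ω ≃ₐ[F] Ω) (x : Ω), ‖g x‖ = ‖x‖)

include B in
lemma Base.isIntegrallyClosed (K : Type*) [Field K] [Algebra S K] [IsFractionRing S K]
    [Algebra K F] [IsScalarTower S K F] : IsIntegrallyClosed S := by
  rw [isIntegrallyClosed_iff K]
  intro x hx
  obtain ⟨z, hz⟩ := B.liouville (h := algebraMap K F x)
    ((isIntegral_algebraMap_iff (algebraMap K F).injective).2 hx) (by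
      intro C
      obtain ⟨⟨g, t⟩, hgt⟩ := IsLocalization.surj (nonZeroDivisors S) x
      refine ⟨t, g, nonZeroDivisors.ne_zero t.2, ?_⟩
      have : algebraMap S F t * algebraMap K F x - algebraMap S F g = 0 := by
        rw [IsScalarTower.algebraMap_apply S K F, IsScalarTower.algebraMap_apply S K F g, ← map_mul,
          ← map_sub]
        simp only at hgt
        rw [mul_comm, hgt, sub_self, map_zero]
      rw [this, norm_zero]; positivity)
  refine ⟨z, (algebraMap K F).injective ?_⟩
  rw [← hz, ← IsScalarTower.algebraMap_apply]

include B in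
lemma norm_S_le (s : S) : ‖algebraMap S Ω s‖ ≤ 1 := by
  rw [IsScalarTower.algebraMap_apply S F Ω, norm_algebraMap']
  exact B.norm_le_one s

include B in
lemma norm_sigma_le {x : L} (hx : IsIntegral S x) (σ : L →ₐ[K] Ω) : ‖σ x‖ ≤ 1 :=
  norm_le_one_of_isIntegral (norm_S_le (F := F) B) (hx.map (σ.restrictScalars S))

include hgal in
/-- A sum of conjugates over a Galois stable set comes from `F`. -/
lemma sum_mem_range (V : Finset (L →ₐ[K] Ω))
    (hV : ∀ (g : Ω ≃ₐ[F] Ω) (σ : L →ₐ[K] Ω), σ ∈ V → (g.toAlgHom.restrictScalars K).comp σ ∈ V)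
    (x : L) : ∃ h : F, algebraMap F Ω h = ∑ σ ∈ V, σ x := by
  classical
  set y := ∑ σ ∈ V, σ x with hy
  have hsep : IsSeparable F y := by
    rw [← mem_separableClosure_iff]
    refine sum_mem fun σ _ => ?_
    rw [mem_separableClosure_iff]
    apply IsSeparable.tower_top (F := K)
    exact IsSeparable.map σ σ.toRingHom.injective (Algebra.IsSeparable.isSeparable K x)
  have hbot : y ∈ (⊥ : Subalgebra F Ω) := by
    by_contra hn
    rw [notMem_iff_exists_ne_and_isConjRoot hsep (IsAlgClosed.splits _)] at hn
    obtain ⟨z, hz, hc⟩ := hn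
    obtain ⟨g, hg⟩ := isConjRoot_iff_exists_algEquiv.1 hc.symm
    apply hz
    rw [← hg, hy, map_sum]
    symm
    refine Finset.sum_bij (fun σ _ => (g.toAlgHom.restrictScalars K).comp σ) (fun σ hσ => hV g σ hσ)
      ?_ ?_ ?_
    · intro σ _ τ _ h
      ext a
      have := DFunLike.congr_fun h a
      exact g.injective this
    · intro σ hσ
      refine ⟨(g.symm.toAlgHom.restrictScalars K).comp σ, hV _ _ hσ, ?_⟩
      ext a
      simp
    · intro σ _
      rfl
  obtain ⟨h, hh⟩ := Algebra.mem_bot.1 hbot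
  exact ⟨h, hh⟩

include B hgal in
/-- The gap lemma: no proper nonempty set of embeddings is separated by arbitrarily large gaps. -/
lemma gap_false (V : Finset (L →ₐ[K] Ω)) (hne : V.Nonempty) (hnu : ∃ σ, σ ∉ V)
    (hV : ∀ D : ℕ, 1 ≤ D → ∃ (x : L) (P : ℕ), x ≠ 0 ∧ IsIntegral S x ∧ 1 ≤ P ∧
      ∀ σ : L →ₐ[K] Ω, (σ ∈ V → (1/2 : ℝ) ^ P < ‖σ x‖) ∧ (σ ∉ V → ‖σ x‖ ≤ (1/2 : ℝ) ^ (D * P))) :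
    False := by
  classical
  haveI := B.isIntegrallyClosed K
  have hSL : Function.Injective (algebraMap S L) := by
    rw [IsScalarTower.algebraMap_eq S K L]
    exact (algebraMap K L).injective.comp (IsFractionRing.injective S K)
  have hstab : ∀ (g : Ω ≃ₐ[F] Ω) (σ : L →ₐ[K] Ω), σ ∈ V →
      (g.toAlgHom.restrictScalars K).comp σ ∈ V := by
    obtain ⟨x, P, -, -, -, h⟩ := hV 1 le_rfl
    intro g σ hσ
    by_contra hc
    have h1 := (h _).2 hc
    have h2 := (h _).1 hσ
    have : ‖((g.toAlgHom.restrictScalars K).comp σ) x‖ = ‖σ x‖ := hgal g (σ x)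
    rw [this, one_mul] at h1
    linarith
  -- sums over V of integral elements are in S
  have hS : ∀ w : L, IsIntegral S w → ∃ z : S, algebraMap S Ω z = ∑ σ ∈ V, σ w := by
    intro w hw
    obtain ⟨h, hh⟩ := sum_mem_range (F := F) hgal V hstab w
    have hhIntegral : IsIntegral S h := by
      rw [← isIntegral_algebraMap_iff (algebraMap F Ω).injective, hh]
      exact IsIntegral.sum _ fun σ _ => hw.map (σ.restrictScalars S)
    obtain ⟨z, hz⟩ := B.liouville hhIntegral (by
      intro c
      set e := Module.finrank K L with he
      obtain ⟨a, P, ha0, ha, hP, hσ⟩ := hV (c * e + c + e + 1) (by omega)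
      set D := c * e + c + e + 1 with hD
      set ε : ℝ := (1/2 : ℝ) ^ (D * P) with hε
      have hε0 : 0 ≤ ε := by positivity
      have hε1 : ε ≤ 1 := pow_le_one₀ (by norm_num) (by norm_num)
      set f := minpoly S a with hf
      have hfK : minpoly K a = f.map (algebraMap S K) :=
        minpoly.isIntegrallyClosed_eq_field_fractions' K ha
      have hfm : f.Monic := minpoly.monic ha
      set fΩ := f.map (algebraMap S Ω) with hfΩ
      have hfKΩ : fΩ = (minpoly K a).map (algebraMap K Ω) := by
        rw [hfK, Polynomial.map_map, ← IsScalarTower.algebraMap_eq]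
      have hfΩm : fΩ.Monic := hfm.map _
      have hsplit := (IsAlgClosed.splits fΩ).eq_prod_roots_of_monic hfΩm
      have hroot : ∀ z, z ∈ fΩ.roots ↔ ∃ σ : L →ₐ[K] Ω, σ a = z := by
        intro z
        have := Algebra.IsAlgebraic.range_eval_eq_rootSet_minpoly (F := K) Ω a
        have h2 : z ∈ (minpoly K a).rootSet Ω ↔ z ∈ fΩ.roots := by
          rw [mem_rootSet_of_ne (minpoly.ne_zero ha.tower_top), mem_roots hfΩm.ne_zero, hfKΩ,
            IsRoot.def, eval_map_algebraMap]
        rw [← h2, ← this]; rfl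
      set ZV := fΩ.roots.filter (fun z => (1/2 : ℝ) ^ P < ‖z‖) with hZV
      set ZU := fΩ.roots.filter (fun z => ¬ (1/2 : ℝ) ^ P < ‖z‖) with hZU
      have hr1 : ∀ z ∈ fΩ.roots, ‖z‖ ≤ 1 := by
        intro z hz
        obtain ⟨σ, rfl⟩ := (hroot z).1 hz
        exact norm_sigma_le (F := F) B ha σ
      have hUs : ∀ z ∈ ZU, ‖z‖ ≤ ε := by
        intro z hz
        rw [hZU, Multiset.mem_filter] at hz
        obtain ⟨σ, rfl⟩ := (hroot z).1 hz.1
        exact (hσ σ).2 fun hσV => hz.2 ((hσ σ).1 hσV)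
      set fV := (ZV.map fun z => X - C z).prod with hfV
      set fU := (ZU.map fun z => X - C z).prod with hfU
      set u := Multiset.card ZU with hu
      have hprod : fΩ = fU * fV := by
        rw [hsplit, hfU, hfV, ← Multiset.prod_add, ← Multiset.map_add, add_comm,
          Multiset.filter_add_not]
      have hfVb : ∀ i, ‖fV.coeff i‖ ≤ 1 := 
        coeff_prod_le _ fun z hz => hr1 z (Multiset.mem_of_mem_filter hz)
      have hdiff : ∀ i, ‖fΩ.coeff (u + i) - fV.coeff i‖ ≤ ε := by
        intro i
        have := coeff_mul_le hε0 zero_le_one (coeff_prod_small hε0 hε1 ZU hUs) hfVb (i + u)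
        rw [mul_one, ← hfU, sub_mul, ← hprod, coeff_sub, coeff_X_pow_mul, add_comm] at this
        exact this
      have hcardV : Multiset.card ZV ≤ e := by
        refine (Multiset.card_le_card (Multiset.filter_le _ _)).trans ?_
        refine (card_roots' _).trans ?_
        rw [hfKΩ]
        exact natDegree_map_le.trans (minpoly.natDegree_le a)
      set t : S := f.coeff u with ht
      have htΩ : algebraMap S Ω t = fΩ.coeff u := by rw [hfΩ, coeff_map]
      have hfV0 : (1/2 : ℝ) ^ (P * e) ≤ ‖fV.coeff 0‖ := by
        refine le_trans ?_ (le_norm_prod (δ := (1/2:ℝ)^P) (by positivity) ZV ?_)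
        · rw [← pow_mul]
          exact pow_le_pow_of_le_one (by norm_num) (by norm_num) (by gcongr)
        · intro z hz
          exact (Multiset.of_mem_filter (p := fun z => (1/2 : ℝ) ^ P < ‖z‖) hz).le
      have htn : (1/2 : ℝ) ^ (P * e) ≤ ‖algebraMap S Ω t‖ := by
        have h1 := hdiff 0
        rw [add_zero, ← htΩ, norm_sub_rev] at h1
        have h2 : ε < (1/2 : ℝ) ^ (P * e) := by
          apply pow_lt_pow_right_of_lt_one₀ (by norm_num) (by norm_num)
          rw [hD]; nlinarith [Nat.zero_le (c * e * P), Nat.zero_le (c * P)]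
        have := norm_eq_of_sub_lt (h1.trans_lt (h2.trans_le hfV0))
        rw [this]; exact hfV0
      have htF : ‖algebraMap S F t‖ = ‖algebraMap S Ω t‖ := by
        rw [IsScalarTower.algebraMap_apply S F Ω, norm_algebraMap']
      have ht0 : t ≠ 0 := by
        intro h0
        rw [h0, map_zero, norm_zero] at htn
        have : (0:ℝ) < (1/2) ^ (P * e) := by positivity
        linarith
      have hvt : v t ≤ P * e := by
        rw [← htF, B.norm_eq t ht0] at htn
        by_contra! hlt
        have := pow_lt_pow_right_of_lt_one₀ (by norm_num : (0:ℝ) < 1/2) (by norm_num) hlt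
        linarith
      set N := f.natDegree + 1 with hN
      set q : L := ∑ i ∈ Finset.range N, algebraMap S L (f.coeff (u + i)) * a ^ i with hq
      have hqi : IsIntegral S q := IsIntegral.sum _ fun i _ => 
        isIntegral_algebraMap.mul (ha.pow i)
      have hσq : ∀ σ : L →ₐ[K] Ω, σ q = ∑ i ∈ Finset.range N, fΩ.coeff (u + i) * (σ a) ^ i := by
        intro σ
        rw [hq, map_sum]
        refine Finset.sum_congr rfl fun i _ => ?_
        rw [map_mul, map_pow, hfΩ, coeff_map]
        congr 1
        exact (σ.restrictScalars S).commutes _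
      have hqV : ∀ σ ∈ V, ‖σ q‖ ≤ ε := by
        intro σ hσV
        have hz : σ a ∈ ZV := by
          rw [hZV, Multiset.mem_filter]
          exact ⟨(hroot _).2 ⟨σ, rfl⟩, (hσ σ).1 hσV⟩
        have hev : fV.eval (σ a) = 0 := by
          rw [hfV, eval_multiset_prod, Multiset.prod_eq_zero_iff, Multiset.map_map,
            Multiset.mem_map]
          exact ⟨σ a, hz, by simp⟩
        have hdeg : fV.natDegree < N := by
          rw [hN, Nat.lt_succ_iff]
          have : fV.natDegree ≤ fΩ.natDegree := by
            apply natDegree_le_of_dvd _ hfΩm.ne_zero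
            rw [hprod]; exact dvd_mul_left _ _
          exact this.trans natDegree_map_le
        rw [eval_eq_sum_range' hdeg] at hev
        have : σ q = ∑ i ∈ Finset.range N, (fΩ.coeff (u + i) - fV.coeff i) * (σ a) ^ i := by
          simp only [sub_mul, Finset.sum_sub_distrib]
          rw [hev, hσq, sub_zero]
        rw [this]
        refine IsUltrametricDist.norm_sum_le_of_forall_le_of_nonneg hε0 fun i _ => ?_
        rw [norm_mul, norm_pow]
        calc _ ≤ ε * 1 := by
              gcongr
              · exact hdiff i
              · exact pow_le_one₀ (norm_nonneg _) (norm_sigma_le (F := F) B ha σ)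
          _ = ε := mul_one _
      have hqU : ∀ σ ∉ V, ‖algebraMap S Ω t - σ q‖ ≤ ε := by
        intro σ hσU
        have : algebraMap S Ω t - σ q =
            -∑ i ∈ Finset.range f.natDegree, fΩ.coeff (u + (i + 1)) * (σ a) ^ (i + 1) := by
          rw [hσq, hN, Finset.sum_range_succ', htΩ]
          simp
        rw [this, norm_neg]
        refine IsUltrametricDist.norm_sum_le_of_forall_le_of_nonneg hε0 fun i _ => ?_
        rw [norm_mul, norm_pow]
        have h1 : ‖fΩ.coeff (u + (i + 1))‖ ≤ 1 := by
          rw [hfΩ, coeff_map]; exact norm_S_le (F := F) B _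
        have h2 := (hσ σ).2 hσU
        calc _ ≤ 1 * ε ^ (i + 1) := by gcongr
          _ ≤ ε := by rw [one_mul, pow_succ]; exact mul_le_of_le_one_left hε0 (pow_le_one₀ hε0 hε1)
      have hTr : IsIntegral S (Algebra.trace K L ((algebraMap S L t - q) * w)) :=
        Algebra.isIntegral_trace ((isIntegral_algebraMap.sub hqi).mul hw)
      obtain ⟨G, hG⟩ := IsIntegrallyClosed.isIntegral_iff.1 hTr
      have hGΩ : algebraMap S Ω G = ∑ σ : L →ₐ[K] Ω, (algebraMap S Ω t - σ q) * σ w := by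
        rw [IsScalarTower.algebraMap_apply S K Ω, hG, trace_eq_sum_embeddings Ω]
        refine Finset.sum_congr rfl fun σ _ => ?_
        rw [map_mul, map_sub]
        congr 2
        exact (σ.restrictScalars S).commutes _
      refine ⟨t, G, ht0, ?_⟩
      rw [← norm_algebraMap' Ω, map_sub, map_mul, hh, ← IsScalarTower.algebraMap_apply,
        ← IsScalarTower.algebraMap_apply, hGΩ, ← Finset.sum_add_sum_compl V, Finset.mul_sum,
        ← sub_sub, ← Finset.sum_sub_distrib]
      refine le_trans (b := ε) ?_ ?_
      · refine (nsub_le_max _ _).trans (max_le ?_ ?_)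
        · refine IsUltrametricDist.norm_sum_le_of_forall_le_of_nonneg hε0 fun σ hσV => ?_
          have : algebraMap S Ω t * σ w - (algebraMap S Ω t - σ q) * σ w = σ q * σ w := by ring
          rw [this, norm_mul]
          exact (mul_le_mul (hqV σ hσV) (norm_sigma_le (F := F) B hw σ) (norm_nonneg _) hε0).trans_eq
            (mul_one _)
        · refine IsUltrametricDist.norm_sum_le_of_forall_le_of_nonneg hε0 fun σ hσV => ?_
          rw [norm_mul]
          exact (mul_le_mul (hqU σ (by simpa using hσV)) (norm_sigma_le (F := F) B hw σ)
            (norm_nonneg _) hε0).trans_eq (mul_one _)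
      · apply pow_le_pow_of_le_one (by norm_num) (by norm_num)
        rw [hD]
        nlinarith [Nat.mul_le_mul_left c hvt, Nat.mul_le_mul_left c hP, Nat.zero_le (e * P)])
    refine ⟨z, ?_⟩
    rw [← hh, ← hz, ← IsScalarTower.algebraMap_apply]
  -- hence the sum over V is K-valued
  have hK : ∀ y : L, ∃ k : K, algebraMap K Ω k = ∑ σ ∈ V, σ y := by
    intro y
    have : IsAlgebraic S y := (IsFractionRing.isAlgebraic_iff S K L).2 (Algebra.IsAlgebraic.isAlgebraic y)
    obtain ⟨s, hs0, hs⟩ := this.exists_integral_multiple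
    obtain ⟨z, hz⟩ := hS _ hs
    have hsK : algebraMap S K s ≠ 0 := by
      simpa using hs0
    refine ⟨(algebraMap S K s)⁻¹ * algebraMap S K z, ?_⟩
    rw [map_mul, ← IsScalarTower.algebraMap_apply, hz, map_inv₀]
    rw [inv_mul_eq_iff_eq_mul₀ (by simpa using hs0), Finset.mul_sum]
    refine Finset.sum_congr rfl fun σ _ => ?_
    rw [← IsScalarTower.algebraMap_apply, Algebra.smul_def, map_mul]
    congr 1
    exact (σ.restrictScalars S).commutes _
  choose τ hτ using hK
  let τl : L →ₗ[K] K :=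
    { toFun := τ
      map_add' := fun x y => (algebraMap K Ω).injective (by
        rw [map_add, hτ, hτ, hτ, ← Finset.sum_add_distrib]; simp)
      map_smul' := fun k x => (algebraMap K Ω).injective (by
        simp only [RingHom.id_apply, smul_eq_mul]
        rw [map_mul, hτ, hτ, Finset.mul_sum]
        refine Finset.sum_congr rfl fun σ _ => ?_
        rw [map_smul, Algebra.smul_def]) }
  set z : L := (LinearMap.BilinForm.toDual (Algebra.traceForm K L)
    (traceForm_nondegenerate K L)).symm τl with hz
  have hzt : ∀ y, Algebra.trace K L (z * y) = τ y := by
    intro y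
    have := LinearMap.BilinForm.apply_toDual_symm_apply (B := Algebra.traceForm K L)
      (hB := traceForm_nondegenerate K L) τl y
    exact this
  have hli : LinearIndependent Ω (fun σ : L →ₐ[K] Ω => (σ : L → Ω)) := by
    have := linearIndependent_monoidHom L Ω
    exact this.comp (fun σ : L →ₐ[K] Ω => ((σ : L →+* Ω) : L →* Ω)) (by
      intro σ τ h
      ext a
      exact DFunLike.congr_fun h a)
  have hrel : ∑ σ : L →ₐ[K] Ω, (σ z - if σ ∈ V then 1 else 0) • (σ : L → Ω) = 0 := by
    ext y
    have h1 : algebraMap K Ω (Algebra.trace K L (z * y)) = _ := trace_eq_sum_embeddings Ω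
    rw [hzt, hτ] at h1
    simp only [Finset.sum_apply, Pi.smul_apply, smul_eq_mul, sub_mul, Pi.zero_apply,
      Finset.sum_sub_distrib, ite_mul, one_mul, zero_mul, Finset.sum_ite_mem, Finset.univ_inter]
    rw [h1]
    simp
  have hz1 := Fintype.linearIndependent_iff.1 hli _ hrel
  obtain ⟨σ, hσ⟩ := hne
  obtain ⟨σ', hσ'⟩ := hnu
  have h1 := hz1 σ
  have h2 := hz1 σ'
  rw [if_pos hσ, sub_eq_zero] at h1
  rw [if_neg hσ', sub_zero] at h2
  have h3 : z = 1 := σ.toRingHom.injective (by simpa using h1)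
  rw [h3, map_one] at h2
  exact one_ne_zero h2

include B hgal in
/-- Izumi's theorem in the separable case. -/
theorem izumi_sep : ∃ c : ℕ, ∀ x : L, x ≠ 0 → IsIntegral S x → ∀ (σ σ' : L →ₐ[K] Ω) (n : ℕ),
    ‖σ x‖ ≤ (1/2 : ℝ) ^ (c * (n + 1)) → ‖σ' x‖ ≤ (1/2 : ℝ) ^ n := by
  classical
  by_contra! hcon
  set e := Fintype.card (L →ₐ[K] Ω) with he
  let Q : ℕ → Finset (L →ₐ[K] Ω) → Prop := fun D V =>
    ∃ (x : L) (P : ℕ), x ≠ 0 ∧ IsIntegral S x ∧ 1 ≤ P ∧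
      ∀ σ : L →ₐ[K] Ω, (σ ∈ V → (1/2 : ℝ) ^ P < ‖σ x‖) ∧ (σ ∉ V → ‖σ x‖ ≤ (1/2 : ℝ) ^ (D * P))
  have hmono : ∀ D D' V, D' ≤ D → Q D V → Q D' V := by
    rintro D D' V hD ⟨x, P, hx, hxi, hP, h⟩
    refine ⟨x, P, hx, hxi, hP, fun σ => ⟨(h σ).1, fun hσ => ((h σ).2 hσ).trans ?_⟩⟩
    exact pow_le_pow_of_le_one (by norm_num) (by norm_num) (by gcongr)
  have hex : ∀ D : ℕ, 1 ≤ D → ∃ V : Finset (L →ₐ[K] Ω), V.Nonempty ∧ (∃ σ, σ ∉ V) ∧ Q D V := by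
    intro D hD
    obtain ⟨x, hx, hxi, σ, σ', n, h1, h2⟩ := hcon (D ^ e)
    let V : ℕ → Finset (L →ₐ[K] Ω) := fun i =>
      Finset.univ.filter fun τ => (1/2 : ℝ) ^ (D ^ i * (n + 1)) < ‖τ x‖
    have hVm : ∀ i, V i ⊆ V (i + 1) := by
      intro i τ hτ
      simp only [V, Finset.mem_filter, Finset.mem_univ, true_and] at hτ ⊢
      refine lt_of_le_of_lt ?_ hτ
      apply pow_le_pow_of_le_one (by norm_num) (by norm_num)
      gcongr
      · omega
    have hV0 : σ' ∈ V 0 := by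
      simp only [V, Finset.mem_filter, Finset.mem_univ, true_and]
      refine lt_of_le_of_lt ?_ h2
      apply pow_le_pow_of_le_one (by norm_num) (by norm_num)
      simp
    have hVm' : ∀ i j, i ≤ j → V i ⊆ V j := fun i j hij => monotone_nat_of_le_succ hVm hij
    have hVe : σ ∉ V e := by
      simp only [V, Finset.mem_filter, Finset.mem_univ, true_and, not_lt]
      exact h1
    have : ∃ i < e, V i = V (i + 1) := by
      by_contra! hne
      have hc : ∀ i ≤ e, i < (V i).card := by
        intro i
        induction i with
        | zero => intro _; exact Finset.card_pos.2 ⟨_, hV0⟩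
        | succ i ih =>
          intro hi
          have h3 := ih (by omega)
          have := Finset.card_lt_card (lt_of_le_of_ne (hVm i) (hne i (by omega)))
          omega
      have := hc e le_rfl
      have h4 := Finset.card_le_univ (V e)
      omega
    obtain ⟨i, hi, hVi⟩ := this
    refine ⟨V i, ⟨σ', hVm' 0 i (Nat.zero_le _) hV0⟩, ⟨σ, fun h => hVe (hVm' i e hi.le h)⟩, x,
      D ^ i * (n + 1), hx, hxi, ?_, ?_⟩
    · have : 0 < D ^ i := by positivity
      nlinarith
    · intro τ
      constructor
      · intro hτ
        simpa only [V, Finset.mem_filter, Finset.mem_univ, true_and] using hτ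
      · intro hτ
        rw [hVi] at hτ
        simp only [V, Finset.mem_filter, Finset.mem_univ, true_and, not_lt] at hτ
        refine hτ.trans_eq ?_
        rw [pow_succ]; congr 1; ring
  have hno : ∀ V : Finset (L →ₐ[K] Ω), ∃ D : ℕ, 1 ≤ D ∧ (V.Nonempty → (∃ σ, σ ∉ V) → ¬ Q D V) := by
    intro V
    by_contra! hc
    obtain ⟨hne, hnu, -⟩ := hc 1 le_rfl
    exact gap_false (F := F) B hgal V hne hnu fun D hD => (hc D hD).2.2
  choose D hD1 hD using hno
  obtain ⟨V, hne, hnu, hQ⟩ := hex (1 + ∑ V, D V) (by omega)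
  refine hD V hne hnu (hmono _ _ V ?_ hQ)
  have := Finset.single_le_sum (f := D) (fun _ _ => Nat.zero_le _) (Finset.mem_univ V)
  omega

end Sep

end Izumi

set_option linter.unusedSectionVars false

namespace Izumi

section Fin

variable {S F K E Ω A : Type*} [CommRing S] [IsDomain S] [NontriviallyNormedField F]
  [IsUltrametricDist F] [Algebra S F] {v : S → ℕ} (B : Base S F v)
  [Field K] [Algebra S K] [IsFractionRing S K] [Algebra K F] [IsScalarTower S K F]
  [Field E] [Algebra K E] [FiniteDimensional K E] [Algebra.IsSeparable K E]
  [Algebra S E] [IsScalarTower S K E]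
  [NormedField Ω] [IsUltrametricDist Ω] [NormedAlgebra F Ω] [IsAlgClosed Ω] [Normal F Ω]
  [Algebra K Ω] [IsScalarTower K F Ω] [Algebra S Ω] [IsScalarTower S K Ω] [IsScalarTower S F Ω]
  (hgal : ∀ (g : Ω ≃ₐ[F] Ω) (x : Ω), ‖g x‖ = ‖x‖)
  [CommRing A] [IsDomain A] [Algebra S A] [Module.Finite S A] [IsNoetherianRing S]
  (hSA : Function.Injective (algebraMap S A))
  (X : A →+* E) (q : ℕ) (hq : 1 ≤ q) (hXs : ∀ s : S, X (algebraMap S A s) = algebraMap S E (s ^ q))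
  (hXi : ∀ a, IsIntegral S (X a))
  (nn : Ideal S) (hnn : ∀ n s, s ∈ nn ^ n ↔ ‖algebraMap S F s‖ ≤ (1/2 : ℝ) ^ n)
  (hΛ : ∀ t : S, t ≠ 0 → ∃ Λ : S →+ S, (∀ s t, Λ (s ^ q * t) = s * Λ t) ∧ Λ t ≠ 0 ∧
    ∃ c : ℕ, ∀ n s, ‖algebraMap S F s‖ ≤ (1/2 : ℝ) ^ (q * n + c) →
      ‖algebraMap S F (Λ s)‖ ≤ (1/2 : ℝ) ^ n)

include B hXs hXi hnn hΛ hSA in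
/-- The comparison of the conjugate norms with the adic filtration. -/
lemma exists_adic_bound : ∃ k c : ℕ, ∀ (a : A) (n : ℕ),
    (∀ σ : E →ₐ[K] Ω, ‖σ (X a)‖ ≤ (1/2 : ℝ) ^ (q * (n + k) + c)) →
    a ∈ (nn.map (algebraMap S A)) ^ n := by
  classical
  have := B.isIntegrallyClosed K
  have hSE : Function.Injective (algebraMap S E) := by
    rw [IsScalarTower.algebraMap_eq S K E]
    exact (algebraMap K E).injective.comp (IsFractionRing.injective S K)
  -- choose theta with nonzero trace
  obtain ⟨θ, hθi, hθ⟩ : ∃ θ : E, IsIntegral S θ ∧ Algebra.trace K E θ ≠ 0 := by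
    obtain ⟨y, hy⟩ : ∃ y : E, Algebra.trace K E y ≠ 0 := by
      by_contra! h
      exact Algebra.trace_ne_zero K E (LinearMap.ext h)
    have : IsAlgebraic S y := (IsFractionRing.isAlgebraic_iff S K E).2 (Algebra.IsAlgebraic.isAlgebraic y)
    obtain ⟨s, hs0, hs⟩ := this.exists_integral_multiple
    refine ⟨_, hs, ?_⟩
    rw [← algebraMap_smul K s y, map_smul, smul_eq_mul]
    exact mul_ne_zero (by simpa using hs0) hy
  have htr : ∀ a : A, ∃ t : S, algebraMap S K t = Algebra.trace K E (X a * θ) := fun a =>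
    IsIntegrallyClosed.isIntegral_iff.1 (Algebra.isIntegral_trace ((hXi a).mul hθi))
  choose τ hτ using htr
  have hKinj : Function.Injective (algebraMap S K) := IsFractionRing.injective S K
  have hτadd : ∀ a b, τ (a + b) = τ a + τ b := fun a b => hKinj (by
    rw [map_add, hτ, hτ, hτ, map_add, add_mul, map_add])
  have hτs : ∀ (s : S) a, τ (s • a) = s ^ q * τ a := fun s a => hKinj (by
    rw [map_mul, hτ, hτ, Algebra.smul_def, map_mul X, hXs, mul_assoc,
      IsScalarTower.algebraMap_apply S K E, ← Algebra.smul_def, map_smul, smul_eq_mul])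
  have hτ1 : τ 1 ≠ 0 := by
    intro h
    have := hτ 1
    rw [h, map_zero, map_one, one_mul] at this
    exact hθ this.symm
  obtain ⟨Λ, hΛs, hΛ1, c, hc⟩ := hΛ _ hτ1
  let ℓ : A →ₗ[S] S :=
    { toFun := fun a => Λ (τ a)
      map_add' := fun a b => by rw [hτadd, map_add]
      map_smul' := fun s a => by rw [hτs, hΛs]; rfl }
  have hℓn : ∀ (a : A) (n : ℕ), (∀ σ : E →ₐ[K] Ω, ‖σ (X a)‖ ≤ (1/2 : ℝ) ^ (q * n + c)) →
      ℓ a ∈ nn ^ n := by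
    intro a n h
    rw [hnn]
    apply hc
    have : ‖algebraMap S F (τ a)‖ = ‖∑ σ : E →ₐ[K] Ω, σ (X a * θ)‖ := by
      rw [← trace_eq_sum_embeddings Ω, ← hτ, ← IsScalarTower.algebraMap_apply,
        IsScalarTower.algebraMap_apply S F Ω, norm_algebraMap']
    rw [this]
    refine IsUltrametricDist.norm_sum_le_of_forall_le_of_nonneg (by positivity) fun σ _ => ?_
    rw [map_mul, norm_mul]
    exact (mul_le_mul (h σ) (norm_sigma_le (F := F) B hθi σ) (norm_nonneg _)
      (by positivity)).trans_eq (mul_one _)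
  obtain ⟨r, b, hb⟩ := Module.Finite.exists_fin (R := S) (M := A)
  let ι : A →ₗ[S] (Fin r → S) := LinearMap.pi fun i => ℓ ∘ₗ LinearMap.mulLeft S (b i)
  have hι : ∀ a i, ι a i = ℓ (b i * a) := fun a i => rfl
  have hιinj : Function.Injective ι := by
    rw [← LinearMap.ker_eq_bot, LinearMap.ker_eq_bot']
    intro a ha
    by_contra ha0
    have h1 : ∀ y : A, ℓ (y * a) = 0 := by
      intro y
      have hy : y ∈ Submodule.span S (Set.range b) := by rw [hb]; trivial
      induction hy using Submodule.span_induction with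
      | mem x hx => obtain ⟨i, rfl⟩ := hx; rw [← hι, ha]; rfl
      | zero => simp
      | add x y _ _ hx hy => rw [add_mul, map_add, hx, hy, add_zero]
      | smul s x _ hx => rw [smul_mul_assoc, map_smul, hx, smul_zero]
    have halg : IsAlgebraic S a := (Algebra.IsIntegral.isIntegral (R := S) a).isAlgebraic
    obtain ⟨y, s, hs, hys⟩ := IsAlgebraic.exists_nonzero_dvd (R := S) halg
      (mem_nonZeroDivisors_of_ne_zero ha0) |>.elim fun s hs => 
        hs.2.elim fun y hy => (⟨y, s, hs.1, hy⟩ : ∃ (y : A) (s : S), s ≠ 0 ∧ algebraMap S A s = a * y)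
    have h2 := h1 y
    rw [mul_comm, ← hys, Algebra.algebraMap_eq_smul_one, map_smul, smul_eq_mul] at h2
    exact mul_ne_zero hs hΛ1 h2
  obtain ⟨k, hk⟩ := Ideal.exists_pow_inf_eq_pow_smul nn (LinearMap.range ι)
  refine ⟨k, c, fun a n h => ?_⟩
  have h1 : ι a ∈ (nn ^ (n + k) • ⊤ ⊓ LinearMap.range ι : Submodule S (Fin r → S)) := by
    refine ⟨?_, ⟨a, rfl⟩⟩
    rw [pi_eq_sum_univ (ι a)]
    refine Submodule.sum_mem _ fun i _ => Submodule.smul_mem_smul ?_ trivial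
    rw [hι]
    apply hℓn
    intro σ
    rw [map_mul, map_mul, norm_mul]
    calc _ ≤ 1 * (1/2 : ℝ) ^ (q * (n + k) + c) :=
          mul_le_mul (norm_sigma_le (F := F) B (hXi _) σ) (h σ) (norm_nonneg _) zero_le_one
      _ = _ := one_mul _
  rw [hk (n + k) (by omega), Nat.add_sub_cancel] at h1
  have h2 : ι a ∈ (nn ^ n • LinearMap.range ι : Submodule S (Fin r → S)) :=
    Submodule.smul_mono le_rfl inf_le_right h1
  rw [LinearMap.range_eq_map, ← Submodule.map_smul''] at h2
  obtain ⟨a', ha', haa⟩ := h2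
  have := hιinj haa
  subst this
  rw [← Ideal.map_pow]
  have h3 : a' ∈ (nn ^ n • ⊤ : Submodule S A) := ha'
  rw [Ideal.smul_top_eq_map] at h3
  exact h3

include K B hgal hq hXs hXi hnn hΛ hSA in
theorem izumi_fin (hXinj : Function.Injective X) : ∃ c : ℕ, ∀ (n : ℕ) (a b : A),
    a * b ∈ (nn.map (algebraMap S A)) ^ (c * (n + 1)) →
    a ∈ (nn.map (algebraMap S A)) ^ n ∨ b ∈ (nn.map (algebraMap S A)) ^ n := by
  obtain ⟨k, c1, hkc⟩ := exists_adic_bound (K := K) (F := F) (Ω := Ω) B hSA X q hXs hXi nn hnn hΛ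
  obtain ⟨c0, hc0⟩ := izumi_sep (F := F) (K := K) (L := E) (Ω := Ω) B hgal
  have hle : ∀ N : ℕ, ∀ y ∈ (nn.map (algebraMap S A)) ^ N, ∀ σ : E →ₐ[K] Ω,
      ‖σ (X y)‖ ≤ (1/2 : ℝ) ^ (q * N) := by
    intro N y hy σ
    let J : Ideal A :=
      { carrier := {y | ‖σ (X y)‖ ≤ (1/2 : ℝ) ^ (q * N)}
        add_mem' := fun {a b} ha hb => by
          simp only [Set.mem_setOf_eq] at *
          rw [map_add, map_add]
          exact (IsUltrametricDist.norm_add_le_max _ _).trans (max_le ha hb)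
        zero_mem' := by simp
        smul_mem' := fun s a ha => by
          simp only [Set.mem_setOf_eq, smul_eq_mul] at *
          rw [map_mul, map_mul, norm_mul]
          exact (mul_le_mul (norm_sigma_le (F := F) B (hXi s) σ) ha (norm_nonneg _) zero_le_one).trans_eq
            (one_mul _) }
    have : (nn.map (algebraMap S A)) ^ N ≤ J := by
      rw [← Ideal.map_pow, Ideal.map_le_iff_le_comap]
      intro s hs
      change ‖σ (X (algebraMap S A s))‖ ≤ (1/2 : ℝ) ^ (q * N)
      have h1 : σ (X (algebraMap S A s)) = algebraMap F Ω (algebraMap S F s ^ q) := by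
        rw [hXs, ← map_pow, ← IsScalarTower.algebraMap_apply]
        exact (σ.restrictScalars S).commutes _
      rw [h1, norm_algebraMap', norm_pow, mul_comm, pow_mul]
      gcongr
      exact (hnn N s).1 hs
    exact this hy
  have : ∃ σ : E →ₐ[K] Ω, True := ⟨IsAlgClosed.lift, trivial⟩
  obtain ⟨σ0, -⟩ := this
  have key : ∀ (n : ℕ) (a : A), ‖σ0 (X a)‖ ≤ (1/2 : ℝ) ^ (c0 * (q * (n + k) + c1 + 1)) →
      a ∈ (nn.map (algebraMap S A)) ^ n := by
    intro n a h
    by_cases ha : a = 0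
    · rw [ha]; exact Ideal.zero_mem _
    apply hkc
    intro σ
    refine hc0 (X a) ?_ (hXi a) σ0 σ _ h
    rw [Ne, map_eq_zero_iff X hXinj]; exact ha
  refine ⟨2 * (c0 * (q + q * k + c1 + 1)), fun n a b hab => ?_⟩
  have h1 := hle _ _ hab σ0
  rw [map_mul, map_mul, norm_mul] at h1
  set M := c0 * (q * (n + k) + c1 + 1) with hM
  have hM2 : M + M ≤ q * (2 * (c0 * (q + q * k + c1 + 1)) * (n + 1)) := by
    have : M ≤ c0 * (q + q * k + c1 + 1) * (n + 1) := by
      rw [hM, mul_assoc]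
      apply Nat.mul_le_mul_left
      nlinarith [Nat.zero_le (q * k * n), Nat.zero_le (c1 * n)]
    nlinarith
  have h2 : ‖σ0 (X a)‖ * ‖σ0 (X b)‖ ≤ (1/2 : ℝ) ^ M * (1/2 : ℝ) ^ M := by
    rw [← pow_add]
    exact h1.trans (pow_le_pow_of_le_one (by norm_num) (by norm_num) hM2)
  by_contra! hcon
  have ha := lt_of_not_ge fun h => hcon.1 (key n a h)
  have hb := lt_of_not_ge fun h => hcon.2 (key n b h)
  have hpos : (0:ℝ) < (1/2) ^ M := by positivity
  have := mul_lt_mul'' ha hb hpos.le hpos.le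
  linarith

end Fin

end Izumi

set_option linter.unusedSectionVars false
set_option linter.style.haveILetI false

namespace Izumi

section Step1

open UniformSpace

variable {S K E A : Type*} [CommRing S] [IsDomain S] [NontriviallyNormedField K]
  [IsUltrametricDist K] [Algebra S K] [IsFractionRing S K] {v : S → ℕ}

/-- The completion of a nontrivially normed field. -/
noncomputable abbrev complNNF (K : Type*) [NontriviallyNormedField K] :
    NontriviallyNormedField (Completion K) :=
  { (inferInstance : NormedField (Completion K)) with
    non_trivial := by
      obtain ⟨x, hx⟩ := NontriviallyNormedField.non_trivial (α := K)
      exact ⟨(x : Completion K), by rw [Completion.norm_coe]; exact hx⟩ }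

lemma complUltra (K : Type*) [NormedField K] [IsUltrametricDist K] :
    IsUltrametricDist (Completion K) := by
  apply IsUltrametricDist.isUltrametricDist_of_forall_norm_add_le_max_norm
  intro x y
  induction x, y using Completion.induction_on₂ with
  | hp => exact isClosed_le (by fun_prop) (by fun_prop)
  | ih a b =>
    rw [← Completion.coe_add, Completion.norm_coe, Completion.norm_coe, Completion.norm_coe]
    exact IsUltrametricDist.norm_add_le_max a b

lemma exists_compl.{u} (K : Type u) [NontriviallyNormedField K] [IsUltrametricDist K] :
    ∃ (F : Type u) (_ : NontriviallyNormedField F) (_ : IsUltrametricDist F) (_ : CompleteSpace F)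
      (_ : Algebra K F),
      (∀ x : K, ‖algebraMap K F x‖ = ‖x‖) ∧ DenseRange (algebraMap K F) := by
  refine ⟨Completion K, complNNF K, complUltra K, inferInstance, inferInstance, fun x => Completion.norm_coe x,
    Completion.denseRange_coe⟩

lemma exists_algClosure.{u} (F : Type u) [NontriviallyNormedField F] [IsUltrametricDist F]
    [CompleteSpace F] :
    ∃ (Ω : Type u) (_ : NormedField Ω) (_ : IsUltrametricDist Ω) (_ : NormedAlgebra F Ω),
      IsAlgClosed Ω ∧ Normal F Ω ∧ ∀ (g : Ω ≃ₐ[F] Ω) (x : Ω), ‖g x‖ = ‖x‖ := by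
  let Ω := AlgebraicClosure F
  letI : NormedField Ω := spectralNorm.normedField F Ω
  letI : NormedAlgebra F Ω := spectralNorm.normedAlgebra F Ω
  refine ⟨Ω, inferInstance, IsUltrametricDist.isUltrametricDist_of_isNonarchimedean_norm
    (isNonarchimedean_spectralNorm (K := F) (L := AlgebraicClosure F)), inferInstance,
    AlgebraicClosure.isAlgClosed F, IsAlgClosure.normal F (AlgebraicClosure F),
    fun g x => (spectralNorm_eq_of_equiv g x).symm⟩

theorem izumi_K
  (norm_eq : ∀ s : S, s ≠ 0 → ‖algebraMap S K s‖ = (1/2 : ℝ) ^ (v s))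
  (complete : ∀ s : ℕ → S, (∀ n, ‖algebraMap S K (s (n+1) - s n)‖ ≤ (1/2 : ℝ)^n) →
    ∃ l, ∀ n, ‖algebraMap S K (l - s n)‖ ≤ (1/2 : ℝ)^n)
  (dich : ∀ u w : S, u ≠ 0 → w ≠ 0 → (∃ z, ‖algebraMap S K (u - z * w)‖ < ‖algebraMap S K u‖) ∨
    (∀ (T G : S) (s : ℕ), T ≠ 0 →
      ‖algebraMap S K (T * u ^ s - G * w ^ s)‖ < ‖algebraMap S K (T * u ^ s)‖ → s ≤ v T))
  [Field E] [Algebra K E] [FiniteDimensional K E] [Algebra.IsSeparable K E]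
  [Algebra S E] [IsScalarTower S K E]
  [CommRing A] [IsDomain A] [Algebra S A] [Module.Finite S A] [IsNoetherianRing S]
  (hSA : Function.Injective (algebraMap S A))
  (X : A →+* E) (q : ℕ) (hq : 1 ≤ q) (hXs : ∀ s : S, X (algebraMap S A s) = algebraMap S E (s ^ q))
  (hXi : ∀ a, IsIntegral S (X a))
  (nn : Ideal S) (hnn : ∀ n s, s ∈ nn ^ n ↔ ‖algebraMap S K s‖ ≤ (1/2 : ℝ) ^ n)
  (hΛ : ∀ t : S, t ≠ 0 → ∃ Λ : S →+ S, (∀ s t, Λ (s ^ q * t) = s * Λ t) ∧ Λ t ≠ 0 ∧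
    ∃ c : ℕ, ∀ n s, ‖algebraMap S K s‖ ≤ (1/2 : ℝ) ^ (q * n + c) →
      ‖algebraMap S K (Λ s)‖ ≤ (1/2 : ℝ) ^ n)
  (hXinj : Function.Injective X) : ∃ c : ℕ, ∀ (n : ℕ) (a b : A),
    a * b ∈ (nn.map (algebraMap S A)) ^ (c * (n + 1)) →
    a ∈ (nn.map (algebraMap S A)) ^ n ∨ b ∈ (nn.map (algebraMap S A)) ^ n := by
  obtain ⟨F, _, _, _, _, hKF, hdense⟩ := exists_compl K
  letI : Algebra S F := ((algebraMap K F).comp (algebraMap S K)).toAlgebra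
  haveI : IsScalarTower S K F := IsScalarTower.of_algebraMap_eq (fun _ => rfl)
  have hSF : ∀ s : S, ‖algebraMap S F s‖ = ‖algebraMap S K s‖ := fun s => hKF _
  obtain ⟨Ω, _, _, _, _, _, hgal⟩ := exists_algClosure F
  letI : Algebra K Ω := ((algebraMap F Ω).comp (algebraMap K F)).toAlgebra
  haveI : IsScalarTower K F Ω := IsScalarTower.of_algebraMap_eq (fun _ => rfl)
  letI : Algebra S Ω := ((algebraMap F Ω).comp (algebraMap S F)).toAlgebra
  haveI : IsScalarTower S F Ω := IsScalarTower.of_algebraMap_eq (fun _ => rfl)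
  haveI : IsScalarTower S K Ω := IsScalarTower.of_algebraMap_eq (fun _ => rfl)
  have B : Base S F v :=
    { norm_eq := fun s hs => by rw [hSF, norm_eq s hs]
      dense := fun h hh => by
        obtain ⟨k, hk⟩ : ∃ k : K, ‖h - algebraMap K F k‖ < ‖h‖ := by
          obtain ⟨y, hk, ⟨k, rfl⟩⟩ := Metric.dense_iff.1 hdense h ‖h‖
            (norm_pos_iff.2 hh)
          rw [Metric.mem_ball, dist_comm, dist_eq_norm] at hk
          exact ⟨k, hk⟩
        obtain ⟨u, w, hw, rfl⟩ := IsFractionRing.div_surjective (A := S) k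
        have hw0 : w ≠ 0 := nonZeroDivisors.ne_zero hw
        have hwK : algebraMap S K w ≠ 0 := by
          simpa using hw0
        refine ⟨u, w, hw0, ?_⟩
        have : algebraMap S F w * h - algebraMap S F u =
          algebraMap S F w * (h - algebraMap K F (algebraMap S K u / algebraMap S K w)) := by
          rw [mul_sub, IsScalarTower.algebraMap_apply S K F w, IsScalarTower.algebraMap_apply S K F u,
            ← map_mul, mul_div_cancel₀ _ hwK]
        rw [this, norm_mul, norm_mul]
        refine mul_lt_mul_of_pos_left hk ?_
        rw [hSF]; exact norm_pos_iff.2 hwK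
      complete := fun s hs => by
        simp only [hSF] at *
        exact complete s hs
      dich := fun u w hu hw => by
        simp only [hSF] at *
        exact dich u w hu hw }
  exact izumi_fin (K := K) (F := F) (Ω := Ω) B hgal hSA X q hq hXs hXi nn
    (fun n s => by rw [hSF]; exact hnn n s) (by simpa only [hSF] using hΛ) hXinj

end Step1

end Izumi

set_option linter.unusedSectionVars false
set_option linter.style.haveILetI false

namespace Izumi

/-- The algebraic properties of a ring `S` with ideal `nn` used in the argument. -/
structure AdicBase (S : Type*) [CommRing S] (nn : Ideal S) (v : S → ℕ) : Prop where
  mem_pow : ∀ n s, s ≠ 0 → (s ∈ nn ^ n ↔ n ≤ v s)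
  vmul : ∀ s t, s ≠ 0 → t ≠ 0 → v (s * t) = v s + v t
  nontriv : ∃ ϖ, ϖ ≠ 0 ∧ 1 ≤ v ϖ
  complete : ∀ s : ℕ → S, (∀ n, s (n+1) - s n ∈ nn ^ n) → ∃ l, ∀ n, l - s n ∈ nn ^ n
  dich : ∀ u w : S, u ≠ 0 → w ≠ 0 → (∃ z, u - z * w ∈ nn ^ (v u + 1)) ∨
    (∀ (T G : S) (s : ℕ), T ≠ 0 → T * u ^ s - G * w ^ s ∈ nn ^ (v T + s * v u + 1) → s ≤ v T)
  frob : ∀ e : ℕ, ∀ t : S, t ≠ 0 → ∃ Λ : S →+ S,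
    (∀ s t, Λ (s ^ (ringExpChar S ^ e) * t) = s * Λ t) ∧ Λ t ≠ 0 ∧
    ∃ c : ℕ, ∀ n s, s ∈ nn ^ ((ringExpChar S ^ e) * n + c) → Λ s ∈ nn ^ n

section

open scoped NNReal nonZeroDivisors

variable {S : Type*} [CommRing S] [IsDomain S] {nn : Ideal S} {v : S → ℕ}

lemma half_pow_le_iff (m n : ℕ) : (1/2 : ℝ) ^ m ≤ (1/2 : ℝ) ^ n ↔ n ≤ m := by
  rw [pow_le_pow_iff_right_of_lt_one₀ (by norm_num) (by norm_num)]

lemma half_pow_le_iff' (m n : ℕ) : (1/2 : ℝ≥0) ^ m ≤ (1/2 : ℝ≥0) ^ n ↔ n ≤ m := by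
  rw [pow_le_pow_iff_right_of_lt_one₀ (by norm_num)]
  rw [← NNReal.coe_lt_coe]; norm_num

open Classical in
/-- The valuation attached to an order function. -/
noncomputable def AdicBase.val (B : AdicBase S nn v) : Valuation S ℝ≥0 where
  toFun s := if s = 0 then 0 else (1/2 : ℝ≥0) ^ (v s)
  map_zero' := by simp
  map_one' := by
    have := B.vmul 1 1 one_ne_zero one_ne_zero
    simp at this
    simp [this]
  map_mul' s t := by
    by_cases hs : s = 0
    · simp [hs]
    by_cases ht : t = 0
    · simp [ht]
    simp only [hs, ht, mul_eq_zero, or_self, if_false, B.vmul s t hs ht, pow_add]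
  map_add_le_max' s t := by
    by_cases hs : s = 0
    · simp [hs]
    by_cases ht : t = 0
    · simp [ht]
    by_cases hst : s + t = 0
    · simp [hst]
    simp only [hs, ht, hst, if_false]
    rw [le_max_iff, half_pow_le_iff', half_pow_le_iff']
    rcases le_total (v s) (v t) with h | h
    · left
      rw [← B.mem_pow _ _ hst]
      exact add_mem ((B.mem_pow _ _ hs).2 le_rfl) ((B.mem_pow _ _ ht).2 h)
    · right
      rw [← B.mem_pow _ _ hst]
      exact add_mem ((B.mem_pow _ _ hs).2 h) ((B.mem_pow _ _ ht).2 le_rfl)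

open Classical in
lemma AdicBase.val_apply (B : AdicBase S nn v) {s : S} (hs : s ≠ 0) :
    B.val s = (1/2 : ℝ≥0) ^ (v s) := by
  change (if s = 0 then 0 else (1/2 : ℝ≥0) ^ (v s)) = _
  simp [hs]

end

open scoped NNReal nonZeroDivisors in
lemma AdicBase.exists_frac.{u} {S : Type u} [CommRing S] [IsDomain S] {nn : Ideal S} {v : S → ℕ}
    (B : AdicBase S nn v) :
    ∃ (K : Type u) (_ : NontriviallyNormedField K) (_ : IsUltrametricDist K) (_ : Algebra S K),
      IsFractionRing S K ∧ ∀ s : S, s ≠ 0 → ‖algebraMap S K s‖ = (1/2 : ℝ) ^ (v s) := by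
  let K := FractionRing S
  have hS : S⁰ ≤ B.val.supp.primeCompl := by
    intro s hs
    change s ∉ B.val.supp
    rw [Valuation.mem_supp_iff, B.val_apply (nonZeroDivisors.ne_zero hs)]
    positivity
  let w : Valuation K ℝ≥0 := B.val.extendToLocalization hS K
  have hw : ∀ s : S, s ≠ 0 → w (algebraMap S K s) = (1/2 : ℝ≥0) ^ (v s) := by
    intro s hs
    rw [← B.val_apply hs]
    exact Valuation.extendToLocalization_apply_map_apply _ hS K s
  let ab : AbsoluteValue K ℝ :=
    { toFun := fun x => (w x : ℝ)
      map_mul' := fun x y => by simp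
      nonneg' := fun x => NNReal.coe_nonneg _
      eq_zero' := fun x => by simp
      add_le' := fun x y => by
        have h := w.map_add x y
        have : w (x + y) ≤ w x + w y := h.trans (max_le (by simp) (by simp))
        exact_mod_cast this }
  letI nf : NormedField K := ab.toNormedField
  have hnorm : ∀ x : K, ‖x‖ = (w x : ℝ) := fun x => rfl
  letI : NontriviallyNormedField K :=
    { nf with
      non_trivial := by
        obtain ⟨ϖ, h0, h1⟩ := B.nontriv
        refine ⟨(algebraMap S K ϖ)⁻¹, ?_⟩
        have : (w (algebraMap S K ϖ)⁻¹ : ℝ) = ((1/2 : ℝ) ^ (v ϖ))⁻¹ := by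
          rw [map_inv₀, hw ϖ h0]; simp
        change 1 < (w (algebraMap S K ϖ)⁻¹ : ℝ)
        rw [this]
        apply (one_lt_inv₀ (by positivity)).2
        exact pow_lt_one₀ (by norm_num) (by norm_num) (by omega) }
  refine ⟨K, inferInstance, ?_, inferInstance, ?_, ?_⟩
  · apply IsUltrametricDist.isUltrametricDist_of_forall_norm_add_le_max_norm
    intro x y
    change (w (x+y) : ℝ) ≤ max (w x : ℝ) (w y : ℝ)
    exact_mod_cast w.map_add x y
  · exact (inferInstance : IsFractionRing S (FractionRing S))
  · intro s hs
    change (w (algebraMap S K s) : ℝ) = _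
    rw [hw s hs]; simp

/-- The inseparable trick: a `q`-power map into a finite separable extension. -/
lemma exists_sep.{u} {S K : Type*} {A : Type u} [CommRing S] [IsDomain S] [CommRing A] [IsDomain A]
    [Algebra S A] [Module.Finite S A] (hSA : Function.Injective (algebraMap S A))
    [Field K] [Algebra S K] [IsFractionRing S K] :
    ∃ (E : Type u) (_ : Field E) (_ : Algebra K E) (_ : Algebra S E) (e : ℕ) (X : A →+* E),
      FiniteDimensional K E ∧ Algebra.IsSeparable K E ∧ IsScalarTower S K E ∧
      (∀ s : S, X (algebraMap S A s) = algebraMap S E (s ^ (ringExpChar S ^ e))) ∧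
      Function.Injective X := by
  classical
  let L := FractionRing A
  have hSL : Function.Injective ((algebraMap A L).comp (algebraMap S A)) :=
    (IsFractionRing.injective A L).comp hSA
  letI : Algebra K L := (IsFractionRing.lift (A := S) (K := K) hSL).toAlgebra
  haveI : IsScalarTower S K L := IsScalarTower.of_algebraMap_eq (fun s => by
    change _ = IsFractionRing.lift (A := S) (K := K) hSL (algebraMap S K s)
    rw [IsFractionRing.lift_algebraMap]; rfl)
  haveI : FiniteDimensional K L := by
    obtain ⟨G, hG⟩ := Module.Finite.fg_top (R := S) (M := A)
    refine ⟨⟨G.image (algebraMap A L), ?_⟩⟩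
    rw [eq_top_iff]
    rintro y -
    have hA : ∀ a : A, algebraMap A L a ∈ Submodule.span K ((G.image (algebraMap A L) : Finset L) : Set L) := by
      intro a
      have : a ∈ Submodule.span S (G : Set A) := by rw [hG]; trivial
      induction this using Submodule.span_induction with
      | mem x hx => exact Submodule.subset_span (Finset.mem_coe.2 (Finset.mem_image_of_mem _ hx))
      | zero => simp
      | add x y _ _ hx hy => rw [map_add]; exact add_mem hx hy
      | smul s x _ hx =>
        rw [Algebra.smul_def, map_mul]
        have : algebraMap A L (algebraMap S A s) = algebraMap K L (algebraMap S K s) := by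
          rw [← IsScalarTower.algebraMap_apply S K L, ← IsScalarTower.algebraMap_apply S A L]
        rw [this, ← Algebra.smul_def]
        exact Submodule.smul_mem _ _ hx
    obtain ⟨a, b, hb, rfl⟩ := IsFractionRing.div_surjective (A := A) y
    have hb0 := nonZeroDivisors.ne_zero hb
    have halg : IsAlgebraic S b := (Algebra.IsIntegral.isIntegral (R := S) b).isAlgebraic
    obtain ⟨r, hr0, c, hc⟩ := halg.exists_nonzero_dvd hb
    have hbL : algebraMap A L b ≠ 0 := by simpa using hb0
    have hrK : algebraMap S K r ≠ 0 := by simpa using hr0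
    have h2 : algebraMap K L (algebraMap S K r) = algebraMap A L b * algebraMap A L c := by
      rw [← map_mul, ← hc, ← IsScalarTower.algebraMap_apply S K L, ← IsScalarTower.algebraMap_apply S A L]
    have h3 : algebraMap A L a / algebraMap A L b = (algebraMap S K r)⁻¹ • algebraMap A L (a * c) := by
      rw [Algebra.smul_def, map_inv₀, h2, map_mul]
      have : algebraMap A L c ≠ 0 := by
        intro h
        rw [h, mul_zero] at h2
        exact hrK (by simpa using h2)
      rw [div_eq_mul_inv, mul_inv]
      rw [show (algebraMap A L b)⁻¹ * (algebraMap A L c)⁻¹ * (algebraMap A L a * algebraMap A L c) =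
        algebraMap A L a * (algebraMap A L b)⁻¹ * ((algebraMap A L c)⁻¹ * algebraMap A L c) by ring,
        inv_mul_cancel₀ this, mul_one]
    rw [h3]
    exact Submodule.smul_mem _ _ (hA _)
  let E := separableClosure K L
  let e := IsPurelyInseparable.exponent E L
  have hch : ringExpChar E = ringExpChar S := by
    haveI : ExpChar S (ringExpChar S) := inferInstance
    have h1 : Function.Injective (algebraMap S E) := by
      rw [IsScalarTower.algebraMap_eq S K E]
      exact (algebraMap K E).injective.comp (IsFractionRing.injective S K)
    haveI := expChar_of_injective_ringHom h1 (ringExpChar S)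
    exact ringExpChar.eq E (ringExpChar S)
  haveI : ExpChar S (ringExpChar S) := inferInstance
  haveI hEL : ExpChar L (ringExpChar S) := expChar_of_injective_ringHom hSL (ringExpChar S)
  have hex : ∀ a : L, ∃ y : E, (y : L) = a ^ (ringExpChar S ^ e) := by
    intro a
    obtain ⟨y, hy⟩ := IsPurelyInseparable.exponent_def E a
    rw [hch] at hy
    exact ⟨y, hy⟩
  let f : L →+* L := iterateFrobenius L (ringExpChar S) e
  have hf : ∀ a : L, f a ∈ E.toSubring := by
    intro a
    obtain ⟨y, hy⟩ := hex a
    change iterateFrobenius L (ringExpChar S) e a ∈ _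
    rw [iterateFrobenius_def, ← hy]
    exact y.2
  let X : A →+* E := (f.codRestrict E.toSubring hf).comp (algebraMap A L)
  have hX : ∀ a, ((X a : E) : L) = algebraMap A L a ^ (ringExpChar S ^ e) := fun a => by
    change iterateFrobenius L (ringExpChar S) e _ = _
    rw [iterateFrobenius_def]
  refine ⟨E, inferInstance, inferInstance, inferInstance, e, X, inferInstance, inferInstance,
    inferInstance, ?_, ?_⟩
  · intro s
    apply Subtype.ext
    rw [hX, ← map_pow, ← map_pow, ← IsScalarTower.algebraMap_apply S A L,
      IsScalarTower.algebraMap_apply S K L, IsScalarTower.algebraMap_apply S K E]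
    rfl
  · intro a b hab
    have h : f (algebraMap A L a) = f (algebraMap A L b) := congrArg Subtype.val hab
    exact IsFractionRing.injective A L (f.injective h)

theorem AdicBase.izumi {S A : Type*} [CommRing S] [IsDomain S] {nn : Ideal S} {v : S → ℕ}
    (B : AdicBase S nn v) [IsNoetherianRing S] [CommRing A] [IsDomain A] [Algebra S A]
    [Module.Finite S A] (hSA : Function.Injective (algebraMap S A)) :
    ∃ c : ℕ, ∀ (n : ℕ) (a b : A), a * b ∈ (nn.map (algebraMap S A)) ^ (c * (n + 1)) →
      a ∈ (nn.map (algebraMap S A)) ^ n ∨ b ∈ (nn.map (algebraMap S A)) ^ n := by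
  obtain ⟨K, _, _, _, _, hK⟩ := B.exists_frac
  obtain ⟨E, _, _, _, e, X, _, _, _, hXs, hXinj⟩ := exists_sep (K := K) hSA
  have hmem : ∀ n s, s ∈ nn ^ n ↔ ‖algebraMap S K s‖ ≤ (1/2 : ℝ) ^ n := by
    intro n s
    by_cases hs : s = 0
    · simp [hs]
    rw [B.mem_pow n s hs, hK s hs, half_pow_le_iff]
  have hlt : ∀ n s, s ∈ nn ^ (n + 1) ↔ ‖algebraMap S K s‖ < (1/2 : ℝ) ^ n := by
    intro n s
    by_cases hs : s = 0
    · simp [hs]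
    rw [B.mem_pow _ s hs, hK s hs, pow_lt_pow_iff_right_of_lt_one₀ (by norm_num) (by norm_num)]
    rfl
  have hpow : ∀ (u : S) (s : ℕ), u ≠ 0 → v (u ^ s) = s * v u := by
    intro u s hu
    induction s with
    | zero =>
      have := B.vmul 1 1 one_ne_zero one_ne_zero
      simp at this; simp [this]
    | succ s ih => rw [pow_succ, B.vmul _ _ (pow_ne_zero _ hu) hu, ih]; ring
  refine izumi_K (K := K) (E := E) (v := v) hK ?_ ?_ hSA X (ringExpChar S ^ e) ?_ hXs ?_ nn hmem ?_ hXinj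
  · intro s hs
    obtain ⟨l, hl⟩ := B.complete s (fun n => (hmem _ _).2 (hs n))
    exact ⟨l, fun n => (hmem _ _).1 (hl n)⟩
  · intro u w hu hw
    rcases B.dich u w hu hw with ⟨z, hz⟩ | h
    · left
      refine ⟨z, ?_⟩
      rw [hK u hu]; exact (hlt _ _).1 hz
    · right
      intro T G s hT hTG
      apply h T G s hT
      rw [hlt]
      have hne : T * u ^ s ≠ 0 := mul_ne_zero hT (pow_ne_zero _ hu)
      rw [hK _ hne, B.vmul _ _ hT (pow_ne_zero _ hu), hpow u s hu] at hTG
      exact hTG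
  · exact Nat.one_le_pow _ _ (expChar_pos S _)
  · intro a
    have ha : IsIntegral S a := Algebra.IsIntegral.isIntegral a
    obtain ⟨P, hP, hPa⟩ := ha
    haveI : ExpChar S (ringExpChar S) := inferInstance
    refine ⟨P.map (iterateFrobenius S (ringExpChar S) e), hP.map _, ?_⟩
    have h1 : (algebraMap S E).comp (iterateFrobenius S (ringExpChar S) e) = X.comp (algebraMap S A) := by
      ext s
      simp [iterateFrobenius_def, hXs]
    rw [Polynomial.eval₂_map, h1, ← Polynomial.hom_eval₂, hPa, map_zero]
  · intro t ht
    obtain ⟨Λ, h1, h2, c, h3⟩ := B.frob e t ht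
    exact ⟨Λ, h1, h2, c, fun n s hs => (hmem _ _).1 (h3 n s ((hmem _ _).2 hs))⟩

end Izumi

set_option linter.unusedSectionVars false
set_option linter.style.haveILetI false

namespace Izumi

open MvPowerSeries Finsupp

section Power

variable {σ D : Type*} [Finite σ] [CommRing D] (ϖ : D)

/-- The filtration of a power series ring. -/
def JJ (σ : Type*) (n : ℕ) : Ideal (MvPowerSeries σ D) where
  carrier := {s | ∀ α : σ →₀ ℕ, ϖ ^ (n - degree α) ∣ coeff α s}
  add_mem' ha hb α := by rw [map_add]; exact dvd_add (ha α) (hb α)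
  zero_mem' α := by simp
  smul_mem' c s hs α := by
    classical
    rw [smul_eq_mul, coeff_mul]
    apply Finset.dvd_sum
    rintro ⟨β, γ⟩ h
    rw [Finset.HasAntidiagonal.mem_antidiagonal] at h
    apply Dvd.dvd.mul_left
    refine (pow_dvd_pow _ ?_).trans (hs γ)
    have : degree γ ≤ degree α := by simp at h; rw [← h, map_add]; omega
    omega

lemma mem_JJ {n : ℕ} {s : MvPowerSeries σ D} :
    s ∈ JJ ϖ σ n ↔ ∀ α : σ →₀ ℕ, ϖ ^ (n - degree α) ∣ coeff α s := Iff.rfl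

lemma JJ_anti {m n : ℕ} (h : m ≤ n) : JJ ϖ σ n ≤ JJ ϖ σ m := fun s hs α =>
  (pow_dvd_pow _ (by omega)).trans (hs α)

lemma JJ_zero : JJ ϖ σ 0 = ⊤ := by
  rw [eq_top_iff]; intro s _ α; simp

lemma JJ_mul {m n : ℕ} {s t : MvPowerSeries σ D} (hs : s ∈ JJ ϖ σ m) (ht : t ∈ JJ ϖ σ n) :
    s * t ∈ JJ ϖ σ (m + n) := by
  classical
  intro α
  rw [coeff_mul]
  apply Finset.dvd_sum
  rintro ⟨β, γ⟩ h
  rw [Finset.HasAntidiagonal.mem_antidiagonal] at h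
  simp only at h
  refine dvd_trans ?_ (mul_dvd_mul (hs β) (ht γ))
  rw [← pow_add]
  apply pow_dvd_pow
  rw [← h, map_add]; omega

/-- The ideal generated by the uniformizer and the variables. -/
noncomputable def NN (σ : Type*) : Ideal (MvPowerSeries σ D) :=
  Ideal.span (insert (C ϖ) (Set.range X))

lemma NN_le : NN ϖ σ ≤ JJ ϖ σ 1 := by
  classical
  rw [NN, Ideal.span_le]
  rintro s (rfl | ⟨i, rfl⟩) α
  · rw [coeff_C]
    split_ifs with h
    · rw [h]; simp
    · simp
  · rw [coeff_X]
    split_ifs with h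
    · rw [h]; simp
    · simp

lemma C_mem_NN : C ϖ ∈ NN ϖ σ := Ideal.subset_span (Set.mem_insert _ _)

lemma X_mem_NN (i : σ) : (X i : MvPowerSeries σ D) ∈ NN ϖ σ :=
  Ideal.subset_span (Set.mem_insert_of_mem _ ⟨i, rfl⟩)

lemma monomial_mem_NN (β : σ →₀ ℕ) : (monomial β (1 : D)) ∈ NN ϖ σ ^ degree β := by
  classical
  induction β using Finsupp.induction_linear with
  | zero => simp
  | add f g hf hg =>
    rw [map_add, pow_add, show (1 : D) = 1 * 1 by simp, ← monomial_mul_monomial]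
    exact Ideal.mul_mem_mul hf hg
  | single i n =>
    rw [degree_single, ← X_pow_eq]
    exact Ideal.pow_mem_pow (X_mem_NN ϖ i) n

lemma tail_mem (n : ℕ) (s : MvPowerSeries σ D) (hs : ∀ α, degree α < n → coeff α s = 0) :
    s ∈ NN ϖ σ ^ n := by
  classical
  have : ∀ α : σ →₀ ℕ, ∃ β : σ →₀ ℕ, n ≤ degree α → β ≤ α ∧ degree β = n := by
    intro α
    by_cases h : n ≤ degree α
    · obtain ⟨β, h1, h2⟩ := exists_le_degree_eq _ _ h
      exact ⟨β, fun _ => ⟨h1, h2⟩⟩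
    · exact ⟨0, fun h' => absurd h' h⟩
  choose ch hch using this
  let T := (finite_of_degree_eq (σ := σ) n).toFinset
  let g : (σ →₀ ℕ) → MvPowerSeries σ D := fun β γ => if ch (β + γ) = β then coeff (β + γ) s else 0
  have hg : ∀ β γ, coeff γ (g β) = if ch (β + γ) = β then coeff (β + γ) s else 0 := fun _ _ => rfl
  have : s = ∑ β ∈ T, monomial β 1 * g β := by
    ext γ
    rw [map_sum]
    simp only [coeff_monomial_mul, hg]
    by_cases hγ : n ≤ degree γ
    · obtain ⟨h1, h2⟩ := hch γ hγ
      rw [Finset.sum_eq_single (ch γ)]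
      · rw [if_pos h1, add_tsub_cancel_of_le h1]; simp
      · intro β _ hβ
        split_ifs with h3 h4
        · rw [add_tsub_cancel_of_le h3] at h4; exact absurd h4.symm hβ
        · simp
        · rfl
      · intro h; exact absurd (by simpa [T] using h2) h
    · rw [hs γ (by omega), Finset.sum_eq_zero]
      intro β hβ
      rw [if_neg]
      intro h
      have h1 : degree β = n := by simpa [T] using hβ
      have := Finsupp.degree_mono h
      omega
  rw [this]
  apply Ideal.sum_mem
  intro β hβ
  have h1 : degree β = n := by simpa [T] using hβ
  have := monomial_mem_NN (D := D) ϖ β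
  rw [h1] at this
  exact Ideal.mul_mem_right _ _ this

lemma NN_pow (n : ℕ) : NN ϖ σ ^ n = JJ ϖ σ n := by
  classical
  apply le_antisymm
  · induction n with
    | zero => rw [JJ_zero]; exact le_top
    | succ n ih =>
      rw [pow_succ, Ideal.mul_le]
      intro s hs t ht
      exact JJ_mul ϖ (ih hs) (NN_le ϖ ht)
  · intro s hs
    let T := (finite_of_degree_lt (σ := σ) n).toFinset
    have h1 : s - ∑ β ∈ T, monomial β (coeff β s) ∈ NN ϖ σ ^ n := by
      apply tail_mem
      intro α hα
      rw [map_sub, map_sum]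
      simp only [coeff_monomial]
      rw [Finset.sum_ite_eq, if_pos (by simpa [T] using hα), sub_self]
    rw [← sub_add_cancel s (∑ β ∈ T, monomial β (coeff β s))]
    refine add_mem h1 (Ideal.sum_mem _ ?_)
    intro β hβ
    have h2 : degree β < n := by simpa [T] using hβ
    obtain ⟨d, hd⟩ := hs β
    have h3 : monomial β (coeff β s) = C d * ((C ϖ) ^ (n - degree β) * monomial β (1 : D)) := by
      rw [hd, ← map_pow, ← monomial_zero_eq_C_apply, ← monomial_zero_eq_C_apply, monomial_mul_monomial, monomial_mul_monomial]
      simp [mul_comm]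
    rw [h3]
    apply Ideal.mul_mem_left
    have h4 := Ideal.mul_mem_mul (Ideal.pow_mem_pow (C_mem_NN (σ := σ) ϖ) (n - degree β))
      (monomial_mem_NN ϖ β)
    rwa [← pow_add, Nat.sub_add_cancel h2.le] at h4

end Power

end Izumi

set_option linter.unusedSectionVars false
set_option linter.style.haveILetI false

namespace Izumi

open MvPowerSeries Finsupp

lemma totDeg_le_iff {σ k : Type*} [CommSemiring k] {P : MvPolynomial σ k} {n : ℕ} :
    P.totalDegree ≤ n ↔ ∀ α ∈ P.support, degree α ≤ n := by
  rw [MvPolynomial.totalDegree, Finset.sup_le_iff]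
  rfl

lemma totDeg_pow {σ k : Type*} [Field k] (P : MvPolynomial σ k) (n : ℕ) :
    (P ^ n).totalDegree = n * P.totalDegree := by
  by_cases hP : P = 0
  · subst hP; cases n <;> simp
  induction n with
  | zero => simp
  | succ n ih =>
    rw [pow_succ, MvPolynomial.totalDegree_mul_of_isDomain (pow_ne_zero _ hP) hP, ih]; ring

section Rep

variable {σ D k : Type*} [Finite σ] [CommRing D] [IsDomain D] [Field k] (ϖ : D) (res : D →+* k)

/-- `P` is the initial form of degree `n` of `s`. -/
def Rep (n : ℕ) (s : MvPowerSeries σ D) (P : MvPolynomial σ k) : Prop :=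
  ∀ α, ∃ d, coeff α s = ϖ ^ (n - degree α) * d ∧
    MvPolynomial.coeff α P = if degree α ≤ n then res d else 0

variable (h0 : ϖ ≠ 0) (hsurj : Function.Surjective res) (hker : ∀ x, res x = 0 ↔ ϖ ∣ x)

lemma exists_Rep {n : ℕ} {s : MvPowerSeries σ D} (hs : s ∈ JJ ϖ σ n) :
    ∃ P, Rep ϖ res n s P := by
  classical
  choose d hd using hs
  let T := (finite_of_degree_le (σ := σ) n).toFinset
  refine ⟨∑ β ∈ T, MvPolynomial.monomial β (res (d β)), fun α => ⟨d α, hd α, ?_⟩⟩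
  rw [MvPolynomial.coeff_sum]
  simp only [MvPolynomial.coeff_monomial]
  rw [Finset.sum_ite_eq']
  simp [T]

lemma Rep.mem {n : ℕ} {s : MvPowerSeries σ D} {P : MvPolynomial σ k} (h : Rep ϖ res n s P) :
    s ∈ JJ ϖ σ n := fun α => by
  obtain ⟨d, hd, -⟩ := h α
  exact ⟨d, hd⟩

include hker in
lemma Rep.mul {m n : ℕ} {s t : MvPowerSeries σ D} {P Q : MvPolynomial σ k} (hP : Rep ϖ res m s P)
    (hQ : Rep ϖ res n t Q) : Rep ϖ res (m + n) (s * t) (P * Q) := by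
  classical
  have hϖ : res ϖ = 0 := (hker _).2 dvd_rfl
  intro α
  choose d hd hd' using hP
  choose e he he' using hQ
  refine ⟨∑ x ∈ Finset.HasAntidiagonal.antidiagonal α,
    ϖ ^ ((m - degree x.1) + (n - degree x.2) - (m + n - degree α)) * (d x.1 * e x.2), ?_, ?_⟩
  · rw [coeff_mul, Finset.mul_sum]
    apply Finset.sum_congr rfl
    rintro ⟨β, γ⟩ h
    rw [Finset.HasAntidiagonal.mem_antidiagonal] at h
    simp only at h ⊢
    rw [hd, he, ← mul_assoc (ϖ ^ _), ← pow_add]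
    have : degree α = degree β + degree γ := by rw [← h, map_add]
    rw [show m + n - degree α + (m - degree β + (n - degree γ) - (m + n - degree α)) =
      m - degree β + (n - degree γ) by omega, pow_add]
    ring
  · rw [MvPolynomial.coeff_mul]
    have hterm : ∀ x ∈ Finset.HasAntidiagonal.antidiagonal α, degree x.1 + degree x.2 = degree α := by
      rintro ⟨β, γ⟩ h
      rw [Finset.HasAntidiagonal.mem_antidiagonal] at h
      simp only at h ⊢
      rw [← h, map_add]
    split_ifs with hα
    · rw [map_sum]
      apply Finset.sum_congr rfl
      intro x hx
      have := hterm x hx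
      rw [hd', he', map_mul, map_mul, map_pow, hϖ]
      by_cases h1 : degree x.1 ≤ m
      · by_cases h2 : degree x.2 ≤ n
        · rw [if_pos h1, if_pos h2, show m - degree x.1 + (n - degree x.2) - (m + n - degree α) = 0 by omega]
          simp
        · rw [if_neg h2, zero_pow (by omega)]; simp
      · rw [if_neg h1, zero_pow (by omega)]; simp
    · apply Finset.sum_eq_zero
      intro x hx
      have := hterm x hx
      rw [hd', he']
      by_cases h1 : degree x.1 ≤ m
      · rw [if_neg (show ¬ degree x.2 ≤ n by omega), mul_zero]
      · rw [if_neg h1, zero_mul]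

lemma Rep.sub {n : ℕ} {s t : MvPowerSeries σ D} {P Q : MvPolynomial σ k} (hP : Rep ϖ res n s P)
    (hQ : Rep ϖ res n t Q) : Rep ϖ res n (s - t) (P - Q) := by
  intro α
  obtain ⟨d, hd, hd'⟩ := hP α
  obtain ⟨e, he, he'⟩ := hQ α
  refine ⟨d - e, by rw [map_sub, hd, he]; ring, ?_⟩
  rw [MvPolynomial.coeff_sub, hd', he']
  split_ifs <;> simp

include h0 hker in
lemma Rep.eq_zero_iff {n : ℕ} {s : MvPowerSeries σ D} {P : MvPolynomial σ k} (h : Rep ϖ res n s P) :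
    P = 0 ↔ s ∈ JJ ϖ σ (n + 1) := by
  constructor
  · rintro rfl α
    obtain ⟨d, hd, hd'⟩ := h α
    by_cases hα : degree α ≤ n
    · rw [if_pos hα, MvPolynomial.coeff_zero, eq_comm, hker] at hd'
      rw [hd, show n + 1 - degree α = (n - degree α) + 1 by omega, pow_succ]
      exact mul_dvd_mul_left _ hd'
    · rw [show n + 1 - degree α = 0 by omega]; simp
  · intro hs
    ext α
    obtain ⟨d, hd, hd'⟩ := h α
    rw [hd', MvPolynomial.coeff_zero]
    split_ifs with hα
    · rw [hker]
      have := hs α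
      rw [hd, show n + 1 - degree α = (n - degree α) + 1 by omega, pow_succ] at this
      exact (mul_dvd_mul_iff_left (pow_ne_zero _ h0)).1 this
    · rfl

include h0 hker in
lemma Rep.unique {n : ℕ} {s : MvPowerSeries σ D} {P Q : MvPolynomial σ k} (hP : Rep ϖ res n s P)
    (hQ : Rep ϖ res n s Q) : P = Q := by
  have := hP.sub ϖ res hQ
  rw [sub_self] at this
  exact sub_eq_zero.1 ((this.eq_zero_iff ϖ res h0 hker).2 (zero_mem _))

lemma Rep.degree_le {n : ℕ} {s : MvPowerSeries σ D} {P : MvPolynomial σ k} (h : Rep ϖ res n s P) :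
    P.totalDegree ≤ n := by
  rw [totDeg_le_iff]
  intro α hα
  obtain ⟨d, hd, hd'⟩ := h α
  by_contra hc
  rw [MvPolynomial.mem_support_iff, hd', if_neg hc] at hα
  exact hα rfl

include hsurj in
lemma exists_Rep_of_degree_le {n : ℕ} {P : MvPolynomial σ k} (hP : P.totalDegree ≤ n) :
    ∃ s : MvPowerSeries σ D, Rep ϖ res n s P := by
  choose r hr using hsurj
  let s : MvPowerSeries σ D := fun α => ϖ ^ (n - degree α) * r (MvPolynomial.coeff α P)
  refine ⟨s, fun α => ⟨r (MvPolynomial.coeff α P), rfl, ?_⟩⟩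
  rw [hr]
  split_ifs with h
  · rfl
  · by_contra hc
    have h1 : α ∈ P.support := by rw [MvPolynomial.mem_support_iff]; exact hc
    rw [totDeg_le_iff] at hP
    exact h (hP α h1)

lemma Rep.one : Rep ϖ res 0 (1 : MvPowerSeries σ D) (1 : MvPolynomial σ k) := by
  classical
  intro α
  refine ⟨coeff α 1, by simp, ?_⟩
  rw [coeff_one, MvPolynomial.coeff_one]
  by_cases h : α = 0
  · simp [h]
  · simp [h, Ne.symm h]

include hker in
lemma Rep.pow {n : ℕ} {s : MvPowerSeries σ D} {P : MvPolynomial σ k} (h : Rep ϖ res n s P) (e : ℕ) :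
    Rep ϖ res (e * n) (s ^ e) (P ^ e) := by
  induction e with
  | zero => simpa using Rep.one ϖ res
  | succ e ih =>
    rw [pow_succ, pow_succ, Nat.succ_mul]
    exact ih.mul ϖ res hker h

/-- The order function. -/
noncomputable def vv (s : MvPowerSeries σ D) : ℕ := sSup {n | s ∈ JJ ϖ σ n}

variable (hsep : ∀ x : D, (∀ n, ϖ ^ n ∣ x) → x = 0)

include hsep in
lemma mem_JJ_iff {s : MvPowerSeries σ D} (hs : s ≠ 0) (n : ℕ) : s ∈ JJ ϖ σ n ↔ n ≤ vv ϖ s := by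
  have hb : BddAbove {n | s ∈ JJ ϖ σ n} := by
    obtain ⟨α, hα⟩ : ∃ α, coeff α s ≠ 0 := by
      by_contra! h
      exact hs (by ext α; simpa using h α)
    obtain ⟨N, hN⟩ : ∃ N, ¬ ϖ ^ N ∣ coeff α s := by
      by_contra! h
      exact hα (hsep _ h)
    refine ⟨N + degree α, fun n hn => ?_⟩
    by_contra! hc
    exact hN ((pow_dvd_pow _ (by omega)).trans (hn α))
  have hmem : vv ϖ s ∈ {n | s ∈ JJ ϖ σ n} := Nat.sSup_mem ⟨0, by simp [JJ_zero]⟩ hb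
  constructor
  · intro h
    exact le_csSup hb h
  · intro h
    exact JJ_anti ϖ h hmem

include h0 hker hsep in
lemma exists_init {s : MvPowerSeries σ D} (hs : s ≠ 0) : ∃ P ≠ 0, Rep ϖ res (vv ϖ s) s P := by
  obtain ⟨P, hP⟩ := exists_Rep ϖ res ((mem_JJ_iff ϖ hsep hs _).2 le_rfl)
  refine ⟨P, ?_, hP⟩
  rw [Ne, hP.eq_zero_iff ϖ res h0 hker, mem_JJ_iff ϖ hsep hs]
  omega

include h0 hker hsep in
lemma vv_eq {s : MvPowerSeries σ D} (hs : s ≠ 0) {n : ℕ} {P : MvPolynomial σ k} (hP : P ≠ 0)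
    (h : Rep ϖ res n s P) : vv ϖ s = n := by
  have h1 := (mem_JJ_iff ϖ hsep hs _).1 (h.mem ϖ res)
  have h2 : ¬ (n + 1 ≤ vv ϖ s) := fun h' => hP ((h.eq_zero_iff ϖ res h0 hker).2 ((mem_JJ_iff ϖ hsep hs _).2 h'))
  omega

include h0 hker hsep hsurj in
lemma dich_aux (u w : MvPowerSeries σ D) (hu : u ≠ 0) (hw : w ≠ 0) :
    (∃ z, u - z * w ∈ JJ ϖ σ (vv ϖ u + 1)) ∨
    (∀ (T G : MvPowerSeries σ D) (s : ℕ), T ≠ 0 →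
      T * u ^ s - G * w ^ s ∈ JJ ϖ σ (vv ϖ T + s * vv ϖ u + 1) → s ≤ vv ϖ T) := by
  classical
  obtain ⟨U, hU0, hU⟩ := exists_init ϖ res h0 hker hsep hu
  obtain ⟨W, hW0, hW⟩ := exists_init ϖ res h0 hker hsep hw
  -- the basic relation between initial forms
  have key : ∀ (T G : MvPowerSeries σ D) (s : ℕ), T ≠ 0 →
      T * u ^ s - G * w ^ s ∈ JJ ϖ σ (vv ϖ T + s * vv ϖ u + 1) →
      ∃ P Q : MvPolynomial σ k, ∃ g : ℕ, P ≠ 0 ∧ P * U ^ s = Q * W ^ s ∧ P.totalDegree ≤ vv ϖ T ∧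
        Q.totalDegree ≤ g ∧ g + s * vv ϖ w = vv ϖ T + s * vv ϖ u := by
    intro T G s hT hTG
    obtain ⟨P, hP0, hP⟩ := exists_init ϖ res h0 hker hsep hT
    have h1 := hP.mul ϖ res hker (hU.pow ϖ res hker s)
    have h1ne : P * U ^ s ≠ 0 := mul_ne_zero hP0 (pow_ne_zero _ hU0)
    have hG : G ≠ 0 := by
      rintro rfl
      rw [zero_mul, sub_zero, ← h1.eq_zero_iff ϖ res h0 hker] at hTG
      exact h1ne hTG
    obtain ⟨Q, hQ0, hQ⟩ := exists_init ϖ res h0 hker hsep hG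
    have h2 := hQ.mul ϖ res hker (hW.pow ϖ res hker s)
    have h2ne : Q * W ^ s ≠ 0 := mul_ne_zero hQ0 (pow_ne_zero _ hW0)
    have e1 : vv ϖ G + s * vv ϖ w = vv ϖ T + s * vv ϖ u := by
      rcases lt_trichotomy (vv ϖ G + s * vv ϖ w) (vv ϖ T + s * vv ϖ u) with h | h | h
      · exfalso
        apply h2ne
        rw [h2.eq_zero_iff ϖ res h0 hker]
        have := sub_mem (JJ_anti ϖ (show vv ϖ G + s * vv ϖ w + 1 ≤ vv ϖ T + s * vv ϖ u by omega)
          (h1.mem ϖ res)) (JJ_anti ϖ (show vv ϖ G + s * vv ϖ w + 1 ≤ vv ϖ T + s * vv ϖ u + 1 by omega) hTG)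
        simpa using this
      · exact h
      · exfalso
        apply h1ne
        rw [h1.eq_zero_iff ϖ res h0 hker]
        have := add_mem hTG (JJ_anti ϖ (show vv ϖ T + s * vv ϖ u + 1 ≤ vv ϖ G + s * vv ϖ w by omega)
          (h2.mem ϖ res))
        simpa using this
    refine ⟨P, Q, vv ϖ G, hP0, ?_, hP.degree_le, hQ.degree_le, e1⟩
    rw [e1] at h2
    exact sub_eq_zero.1 (((h1.sub ϖ res h2).eq_zero_iff ϖ res h0 hker).2 hTG)
  by_cases hdvd : W ∣ U
  · obtain ⟨Q, rfl⟩ := hdvd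
    have hQ0 : Q ≠ 0 := right_ne_zero_of_mul hU0
    by_cases hdeg : Q.totalDegree + vv ϖ w ≤ vv ϖ u
    · left
      obtain ⟨z, hz⟩ := exists_Rep_of_degree_le ϖ res hsurj
        (show Q.totalDegree ≤ vv ϖ u - vv ϖ w by omega)
      refine ⟨z, ?_⟩
      have h1 := hz.mul ϖ res hker hW
      rw [show vv ϖ u - vv ϖ w + vv ϖ w = vv ϖ u by omega] at h1
      rw [← (hU.sub ϖ res h1).eq_zero_iff ϖ res h0 hker]
      ring
    · right
      intro T G s hT hTG
      obtain ⟨P, Q', g, hP0, hPQ, hdP, hdQ, hg⟩ := key T G s hT hTG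
      have h1 : P * Q ^ s = Q' := by
        have : W ^ s * (P * Q ^ s) = W ^ s * Q' := by
          rw [mul_comm _ Q', ← hPQ]; ring
        exact mul_left_cancel₀ (pow_ne_zero _ hW0) this
      have h2 : P.totalDegree + s * Q.totalDegree ≤ g := by
        refine le_trans (le_of_eq ?_) hdQ
        rw [← h1, MvPolynomial.totalDegree_mul_of_isDomain hP0 (pow_ne_zero _ hQ0),
          totDeg_pow]
      push Not at hdeg
      have h3 : s * (vv ϖ u + 1) ≤ s * (Q.totalDegree + vv ϖ w) := Nat.mul_le_mul_left _ hdeg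
      rw [mul_add, mul_add] at h3
      omega
  · right
    intro T G s hT hTG
    obtain ⟨P, Q', g, hP0, hPQ, hdP, hdQ, hg⟩ := key T G s hT hTG
    obtain ⟨U', W', G', hrel, rfl, rfl⟩ : ∃ U' W' G', IsRelPrime U' W' ∧ G' * U' = U ∧ G' * W' = W := by
      obtain ⟨U', W', G', h1, h2, h3⟩ := UniqueFactorizationMonoid.exists_reduced_factors U hU0 W
      exact ⟨U', W', G', h1, h2, h3⟩
    have hG0 : G' ≠ 0 := left_ne_zero_of_mul hU0
    have hW'0 : W' ≠ 0 := right_ne_zero_of_mul hW0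
    have hW'u : ¬ IsUnit W' := by
      intro h
      apply hdvd
      exact mul_dvd_mul_left _ (h.dvd)
    obtain ⟨π, hπ, hπW⟩ := WfDvdMonoid.exists_irreducible_factor hW'u hW'0
    have hπp : Prime π := hπ.prime
    have hπU : ¬ π ∣ U' := fun h => hπ.not_isUnit (hrel h hπW)
    have h1 : P * U' ^ s = Q' * W' ^ s := by
      have : G' ^ s * (P * U' ^ s) = G' ^ s * (Q' * W' ^ s) := by
        rw [mul_pow, mul_pow] at hPQ
        linear_combination hPQ
      exact mul_left_cancel₀ (pow_ne_zero _ hG0) this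
    have h2 : π ^ s ∣ P := by
      have h3 : π ^ s ∣ P * U' ^ s := by
        rw [h1]; exact Dvd.dvd.mul_left (pow_dvd_pow_of_dvd hπW s) _
      exact hπp.pow_dvd_of_dvd_mul_right s (fun h => hπU (hπp.dvd_of_dvd_pow h)) h3
    have h4 : 1 ≤ π.totalDegree := by
      by_contra hc
      have : π.totalDegree = 0 := by omega
      rw [MvPolynomial.totalDegree_eq_zero_iff_eq_C] at this
      have hne := hπ.ne_zero
      rw [this] at hne
      apply hπ.not_isUnit
      rw [this]
      apply IsUnit.map
      rw [isUnit_iff_ne_zero]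
      rintro h
      rw [h] at hne
      simp at hne
    obtain ⟨P', rfl⟩ := h2
    have hP' : P' ≠ 0 := right_ne_zero_of_mul hP0
    rw [MvPolynomial.totalDegree_mul_of_isDomain (pow_ne_zero _ hπ.ne_zero) hP',
      totDeg_pow] at hdP
    have : s * 1 ≤ s * π.totalDegree := Nat.mul_le_mul_left _ h4
    omega

variable (hcompl : ∀ s : ℕ → D, (∀ n, ϖ ^ n ∣ s (n + 1) - s n) → ∃ l, ∀ n, ϖ ^ n ∣ l - s n)

include hcompl in
lemma complete_aux (s : ℕ → MvPowerSeries σ D) (hs : ∀ n, s (n + 1) - s n ∈ JJ ϖ σ n) :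
    ∃ l, ∀ n, l - s n ∈ JJ ϖ σ n := by
  have : ∀ α : σ →₀ ℕ, ∃ l, ∀ n, ϖ ^ n ∣ l - coeff α (s (n + degree α)) := by
    intro α
    apply hcompl
    intro n
    have := hs (n + degree α) α
    rw [map_sub] at this
    simpa [add_right_comm] using this
  choose l hl using this
  refine ⟨l, fun n α => ?_⟩
  by_cases h : degree α ≤ n
  · have := hl α (n - degree α)
    rw [Nat.sub_add_cancel h] at this
    exact this
  · rw [show n - degree α = 0 by omega]; simp

include h0 hker hsep hsurj hcompl in
theorem adicBase_mvPowerSeries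
    (frob : ∀ e : ℕ, ∀ t : MvPowerSeries σ D, t ≠ 0 → ∃ Λ : MvPowerSeries σ D →+ MvPowerSeries σ D,
      (∀ s t, Λ (s ^ (ringExpChar (MvPowerSeries σ D) ^ e) * t) = s * Λ t) ∧ Λ t ≠ 0 ∧
      ∃ c : ℕ, ∀ n s, s ∈ JJ ϖ σ ((ringExpChar (MvPowerSeries σ D) ^ e) * n + c) →
        Λ s ∈ JJ ϖ σ n) :
    AdicBase (MvPowerSeries σ D) (NN ϖ σ) (vv ϖ) where
  mem_pow n s hs := by rw [NN_pow, mem_JJ_iff ϖ hsep hs]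
  vmul s t hs ht := by
    obtain ⟨P, hP0, hP⟩ := exists_init ϖ res h0 hker hsep hs
    obtain ⟨Q, hQ0, hQ⟩ := exists_init ϖ res h0 hker hsep ht
    exact vv_eq ϖ res h0 hker hsep (mul_ne_zero hs ht) (mul_ne_zero hP0 hQ0) (hP.mul ϖ res hker hQ)
  nontriv := by
    have h1 : (C ϖ : MvPowerSeries σ D) ≠ 0 := by
      intro h
      have := congrArg constantCoeff h
      simp at this
      exact h0 this
    refine ⟨C ϖ, h1, ?_⟩
    rw [← mem_JJ_iff ϖ hsep h1]
    exact NN_le ϖ (C_mem_NN ϖ)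
  complete s hs := by
    simp only [NN_pow] at *
    exact complete_aux ϖ hcompl s hs
  dich u w hu hw := by
    simp only [NN_pow] at *
    exact dich_aux ϖ res h0 hsurj hker hsep u w hu hw
  frob := by
    simp only [NN_pow] at *
    exact frob

end Rep

end Izumi

set_option linter.unusedSectionVars false
set_option linter.style.haveILetI false

namespace Izumi

open MvPowerSeries Finsupp

/-- Existence of many `q`-inverse-linear functionals. -/
def SL (D : Type*) [CommRing D] (q : ℕ) : Prop :=
  ∀ t : D, t ≠ 0 → ∃ f : D →+ D, (∀ s t, f (s ^ q * t) = s * f t) ∧ f t ≠ 0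

lemma exists_dual {k V : Type*} [Field k] [AddCommGroup V] [Module k V] (t : V) (ht : t ≠ 0) :
    ∃ f : V →+ k, (∀ (s : k) (x : V), f (s • x) = s * f x) ∧ f t ≠ 0 := by
  by_contra! h
  apply ht
  rw [← Module.forall_dual_apply_eq_zero_iff k]
  intro f
  exact h f.toAddMonoidHom (fun s x => by simp)

lemma SL_field (k : Type*) [Field k] (p : ℕ) [ExpChar k p] (e : ℕ) : SL k (p ^ e) := by
  intro t ht
  obtain ⟨f, h1, h2⟩ := @exists_dual k k _ _ (Module.compHom k (iterateFrobenius k p e)) t ht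
  refine ⟨f, fun s x => ?_, h2⟩
  have := h1 s x
  rw [← this]
  congr 1

lemma SL_mv {σ D : Type*} [CommRing D] (p : ℕ) [ExpChar D p] (e : ℕ)
    (h : SL D (p ^ e)) (ϖ : D) (t : MvPowerSeries σ D) (ht : t ≠ 0) :
    ∃ Λ : MvPowerSeries σ D →+ MvPowerSeries σ D,
      (∀ s t, Λ (s ^ (p ^ e) * t) = s * Λ t) ∧ Λ t ≠ 0 ∧
      ∃ c : ℕ, ∀ n s, s ∈ JJ ϖ σ (p ^ e * n + c) → Λ s ∈ JJ ϖ σ n := by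
  classical
  have hp : p ≠ 0 := expChar_ne_zero D p
  have hq : p ^ e ≠ 0 := pow_ne_zero _ hp
  have hcoe : ∀ (s : MvPowerSeries σ D) (γ : σ →₀ ℕ), coeff (p ^ e • γ) (s ^ (p ^ e)) = (coeff γ s) ^ (p ^ e) := by
    intro s γ
    rw [← map_iterateFrobenius_expand p hp, coeff_map, coeff_expand_smul, iterateFrobenius_def]
  have hcoe0 : ∀ (s : MvPowerSeries σ D) (γ : σ →₀ ℕ) (i : σ), ¬ (p ^ e ∣ γ i) → coeff γ (s ^ (p ^ e)) = 0 := by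
    intro s γ i hi
    rw [← map_iterateFrobenius_expand p hp, coeff_map, coeff_expand_of_not_dvd _ _ _ hi, map_zero]
  generalize p ^ e = q at *
  obtain ⟨α, hα⟩ : ∃ α, coeff α t ≠ 0 := by
    by_contra! hc
    exact ht (by ext α; simpa using hc α)
  let α0 : σ →₀ ℕ := α.mapRange (fun x => x % q) (by simp)
  let β0 : σ →₀ ℕ := α.mapRange (fun x => x / q) (by simp)
  have hαβ : α0 + q • β0 = α := by
    ext i
    exact Nat.mod_add_div _ _
  have hα0 : ∀ i, α0 i < q := fun i => Nat.mod_lt _ (by omega)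
  obtain ⟨f, hf, hft⟩ := h _ hα
  let Λ : MvPowerSeries σ D →+ MvPowerSeries σ D :=
    { toFun := fun s β => f (coeff (α0 + q • β) s)
      map_zero' := by ext β; change f _ = 0; simp
      map_add' := fun s t => by
        ext β
        change f _ = f _ + f _
        rw [map_add, map_add] }
  have hΛ : ∀ s β, coeff β (Λ s) = f (coeff (α0 + q • β) s) := fun _ _ => rfl
  refine ⟨Λ, fun s x => ?_, fun hc => ?_, degree α0, fun n s hs β => ?_⟩
  · ext β
    rw [hΛ, coeff_mul, coeff_mul, map_sum]
    symm
    apply Finset.sum_of_injOn (fun x : (σ →₀ ℕ) × (σ →₀ ℕ) => (q • x.1, α0 + q • x.2))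
    · rintro ⟨a, b⟩ _ ⟨a', b'⟩ _ hab
      simp only [Prod.mk.injEq, add_right_inj] at hab
      have hinj : ∀ c d : σ →₀ ℕ, q • c = q • d → c = d := by
        intro c d hcd
        ext i
        have := DFunLike.congr_fun hcd i
        simpa [hq] using this
      exact Prod.ext (hinj _ _ hab.1) (hinj _ _ hab.2)
    · rintro ⟨a, b⟩ hab
      simp only [Finset.mem_coe, Finset.HasAntidiagonal.mem_antidiagonal] at hab ⊢
      rw [← hab, smul_add]; abel
    · rintro ⟨γ, δ⟩ hγ hn
      rw [Finset.HasAntidiagonal.mem_antidiagonal] at hγ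
      simp only at hγ ⊢
      by_cases hd : ∀ i, q ∣ γ i
      · exfalso
        apply hn
        let γ' : σ →₀ ℕ := γ.mapRange (fun x => x / q) (by simp)
        have hγ' : ∀ i, γ i = q * γ' i := fun i => by
          simp [γ', Nat.mul_div_cancel' (hd i)]
        have hle : γ' ≤ β := by
          intro i
          have h1 := DFunLike.congr_fun hγ i
          simp only [Finsupp.add_apply, Finsupp.smul_apply, smul_eq_mul] at h1
          rw [hγ' i] at h1
          have h2 := hα0 i
          by_contra hc
          have h3 : q * (β i + 1) ≤ q * γ' i := Nat.mul_le_mul_left _ (by omega)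
          rw [mul_add] at h3
          omega
        refine ⟨(γ', β - γ'), ?_, ?_⟩
        · simp only [Finset.mem_coe, Finset.HasAntidiagonal.mem_antidiagonal]
          exact add_tsub_cancel_of_le hle
        · have e1 : q • γ' = γ := by ext i; simp [hγ' i]
          simp only [Prod.mk.injEq]
          refine ⟨e1, ?_⟩
          have : γ + (α0 + q • (β - γ')) = γ + δ := by
            rw [hγ, ← e1, add_left_comm, ← smul_add, add_tsub_cancel_of_le hle]
          exact add_left_cancel this
      · push Not at hd
        obtain ⟨i, hi⟩ := hd
        rw [hcoe0 s γ i hi, zero_mul, map_zero]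
    · rintro ⟨a, b⟩ _
      simp only
      rw [hcoe, hf, hΛ]
  · have := congrArg (coeff β0) hc
    rw [hΛ, hαβ] at this
    exact hft (by simpa using this)
  · rw [hΛ]
    have h1 := hs (α0 + q • β)
    have h2 : q * n + degree α0 - degree (α0 + q • β) = (n - degree β) * q := by
      rw [map_add, map_nsmul, smul_eq_mul, Nat.sub_mul, mul_comm n, mul_comm (degree β)]; omega
    rw [h2, pow_mul] at h1
    obtain ⟨d, hd⟩ := h1
    rw [hd, hf]
    exact dvd_mul_right _ _

end Izumi

set_option linter.unusedSectionVars false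
set_option linter.style.haveILetI false

namespace Izumi

/-- In characteristic `p`, a square-zero extension of a field has a section. -/
lemma exists_section {B k : Type*} [CommRing B] [Field k] (p : ℕ) [Fact p.Prime] [CharP B p]
    [CharP k p] (π : B →+* k) (hπ : Function.Surjective π)
    (hsq : ∀ x y, π x = 0 → π y = 0 → x * y = 0) :
    ∃ g : k →+* B, ∀ c, π (g c) = c := by
  classical
  have hp : p.Prime := Fact.out
  have hpp : ∀ x, π x = 0 → x ^ p = 0 := by
    intro x hx
    obtain ⟨r, hr⟩ : ∃ r, p = r + 2 := ⟨p - 2, by have := hp.two_le; omega⟩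
    rw [hr, pow_add, pow_two, hsq x x hx hx, mul_zero]
  have hlift : ∀ x y, π x = π y → x ^ p = y ^ p := by
    intro x y hxy
    have := hpp (x - y) (by rw [map_sub, hxy, sub_self])
    rw [sub_pow_char] at this
    exact sub_eq_zero.1 this
  -- subrings meeting the kernel trivially and containing the `p`-th powers
  let Z : Set (Subring B) := {L | (∀ x : B, x ^ p ∈ L) ∧ ∀ x ∈ L, π x = 0 → x = 0}
  have hZ0 : (frobenius B p).range ∈ Z := by
    refine ⟨fun x => ⟨x, rfl⟩, ?_⟩
    rintro _ ⟨x, rfl⟩ hx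
    rw [frobenius_def] at hx ⊢
    rw [map_pow] at hx
    exact hpp x (eq_zero_of_pow_eq_zero hx)
  obtain ⟨L, hL0, hL⟩ := zorn_le_nonempty₀ Z (by
    intro c hc hchain y hy
    refine ⟨sSup c, ⟨fun x => ?_, fun x hx hx0 => ?_⟩, fun z hz => le_sSup hz⟩
    · exact (le_sSup hy : y ≤ sSup c) ((hc hy).1 x)
    · rw [Subring.mem_sSup_of_directedOn ⟨y, hy⟩ hchain.directedOn] at hx
      obtain ⟨s, hs, hxs⟩ := hx
      exact (hc hs).2 x hxs hx0) _ hZ0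
  have hLZ : L ∈ Z := hL.prop
  obtain ⟨hL1, hL2⟩ := hLZ
  have hinj : Function.Injective (π.comp L.subtype) := by
    rw [injective_iff_map_eq_zero]
    intro x hx
    exact Subtype.ext (hL2 x x.2 hx)
  haveI : Nontrivial B := hπ.nontrivial
  have hfield : IsField L := by
    refine ⟨⟨0, 1, zero_ne_one⟩, mul_comm, ?_⟩
    intro a ha
    have hπa : π a ≠ 0 := fun h => ha (Subtype.ext (hL2 a a.2 h))
    obtain ⟨b, hb⟩ := hπ (π a)⁻¹
    have h1 : ((a : B) * b) ^ p = 1 := by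
      rw [hlift (a * b) 1 (by rw [map_mul, hb, mul_inv_cancel₀ hπa, map_one]), one_pow]
    refine ⟨⟨a ^ (p - 1) * b ^ p, mul_mem (pow_mem a.2 _) (hL1 b)⟩, ?_⟩
    apply Subtype.ext
    change (a : B) * (a ^ (p - 1) * b ^ p) = 1
    rw [← mul_assoc, ← pow_succ', Nat.sub_add_cancel hp.one_le, ← mul_pow, h1]
  letI : Field L := hfield.toField
  letI : Algebra L k := (π.comp L.subtype).toAlgebra
  have hsurj : Function.Surjective (π.comp L.subtype) := by
    intro c
    by_contra hc
    push Not at hc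
    obtain ⟨b, rfl⟩ := hπ c
    let a : L := ⟨b ^ p, hL1 b⟩
    have hirr : Irreducible (Polynomial.X ^ p - Polynomial.C a) := by
      apply X_pow_sub_C_irreducible_of_prime hp
      intro y hy
      apply hc y
      have h2 : (π y) ^ p = (π b) ^ p := by
        rw [← map_pow, ← map_pow]
        congr 1
        exact congrArg Subtype.val hy
      exact frobenius_inj k p h2
    have hmin : ∀ f : Polynomial L, Polynomial.aeval (π b) f = 0 →
        (Polynomial.X ^ p - Polynomial.C a) ∣ f := by
      intro f hf
      have h3 : Polynomial.aeval (π b) (Polynomial.X ^ p - Polynomial.C a) = 0 := by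
        rw [map_sub, map_pow, Polynomial.aeval_X, Polynomial.aeval_C]
        change π b ^ p - π (b ^ p) = 0
        rw [map_pow, sub_self]
      rw [minpoly.eq_of_irreducible_of_monic hirr h3 (Polynomial.monic_X_pow_sub_C _ hp.ne_zero)]
      exact minpoly.dvd _ _ hf
    let L' : Subring B := (Polynomial.eval₂RingHom L.subtype b).range
    have hLL' : L ≤ L' := fun x hx => ⟨Polynomial.C ⟨x, hx⟩, by simp⟩
    have hL' : L' ∈ Z := by
      refine ⟨fun x => hLL' (hL1 x), ?_⟩
      rintro _ ⟨f, rfl⟩ hx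
      have h4 : Polynomial.aeval (π b) f = 0 := by
        rw [← hx, Polynomial.coe_eval₂RingHom, Polynomial.hom_eval₂]
        rfl
      obtain ⟨g, rfl⟩ := hmin f h4
      simp [a]
    have h5 : L' ≤ L := hL.le_of_ge hL' hLL'
    have h6 : b ∈ L := h5 ⟨Polynomial.X, by simp⟩
    exact hc ⟨b, h6⟩ rfl
  let e := RingEquiv.ofBijective _ ⟨hinj, hsurj⟩
  refine ⟨L.subtype.comp e.symm.toRingHom, fun c => ?_⟩
  exact e.apply_symm_apply c

lemma formallySmooth_charP (k : Type*) [Field k] (p : ℕ) [Fact p.Prime] [CharP k p]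
    [Algebra (ZMod p) k] : Algebra.FormallySmooth (ZMod p) k := by
  let f : MvPolynomial k (ZMod p) →ₐ[ZMod p] k := MvPolynomial.aeval id
  have hf : Function.Surjective f := fun x => ⟨MvPolynomial.X x, by simp [f]⟩
  rw [Algebra.FormallySmooth.iff_split_surjection f hf]
  have hs : Function.Surjective f.kerSquareLift := by
    intro x
    obtain ⟨y, hy⟩ := hf x
    exact ⟨Ideal.Quotient.mk (RingHom.ker f.toRingHom ^ 2) y, hy⟩
  haveI : Nontrivial (MvPolynomial k (ZMod p) ⧸ RingHom.ker f.toRingHom ^ 2) := hs.nontrivial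
  haveI : CharP (MvPolynomial k (ZMod p) ⧸ RingHom.ker f.toRingHom ^ 2) p :=
    charP_of_injective_algebraMap (algebraMap (ZMod p) _).injective p
  obtain ⟨g, hg⟩ := exists_section p (f.kerSquareLift : (MvPolynomial k (ZMod p) ⧸ RingHom.ker f.toRingHom ^ 2) →+* k) hs (by
    intro x y hx hy
    obtain ⟨x, rfl⟩ := Ideal.Quotient.mk_surjective x
    obtain ⟨y, rfl⟩ := Ideal.Quotient.mk_surjective y
    rw [← map_mul, Ideal.Quotient.eq_zero_iff_mem, pow_two]
    exact Ideal.mul_mem_mul hx hy)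
  let g' : k →ₐ[ZMod p] (MvPolynomial k (ZMod p) ⧸ RingHom.ker f.toRingHom ^ 2) :=
    { g with
      commutes' := fun r => by
        have : (g.comp (algebraMap (ZMod p) k)) = algebraMap (ZMod p) _ := RingHom.ext_zmod _ _
        exact congrArg (fun h => h r) this }
  exact ⟨g', AlgHom.ext hg⟩

lemma formallySmooth_charZero (k : Type*) [Field k] [Algebra ℚ k] :
    Algebra.FormallySmooth ℚ k := by
  obtain ⟨s, hs⟩ := exists_isTranscendenceBasis ℚ k
  have : Algebra.IsAlgebraic (IntermediateField.adjoin ℚ (Set.range ((↑) : s → k))) k :=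
    hs.isAlgebraic_field
  exact .of_algebraicIndependent_of_isSeparable hs.1

end Izumi

set_option linter.unusedSectionVars false
set_option linter.style.haveILetI false

namespace Izumi

open MvPowerSeries in
theorem exists_eval {σ D A : Type*} [Finite σ] [CommRing D] [CommRing A] (I : Ideal A)
    [hI : IsAdicComplete I A] (ψ : D →+* A) (x : σ → A) (hx : ∀ i, x i ∈ I) :
    ∃ φ : MvPowerSeries σ D →+* A, (∀ d, φ (MvPowerSeries.C d) = ψ d) ∧
      ∀ i, φ (MvPowerSeries.X i) = x i := by
  letI : WithIdeal A := ⟨I⟩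
  letI : UniformSpace D := ⊥
  haveI : DiscreteTopology D := ⟨rfl⟩
  haveI : DiscreteUniformity D := ⟨rfl⟩
  have hA : IsAdic I := rfl
  obtain ⟨h1, h2⟩ := hA.isAdicComplete_iff.1 hI
  have hc : Continuous ψ := continuous_of_discreteTopology
  have he : MvPowerSeries.HasEval x :=
    ⟨fun s => WithIdeal.isTopologicallyNilpotent_of_mem (hx s), by
      rw [Filter.cofinite_eq_bot]; exact Filter.tendsto_bot⟩
  refine ⟨MvPowerSeries.eval₂Hom hc he, fun d => ?_, fun i => ?_⟩
  · rw [coe_eval₂Hom, eval₂_C]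
  · rw [coe_eval₂Hom, eval₂_X]

structure CoefRing (D : Type*) [CommRing D] (ϖ : D) {k : Type*} [Field k] (res : D →+* k) :
    Prop where
  h0 : ϖ ≠ 0
  hsurj : Function.Surjective res
  hker : ∀ x, res x = 0 ↔ ϖ ∣ x
  hsep : ∀ x, (∀ n : ℕ, ϖ ^ n ∣ x) → x = 0
  hcompl : ∀ s : ℕ → D, (∀ n, ϖ ^ n ∣ s (n + 1) - s n) → ∃ l, ∀ n, ϖ ^ n ∣ l - s n
  sl : ∀ e, SL D (ringExpChar D ^ e)

namespace CoefRing

variable {D : Type*} [CommRing D] [IsDomain D] {ϖ : D} {k : Type*} [Field k] {res : D →+* k}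

theorem adicBase (h : CoefRing D ϖ res) (σ : Type*) [Finite σ] :
    AdicBase (MvPowerSeries σ D) (NN ϖ σ) (vv ϖ) := by
  refine adicBase_mvPowerSeries ϖ res h.h0 h.hsurj h.hker h.hsep h.hcompl ?_
  have hE : ExpChar (MvPowerSeries σ D) (ringExpChar D) :=
    expChar_of_injective_ringHom (f := (MvPowerSeries.C : D →+* MvPowerSeries σ D))
      (MvPowerSeries.C_injective) (ringExpChar D)
  have : ringExpChar (MvPowerSeries σ D) = ringExpChar D := ringExpChar.eq _ _
  rw [this]
  intro e t ht
  exact SL_mv (ringExpChar D) e (h.sl e) ϖ t ht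

theorem isUnit (h : CoefRing D ϖ res) {x : D} (hx : res x ≠ 0) : IsUnit x := by
  obtain ⟨y, hy⟩ := h.hsurj (res x)⁻¹
  have h1 : res (1 - x * y) = 0 := by simp [hy, hx]
  obtain ⟨z, hz⟩ := (h.hker _).1 h1
  obtain ⟨l, hl⟩ := h.hcompl (fun n => ∑ i ∈ Finset.range n, (ϖ * z) ^ i) (fun n => by
    rw [Finset.sum_range_succ, add_sub_cancel_left, mul_pow]
    exact dvd_mul_right _ _)
  have h2 : x * y * l - 1 = 0 := by
    refine h.hsep _ fun n => ?_
    obtain ⟨w, hw⟩ := hl n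
    have h3 : (1 - ϖ * z) * (∑ i ∈ Finset.range n, (ϖ * z) ^ i) = 1 - (ϖ * z) ^ n :=
      mul_neg_geom_sum _ _
    have h4 : x * y = 1 - ϖ * z := by rw [← hz]; ring
    refine ⟨(1 - ϖ * z) * w - z ^ n, ?_⟩
    have h5 : l = ∑ i ∈ Finset.range n, (ϖ * z) ^ i + ϖ ^ n * w := by rw [← hw]; ring
    rw [h4, h5, mul_add, h3, mul_pow]; ring
  exact IsUnit.of_mul_eq_one (y * l) (by linear_combination h2)

theorem irreducible (h : CoefRing D ϖ res) : Irreducible ϖ := by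
  have h1 : res ϖ = 0 := (h.hker _).2 dvd_rfl
  have key : ∀ a b : D, ϖ = a * b → res a = 0 → IsUnit b := by
    intro a b hab ha
    obtain ⟨c, rfl⟩ := (h.hker a).1 ha
    refine IsUnit.of_mul_eq_one c (mul_left_cancel₀ h.h0 ?_)
    linear_combination -hab
  refine ⟨fun hu => (hu.map res).ne_zero h1, fun a b hab => ?_⟩
  have h2 : res a * res b = 0 := by rw [← map_mul, ← hab, h1]
  rcases mul_eq_zero.1 h2 with h3 | h3
  · exact Or.inr (key a b hab h3)
  · exact Or.inl (key b a (by rw [hab, mul_comm]) h3)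

theorem isDVR (h : CoefRing D ϖ res) : IsDiscreteValuationRing D := by
  refine IsDiscreteValuationRing.ofHasUnitMulPowIrreducibleFactorization ?_
  refine ⟨ϖ, h.irreducible, fun {x} hx => ?_⟩
  have h1 : ∃ n, ¬ ϖ ^ n ∣ x := by
    by_contra! hn
    exact hx (h.hsep x hn)
  classical
  obtain ⟨n, hn⟩ : ∃ n, Nat.find h1 = n + 1 := by
    refine Nat.exists_eq_succ_of_ne_zero fun h0 => ?_
    have := Nat.find_spec h1
    rw [h0] at this
    simp at this
  have h2 : ϖ ^ n ∣ x := by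
    by_contra h3
    exact Nat.find_min h1 (m := n) (by omega) h3
  have h4 := Nat.find_spec h1
  rw [hn] at h4
  obtain ⟨u, rfl⟩ := h2
  have h5 : res u ≠ 0 := fun h6 => by
    obtain ⟨w, rfl⟩ := (h.hker u).1 h6
    exact h4 ⟨w, by ring⟩
  obtain ⟨u, rfl⟩ := h.isUnit h5
  exact ⟨n, u, rfl⟩

end CoefRing

end Izumi

set_option linter.unusedSectionVars false
set_option linter.style.haveILetI false

namespace Izumi

theorem section_of_smooth {F k B : Type*} [CommRing F] [Field k] [CommRing B] [Algebra F B]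
    [Algebra F k] [Algebra.FormallySmooth F k] (I : Ideal B) [IsAdicComplete I B]
    (π : B →ₐ[F] k) (hπ : Function.Surjective π) (hI : RingHom.ker π = I) :
    ∃ g : k →+* B, ∀ c, π (g c) = c := by
  subst hI
  let e := Ideal.quotientKerAlgEquivOfSurjective hπ
  obtain ⟨g, hg⟩ := Algebra.FormallySmooth.exists_mkₐ_comp_eq_of_isAdicComplete
    (I := RingHom.ker π) (e.symm : k →ₐ[F] B ⧸ RingHom.ker π)
  refine ⟨g, fun c => ?_⟩
  have h1 : Ideal.Quotient.mk (RingHom.ker π) (g c) = e.symm c := DFunLike.congr_fun hg c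
  have h2 : e (Ideal.Quotient.mk (RingHom.ker π) (g c)) = c := by rw [h1]; simp
  exact h2

theorem section_charP {k B : Type*} [Field k] [CommRing B] (p : ℕ) [Fact p.Prime] [CharP B p]
    (I : Ideal B) [IsAdicComplete I B]
    (π : B →+* k) (hπ : Function.Surjective π) (hI : RingHom.ker π = I) :
    ∃ g : k →+* B, ∀ c, π (g c) = c := by
  letI := ZMod.algebra B p
  letI : Algebra (ZMod p) k := (π.comp (algebraMap (ZMod p) B)).toAlgebra
  haveI : CharP k p := charP_of_injective_algebraMap (algebraMap (ZMod p) k).injective p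
  haveI := formallySmooth_charP k p
  let π' : B →ₐ[ZMod p] k := { π with commutes' := fun r => rfl }
  exact section_of_smooth I π' hπ hI

theorem section_charZero {k B : Type*} [Field k] [CommRing B] [CharZero k] [Algebra ℚ B]
    (I : Ideal B) [IsAdicComplete I B]
    (π : B →+* k) (hπ : Function.Surjective π) (hI : RingHom.ker π = I) :
    ∃ g : k →+* B, ∀ c, π (g c) = c := by
  letI : Algebra ℚ k := (π.comp (algebraMap ℚ B)).toAlgebra
  haveI := formallySmooth_charZero k
  let π' : B →ₐ[ℚ] k := { π with commutes' := fun r => rfl }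
  exact section_of_smooth I π' hπ hI

theorem precomplete_of_surj {A M N : Type*} [CommRing A] [AddCommGroup M] [Module A M]
    [AddCommGroup N] [Module A N] (I : Ideal A) [IsPrecomplete I M] (f : M →ₗ[A] N)
    (hf : Function.Surjective f) : IsPrecomplete I N := by
  rw [← AdicCompletion.of_surjective_iff]
  intro y
  obtain ⟨x, rfl⟩ := AdicCompletion.map_surjective I hf y
  obtain ⟨x, rfl⟩ := AdicCompletion.of_surjective I M x
  exact ⟨f x, by rw [AdicCompletion.map_of]⟩

open IsLocalRing

theorem complete_quot {A : Type*} [CommRing A] [IsNoetherianRing A] [IsLocalRing A]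
    [IsAdicComplete (maximalIdeal A) A] (J : Ideal A) :
    IsAdicComplete ((maximalIdeal A).map (Ideal.Quotient.mk J)) (A ⧸ J) := by
  haveI := precomplete_of_surj (maximalIdeal A) J.mkQ J.mkQ_surjective
  exact (IsAdicComplete.map_algebraMap_iff (S := A ⧸ J) (maximalIdeal A) (A ⧸ J)).2 {}

theorem adic_limit {A : Type*} [CommRing A] [IsNoetherianRing A] [IsLocalRing A]
    [IsAdicComplete (maximalIdeal A) A] (x : A) (hx : x ∈ maximalIdeal A) (s : ℕ → A)
    (hs : ∀ n, x ^ n ∣ s (n + 1) - s n) : ∃ l, ∀ n, x ^ n ∣ l - s n := by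
  have h1 : ∀ n k, x ^ n ∣ s (n + k) - s n := by
    intro n k
    induction k with
    | zero => simp
    | succ k ih =>
      have : s (n + (k + 1)) - s n = (s (n + k + 1) - s (n + k)) + (s (n + k) - s n) := by
        rw [← add_assoc]; ring
      rw [this]
      exact dvd_add ((pow_dvd_pow _ (by omega)).trans (hs (n + k))) ih
  obtain ⟨l, hl⟩ := IsPrecomplete.prec (I := maximalIdeal A) (M := A) inferInstance (f := s) (by
    intro m n hmn
    obtain ⟨k, rfl⟩ := Nat.exists_eq_add_of_le hmn
    rw [SModEq.sub_mem, smul_eq_mul, Ideal.mul_top, ← neg_sub, neg_mem_iff]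
    obtain ⟨w, hw⟩ := h1 m k
    rw [hw]
    exact Ideal.mul_mem_right _ _ (Ideal.pow_mem_pow hx m))
  refine ⟨l, fun n => ?_⟩
  rw [← Ideal.mem_span_singleton, ← Ideal.Quotient.eq_zero_iff_mem]
  refine IsHausdorff.haus (I := maximalIdeal A) (M := A ⧸ Ideal.span {x ^ n}) inferInstance _
    fun k => ?_
  rw [SModEq.zero]
  have h2 : (Ideal.Quotient.mk (Ideal.span {x ^ n})) (l - s n)
      = (Ideal.Quotient.mk (Ideal.span {x ^ n})) (l - s (n + k)) := by
    rw [Ideal.Quotient.eq, Ideal.mem_span_singleton]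
    have : l - s n - (l - s (n + k)) = s (n + k) - s n := by ring
    rw [this]; exact h1 n k
  rw [h2]
  have h3 := hl (n + k)
  rw [SModEq.sub_mem, smul_eq_mul, Ideal.mul_top, ← neg_sub, neg_mem_iff] at h3
  have h4 : l - s (n + k) ∈ maximalIdeal A ^ k := Ideal.pow_le_pow_right (by omega) h3
  have h5 : (Ideal.Quotient.mk (Ideal.span {x ^ n})) (l - s (n + k)) =
    (l - s (n + k)) • (1 : A ⧸ Ideal.span {x ^ n}) := by
    rw [Algebra.smul_def, mul_one]; rfl
  rw [h5]
  exact Submodule.smul_mem_smul h4 trivial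

theorem adic_sep {A : Type*} [CommRing A] [IsNoetherianRing A] [IsLocalRing A]
    (x : A) (hx : x ∈ maximalIdeal A) (y : A) (hy : ∀ n : ℕ, x ^ n ∣ y) : y = 0 := by
  refine IsHausdorff.haus (I := maximalIdeal A) (M := A) inferInstance _ fun k => ?_
  rw [SModEq.zero, smul_eq_mul, Ideal.mul_top]
  obtain ⟨w, hw⟩ := hy k
  rw [hw]
  exact Ideal.mul_mem_right _ _ (Ideal.pow_mem_pow hx k)

theorem coefRing_powerSeries {k : Type*} [Field k] (res : PowerSeries k →+* k)
    (hC : ∀ c, res (PowerSeries.C c) = c) (hX : res PowerSeries.X = 0) :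
    CoefRing (PowerSeries k) PowerSeries.X res where
  h0 := PowerSeries.X_ne_zero
  hsurj := fun c => ⟨_, hC c⟩
  hker := by
    intro x
    rw [PowerSeries.X_dvd_iff]
    have h1 : PowerSeries.X ∣ x - PowerSeries.C (PowerSeries.constantCoeff x) := by
      rw [PowerSeries.X_dvd_iff]; simp
    obtain ⟨w, hw⟩ := h1
    have h2 : res x = PowerSeries.constantCoeff x := by
      have := congrArg res hw
      rw [map_sub, map_mul, hX, zero_mul, hC] at this
      exact sub_eq_zero.1 this
    rw [h2]
  hsep := by
    intro x hx
    ext n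
    simpa using PowerSeries.X_pow_dvd_iff.1 (hx (n + 1)) n (by omega)
  hcompl := by
    intro s hs
    refine ⟨PowerSeries.mk fun n => PowerSeries.coeff n (s (n + 1)), fun n => ?_⟩
    rw [PowerSeries.X_pow_dvd_iff]
    intro m hm
    rw [map_sub, PowerSeries.coeff_mk, sub_eq_zero]
    obtain ⟨j, rfl⟩ := Nat.exists_eq_add_of_lt hm
    clear hm
    induction j with
    | zero => rfl
    | succ j ih =>
      rw [ih]
      have := PowerSeries.X_pow_dvd_iff.1 (hs (m + j + 1)) m (by omega)
      rw [map_sub, sub_eq_zero] at this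
      exact this.symm
  sl := by
    have hE : ExpChar (PowerSeries k) (ringExpChar k) :=
      expChar_of_injective_ringHom (f := (PowerSeries.C : k →+* PowerSeries k))
        (PowerSeries.C_injective) (ringExpChar k)
    have : ringExpChar (PowerSeries k) = ringExpChar k := ringExpChar.eq _ _
    rw [this]
    intro e t ht
    obtain ⟨f, h1, h2, -⟩ := SL_mv (σ := Unit) (ringExpChar k) e (SL_field k (ringExpChar k) e)
      (0 : k) t ht
    exact ⟨f, h1, h2⟩

end Izumi

set_option linter.unusedSectionVars false
set_option linter.style.haveILetI false

namespace Izumi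

open IsLocalRing

section chain
variable {A k : Type*} [CommRing A] [Field k] (p : ℕ) (π : A →+* k)

structure GoodPair (U T : Subring A) : Prop where
  le : T ≤ U
  pmem : ∀ u ∈ U, (p : A) * u ∈ T
  surj : ∀ c : k, ∃ t ∈ T, π t = c
  ker : ∀ x ∈ T, π x = 0 → ∃ u ∈ U, x = p * u

variable {p π}

theorem GoodPair.next [Fact p.Prime] [CharP k p] {U T : Subring A} (h : GoodPair p π U T) :
    ∃ V, GoodPair p π T V := by
  let J : Ideal T := Ideal.span {(p : T)}
  let πT : T →+* k := π.comp T.subtype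
  have hJ : ∀ a ∈ J, πT a = 0 := by
    intro a ha
    obtain ⟨b, rfl⟩ := Ideal.mem_span_singleton.1 ha
    simp
  let ρ : T ⧸ J →+* k := Ideal.Quotient.lift J πT hJ
  have hρ : Function.Surjective ρ := by
    intro c
    obtain ⟨t, ht, htc⟩ := h.surj c
    exact ⟨Ideal.Quotient.mk J ⟨t, ht⟩, htc⟩
  haveI : Nontrivial (T ⧸ J) := hρ.nontrivial
  haveI : CharP (T ⧸ J) p := by
    refine (CharP.charP_iff_prime_eq_zero Fact.out).2 ?_
    have : ((p : T) : T) ∈ J := Ideal.mem_span_singleton_self _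
    rw [← Ideal.Quotient.eq_zero_iff_mem] at this
    simpa using this
  obtain ⟨g, hg⟩ := exists_section p ρ hρ (by
    intro x y hx hy
    obtain ⟨x, rfl⟩ := Ideal.Quotient.mk_surjective x
    obtain ⟨y, rfl⟩ := Ideal.Quotient.mk_surjective y
    obtain ⟨u, hu, hxu⟩ := h.ker x x.2 hx
    obtain ⟨w, hw, hyw⟩ := h.ker y y.2 hy
    rw [← map_mul, Ideal.Quotient.eq_zero_iff_mem, Ideal.mem_span_singleton]
    refine ⟨⟨(p : A) * (u * w), h.pmem _ (U.mul_mem hu hw)⟩, Subtype.ext ?_⟩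
    simp only [Subring.coe_mul, Subring.coe_natCast, hxu, hyw]
    ring)
  refine ⟨(g.range.comap (Ideal.Quotient.mk J)).map T.subtype, ?_, ?_, ?_, ?_⟩
  · rintro _ ⟨x, -, rfl⟩
    exact x.2
  · intro u hu
    refine ⟨(p : T) * ⟨u, hu⟩, ?_, by simp⟩
    have : (p : T) * ⟨u, hu⟩ ∈ J := Ideal.mul_mem_right _ _ (Ideal.mem_span_singleton_self _)
    rw [← Ideal.Quotient.eq_zero_iff_mem] at this
    change Ideal.Quotient.mk J _ ∈ g.range
    rw [this]
    exact zero_mem _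
  · intro c
    obtain ⟨t, ht⟩ := Ideal.Quotient.mk_surjective (g c)
    refine ⟨t, ⟨t, ?_, rfl⟩, ?_⟩
    · change Ideal.Quotient.mk J _ ∈ g.range
      rw [ht]; exact ⟨c, rfl⟩
    · have := hg c
      rw [← ht] at this
      exact this
  · rintro _ ⟨x, ⟨c, hc⟩, rfl⟩ hx
    have h1 : c = 0 := by
      rw [← hg c, hc]; exact hx
    rw [h1, map_zero] at hc
    have h2 := Ideal.mem_span_singleton.1 (Ideal.Quotient.eq_zero_iff_mem.1 hc.symm)
    obtain ⟨u, rfl⟩ := h2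
    exact ⟨u, u.2, by simp⟩

theorem exists_chain [Fact p.Prime] [CharP k p] {T : Subring A} (h : GoodPair p π ⊤ T) :
    ∃ S : ℕ → Subring A, S 0 = ⊤ ∧ ∀ n, GoodPair p π (S n) (S (n + 1)) := by
  choose nx hnx using fun (q : {q : Subring A × Subring A // GoodPair p π q.1 q.2}) => q.2.next
  let st : ℕ → {q : Subring A × Subring A // GoodPair p π q.1 q.2} := fun n =>
    Nat.rec ⟨(⊤, T), h⟩ (fun _ q => ⟨(q.1.2, nx q), hnx q⟩) n
  refine ⟨fun n => (st n).1.1, rfl, fun n => ?_⟩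
  exact (st n).2

variable {S : ℕ → Subring A} (h0 : S 0 = ⊤) (hS : ∀ n, GoodPair p π (S n) (S (n + 1)))
include h0 hS

theorem chain_pow (n : ℕ) (a : A) : (p : A) ^ n * a ∈ S n := by
  induction n generalizing a with
  | zero => rw [h0]; trivial
  | succ n ih =>
    rw [pow_succ', mul_assoc]
    exact (hS n).pmem _ (ih a)

theorem chain_dense (n : ℕ) (x : A) (hx : x ∈ S n) :
    ∃ y ∈ S (n + 1), ∃ a, x = y + (p : A) ^ n * a := by
  induction n generalizing x with
  | zero => exact ⟨0, zero_mem _, x, by simp⟩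
  | succ n ih =>
    obtain ⟨v, hv, hvx⟩ := (hS (n + 1)).surj (π x)
    obtain ⟨u, hu, hxu⟩ := (hS n).ker (x - v) (sub_mem hx ((hS (n + 1)).le hv)) (by simp [hvx])
    obtain ⟨t, ht, a, rfl⟩ := ih u hu
    refine ⟨v + p * t, add_mem hv ((hS (n + 1)).pmem _ ht), a, ?_⟩
    linear_combination hxu

end chain

theorem coef_mixed {A : Type*} [CommRing A] [IsDomain A] [IsNoetherianRing A] [IsLocalRing A]
    [IsAdicComplete (maximalIdeal A) A] (p : ℕ) [Fact p.Prime] [CharP (ResidueField A) p]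
    (hp : (p : A) ≠ 0) :
    ∃ D : Subring A, CoefRing D (p : D) ((residue A).comp D.subtype) := by
  have hpm : (p : A) ∈ maximalIdeal A := by
    rw [← residue_eq_zero_iff]; simp
  -- first step
  have hfirst : ∃ T : Subring A, GoodPair p (residue A) ⊤ T := by
    let J : Ideal A := Ideal.span {(p : A)}
    haveI := complete_quot J
    have hJ : ∀ a ∈ J, residue A a = 0 := by
      intro a ha
      obtain ⟨b, rfl⟩ := Ideal.mem_span_singleton.1 ha
      simp
    let ρ : A ⧸ J →+* ResidueField A := Ideal.Quotient.lift J (residue A) hJ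
    have hρ : Function.Surjective ρ := by
      intro c
      obtain ⟨t, htc⟩ := residue_surjective c
      exact ⟨Ideal.Quotient.mk J t, htc⟩
    haveI : Nontrivial (A ⧸ J) := hρ.nontrivial
    haveI : CharP (A ⧸ J) p := by
      refine (CharP.charP_iff_prime_eq_zero Fact.out).2 ?_
      have : ((p : A) : A) ∈ J := Ideal.mem_span_singleton_self _
      rw [← Ideal.Quotient.eq_zero_iff_mem] at this
      simpa using this
    obtain ⟨g, hg⟩ := section_charP p ((maximalIdeal A).map (Ideal.Quotient.mk J)) ρ hρ (by
      change RingHom.ker (Ideal.Quotient.lift J (residue A) hJ) = _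
      have h9 : RingHom.ker (residue A) = maximalIdeal A := by
        ext x
        rw [RingHom.mem_ker, residue_eq_zero_iff]
      rw [← h9]
      exact Ideal.ker_quotient_lift (residue A) hJ)
    refine ⟨g.range.comap (Ideal.Quotient.mk J), le_top, ?_, ?_, ?_⟩
    · intro u hu
      have : (p : A) * u ∈ J := Ideal.mul_mem_right _ _ (Ideal.mem_span_singleton_self _)
      rw [← Ideal.Quotient.eq_zero_iff_mem] at this
      change Ideal.Quotient.mk J _ ∈ g.range
      rw [this]
      exact zero_mem _
    · intro c
      obtain ⟨t, ht⟩ := Ideal.Quotient.mk_surjective (g c)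
      refine ⟨t, ?_, ?_⟩
      · change Ideal.Quotient.mk J _ ∈ g.range
        rw [ht]; exact ⟨c, rfl⟩
      · have := hg c
        rw [← ht] at this
        exact this
    · rintro x ⟨c, hc⟩ hx
      have h1 : c = 0 := by
        rw [← hg c, hc]; exact hx
      rw [h1, map_zero] at hc
      obtain ⟨u, rfl⟩ := Ideal.mem_span_singleton.1 (Ideal.Quotient.eq_zero_iff_mem.1 hc.symm)
      exact ⟨u, trivial, rfl⟩
  obtain ⟨T, hT⟩ := hfirst
  obtain ⟨S, h0, hS⟩ := exists_chain hT
  let D : Subring A := ⨅ n, S n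
  have hD : ∀ x, x ∈ D ↔ ∀ n, x ∈ S n := fun x => by simp [D, Subring.mem_iInf]
  have hker : ∀ x ∈ D, residue A x = 0 → ∃ u ∈ D, x = p * u := by
    intro x hx hx0
    obtain ⟨u, -, hu⟩ := (hS 0).ker x ((hD x).1 hx 1) hx0
    refine ⟨u, (hD u).2 fun n => ?_, hu⟩
    obtain ⟨w, hw, hxw⟩ := (hS n).ker x ((hD x).1 hx (n + 1)) hx0
    have : u = w := mul_left_cancel₀ hp (by rw [← hu, hxw])
    rwa [this]
  have hpow : ∀ n a, (p : A) ^ n * a ∈ D → a ∈ D := by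
    intro n
    induction n with
    | zero => intro a ha; simpa using ha
    | succ n ih =>
      intro a ha
      obtain ⟨u, hu, hau⟩ := hker _ ha (by simp)
      apply ih
      have : (p : A) ^ n * a = u := mul_left_cancel₀ hp (by rw [← hau]; ring)
      rwa [this]
  have hlim : ∀ (s : ℕ → A) (l : A), (∀ n, s n ∈ S n) → (∀ n, (p : A) ^ n ∣ l - s n) → l ∈ D := by
    intro s l hs hl
    rw [hD]
    intro n
    obtain ⟨w, hw⟩ := hl n
    have : l = s n + (p : A) ^ n * w := by rw [← hw]; ring
    rw [this]
    exact add_mem (hs n) (chain_pow h0 hS n w)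
  refine ⟨D, ?_, ?_, ?_, ?_, ?_, ?_⟩
  · intro h
    apply hp
    have := congrArg (Subtype.val) h
    simpa using this
  · intro c
    obtain ⟨z0, hz0, hc⟩ := (hS 0).surj c
    have hstep : ∀ n x, x ∈ S (n + 1) → ∃ y ∈ S (n + 2), ∃ a, x = y + (p : A) ^ (n + 1) * a :=
      fun n x hx => chain_dense h0 hS (n + 1) x hx
    choose! f hf a hfa using hstep
    let z : ℕ → A := fun n => Nat.rec z0 (fun n x => f n x) n
    have hz : ∀ n, z n ∈ S (n + 1) := by
      intro n
      induction n with
      | zero => exact hz0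
      | succ n ih => exact hf n _ ih
    have hz1 : ∀ n, z n = z (n + 1) + (p : A) ^ (n + 1) * a n (z n) := fun n => hfa n _ (hz n)
    obtain ⟨l, hl⟩ := adic_limit (p : A) hpm z (fun n => by
      refine ⟨-(p * a n (z n)), ?_⟩
      linear_combination -(hz1 n))
    have hlD : l ∈ D := hlim z l (fun n => (hS n).le (hz n)) hl
    refine ⟨⟨l, hlD⟩, ?_⟩
    change residue A l = c
    obtain ⟨w, hw⟩ := hl 1
    have h2 : l = z 0 + p * (w - a 0 (z 0)) := by
      have := hz1 0
      simp only [zero_add, pow_one] at this hw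
      linear_combination hw - this
    rw [h2, map_add, map_mul, map_natCast, CharP.cast_eq_zero, zero_mul, add_zero]
    exact hc
  · intro x
    constructor
    · intro hx
      obtain ⟨u, hu, hxu⟩ := hker x x.2 hx
      exact ⟨⟨u, hu⟩, Subtype.ext (by simpa using hxu)⟩
    · rintro ⟨u, rfl⟩
      simp
  · intro x hx
    refine Subtype.ext (adic_sep (p : A) hpm _ fun n => ?_)
    obtain ⟨w, hw⟩ := hx n
    exact ⟨w, by rw [hw]; simp⟩
  · intro s hs
    obtain ⟨l, hl⟩ := adic_limit (p : A) hpm (fun n => (s n : A)) (fun n => by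
      obtain ⟨w, hw⟩ := hs n
      refine ⟨w, ?_⟩
      have := congrArg Subtype.val hw
      simpa using this)
    have hlD : l ∈ D := hlim _ l (fun n => (hD _).1 (s n).2 n) hl
    refine ⟨⟨l, hlD⟩, fun n => ?_⟩
    obtain ⟨w, hw⟩ := hl n
    have hwD : w ∈ D := hpow n w (by rw [← hw]; exact sub_mem hlD (s n).2)
    exact ⟨⟨w, hwD⟩, Subtype.ext (by simpa using hw)⟩
  · have hchar : ringExpChar D = 1 := by
      have : CharP D 0 := by
        obtain ⟨r, hr⟩ := CharP.exists D
        rcases CharP.char_is_prime_or_zero D r with h | h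
        · exfalso
          have h1' : (r : A) = 0 := by
            rw [← map_natCast D.subtype r, CharP.cast_eq_zero, map_zero]
          have h2 : (r : ResidueField A) = 0 := by
            rw [← map_natCast (residue A), h1', map_zero]
          have h3 := (CharP.cast_eq_zero_iff (ResidueField A) p r).1 h2
          have h4 := (Nat.prime_dvd_prime_iff_eq Fact.out h).1 h3
          exact hp (by rw [h4]; exact h1')
        · rwa [h] at hr
      haveI : CharZero D := CharP.charP_to_charZero D
      exact ringExpChar.eq D 1
    intro e t ht
    refine ⟨AddMonoidHom.id D, fun s t => ?_, ht⟩
    simp [hchar]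

theorem exists_coef {A : Type u} [CommRing A] [IsDomain A] [IsNoetherianRing A] [IsLocalRing A]
    [IsAdicComplete (maximalIdeal A) A] (hA : maximalIdeal A ≠ ⊥) :
    ∃ (D : Type u) (_ : CommRing D) (_ : IsDomain D) (ϖ : D) (ψ : D →+* A),
      CoefRing D ϖ ((residue A).comp ψ) ∧ ψ ϖ ≠ 0 := by
  obtain ⟨x, hx, hx0⟩ := Submodule.exists_mem_ne_zero_of_ne_bot hA
  have heq : (∃ g : ResidueField A →+* A, ∀ c, residue A (g c) = c) →
    ∃ (D : Type u) (_ : CommRing D) (_ : IsDomain D) (ϖ : D) (ψ : D →+* A),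
      CoefRing D ϖ ((residue A).comp ψ) ∧ ψ ϖ ≠ 0 := by
    rintro ⟨g, hg⟩
    obtain ⟨φ, h1, h2⟩ := exists_eval (σ := Unit) (maximalIdeal A) g (fun _ => x) (fun _ => hx)
    refine ⟨PowerSeries (ResidueField A), inferInstance, inferInstance, PowerSeries.X, φ,
      coefRing_powerSeries _ (fun c => ?_) ?_, ?_⟩
    · exact (congrArg (residue A) (h1 c)).trans (hg c)
    · exact (congrArg (residue A) (h2 ())).trans ((residue_eq_zero_iff x).2 hx)
    · intro h
      exact hx0 ((h2 ()).symm.trans h)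
  have hker : RingHom.ker (residue A) = maximalIdeal A := by
    ext y; rw [RingHom.mem_ker, residue_eq_zero_iff]
  obtain ⟨p, hp⟩ := CharP.exists (ResidueField A)
  rcases CharP.char_is_prime_or_zero (ResidueField A) p with h | h
  · haveI : Fact p.Prime := ⟨h⟩
    by_cases hpA : (p : A) = 0
    · haveI : CharP A p := (CharP.charP_iff_prime_eq_zero h).2 hpA
      exact heq (section_charP p (maximalIdeal A) (residue A) residue_surjective hker)
    · obtain ⟨D, hD⟩ := coef_mixed p hpA
      refine ⟨D, inferInstance, inferInstance, (p : D), D.subtype, hD, ?_⟩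
      simpa using hpA
  · subst h
    haveI : CharZero (ResidueField A) := CharP.charP_to_charZero _
    haveI : CharZero (A ⧸ maximalIdeal A) := ‹CharZero (ResidueField A)›
    obtain ⟨hQ⟩ : Nonempty (Algebra ℚ A) := (EqualCharZero.nonempty_algebraRat_iff A).2 (fun I hI =>
      (Ideal.Quotient.factor (le_maximalIdeal hI) : A ⧸ I →+* ResidueField A).charZero)
    exact heq (section_charZero (maximalIdeal A) (residue A) residue_surjective hker)

end Izumi

set_option linter.unusedSectionVars false
set_option linter.style.haveILetI false

namespace Izumi

open IsLocalRing

theorem precomplete_pi {S : Type*} [CommRing S] (I : Ideal S) [IsPrecomplete I S] (t : ℕ) :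
    IsPrecomplete I (Fin t → S) := by
  have h1 : ∀ (J : Ideal S) (x : Fin t → S), x ∈ J • (⊤ : Submodule S (Fin t → S)) ↔
      ∀ i, x i ∈ J := by
    intro J x
    constructor
    · intro hx i
      refine Submodule.smul_induction_on hx (fun r hr n _ => ?_) (fun x y hx hy => ?_)
      · exact J.mul_mem_right _ hr
      · exact J.add_mem hx hy
    · intro hx
      rw [pi_eq_sum_univ' x]
      exact Submodule.sum_mem _ fun i _ => Submodule.smul_mem_smul (hx i) trivial
  constructor
  intro f hf
  have h2 : ∀ i : Fin t, ∃ l : S, ∀ n, f n i ≡ l [SMOD (I ^ n • ⊤ : Submodule S S)] := by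
    intro i
    refine IsPrecomplete.prec (I := I) (M := S) inferInstance (f := fun n => f n i) ?_
    intro m n hmn
    have := hf hmn
    rw [SModEq.sub_mem, h1] at this
    rw [SModEq.sub_mem, smul_eq_mul, Ideal.mul_top]
    exact this i
  choose l hl using h2
  refine ⟨l, fun n => ?_⟩
  rw [SModEq.sub_mem, h1]
  intro i
  have := hl i n
  rw [SModEq.sub_mem, smul_eq_mul, Ideal.mul_top] at this
  exact this

theorem finite_of_complete {S A : Type*} [CommRing S] [CommRing A] [Algebra S A]
    [IsNoetherianRing A] [IsLocalRing A] (I : Ideal S) [IsPrecomplete I S] (r : ℕ)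
    (hI : maximalIdeal A ^ r ≤ I.map (algebraMap S A))
    (hI' : I.map (algebraMap S A) ≤ maximalIdeal A)
    (hres : ∀ a : A, ∃ s : S, a - algebraMap S A s ∈ maximalIdeal A) :
    Module.Finite S A := by
  have key : ∀ j : ℕ, ∃ N : Submodule S A, N.FG ∧
      ⊤ = N ⊔ (maximalIdeal A ^ j).restrictScalars S := by
    intro j
    induction j with
    | zero => exact ⟨⊥, Submodule.fg_bot, by simp⟩
    | succ j ih =>
      obtain ⟨N, hN, hT⟩ := ih
      obtain ⟨G, hG⟩ := (inferInstance : IsNoetherian A A).noetherian (maximalIdeal A ^ j)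
      refine ⟨N ⊔ Submodule.span S (G : Set A), hN.sup ⟨G, rfl⟩, ?_⟩
      rw [sup_assoc]
      refine le_antisymm ?_ le_top
      rw [hT]
      refine sup_le_sup_left ?_ N
      intro y hy
      have hy' : y ∈ Submodule.span A (G : Set A) := by rw [hG]; exact hy
      clear hy
      induction hy' using Submodule.span_induction with
      | mem x hx => exact Submodule.mem_sup_left (Submodule.subset_span hx)
      | zero => exact zero_mem _
      | add x y hx hy hx' hy' => exact add_mem hx' hy'
      | smul a x hx hx' =>
        obtain ⟨s, hs⟩ := hres a
        have : a • x = s • x + (a - algebraMap S A s) * x := by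
          rw [Algebra.smul_def s x, smul_eq_mul]; ring
        rw [this]
        refine add_mem (Submodule.smul_mem _ _ hx') (Submodule.mem_sup_right ?_)
        change _ ∈ maximalIdeal A ^ (j + 1)
        rw [pow_succ']
        refine Ideal.mul_mem_mul hs ?_
        rw [← hG]; exact hx
  obtain ⟨N, hN, hT⟩ := key r
  obtain ⟨t, v, hv⟩ := Submodule.fg_iff_exists_fin_generating_family.1 hN
  let f : (Fin t → S) →ₗ[S] A := Fintype.linearCombination S v
  haveI := precomplete_pi I t
  haveI : IsHausdorff (I.map (algebraMap S A)) A :=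
    IsHausdorff.of_isLocalRing _ _ (fun h => by
      rw [h] at hI'
      exact (maximalIdeal.isMaximal A).ne_top (top_le_iff.1 hI'))
  haveI : IsHausdorff I A := (IsHausdorff.map_algebraMap_iff).1 this
  have hf : Function.Surjective f := by
    refine surjective_of_mkQ_comp_surjective (I := I) ?_
    intro y
    obtain ⟨y, rfl⟩ := Submodule.mkQ_surjective _ y
    have hy : y ∈ N ⊔ (maximalIdeal A ^ r).restrictScalars S := by rw [← hT]; trivial
    obtain ⟨z, hz, w, hw, rfl⟩ := Submodule.mem_sup.1 hy
    rw [← hv, ← Fintype.range_linearCombination] at hz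
    obtain ⟨q, hq⟩ := hz
    refine ⟨q, ?_⟩
    change Submodule.mkQ _ (f q) = _
    rw [← sub_eq_zero, ← map_sub, ← LinearMap.mem_ker, Submodule.ker_mkQ, Ideal.smul_top_eq_map]
    change f q - (z + w) ∈ I.map (algebraMap S A)
    have : f q - (z + w) = -w := by rw [show f q = z from hq]; ring
    rw [this, neg_mem_iff]
    exact hI hw
  exact Module.Finite.of_surjective f hf

theorem dim_le_of_finite {S A : Type*} [CommRing S] [CommRing A] [Algebra S A]
    [Algebra.IsIntegral S A] : ringKrullDim A ≤ ringKrullDim S :=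
  Order.krullDim_le_of_strictMono
    (fun P : PrimeSpectrum A => (⟨Ideal.comap (algebraMap S A) P.asIdeal, inferInstance⟩ :
      PrimeSpectrum S))
    (fun P Q h => by
      change Ideal.comap (algebraMap S A) P.asIdeal < Ideal.comap (algebraMap S A) Q.asIdeal
      exact Ideal.IsIntegral.comap_lt_comap h)

theorem exists_params {B : Type*} [CommRing B] [IsNoetherianRing B] [IsLocalRing B] :
    ∃ (d r : ℕ) (x : Fin d → B), ringKrullDim B = d ∧ (∀ i, x i ∈ maximalIdeal B) ∧
      maximalIdeal B ^ r ≤ Ideal.span (Set.range x) := by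
  obtain ⟨s, h1, h2⟩ := (maximalIdeal B).exists_finset_card_eq_height_of_isNoetherianRing
  have hrad : (Ideal.span (s : Set B)).radical = maximalIdeal B := by
    rw [Ideal.radical_eq_sInf]
    refine le_antisymm (sInf_le ⟨h1.1.2, h1.1.1⟩) (le_sInf ?_)
    rintro P ⟨hP, hP'⟩
    exact h1.2 ⟨hP', hP⟩ (le_maximalIdeal hP'.ne_top)
  obtain ⟨r, hr⟩ := Ideal.exists_radical_pow_le_of_fg (Ideal.span (s : Set B))
    ((inferInstance : IsNoetherian B B).noetherian _)
  rw [hrad] at hr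
  have hrange : Set.range (fun i : Fin s.card => (s.equivFin.symm i : B)) = (s : Set B) := by
    ext y
    constructor
    · rintro ⟨i, rfl⟩; exact (s.equivFin.symm i).2
    · intro hy; exact ⟨s.equivFin ⟨y, hy⟩, by simp⟩
  refine ⟨s.card, r, fun i => s.equivFin.symm i, ?_, fun i => ?_, ?_⟩
  · rw [← maximalIdeal_height_eq_ringKrullDim, ← h2]; rfl
  · exact h1.1.2 (Ideal.subset_span (s.equivFin.symm i).2)
  · rw [hrange]; exact hr

theorem maximalIdeal_eq_NN {D : Type*} [CommRing D] [IsDomain D] {ϖ : D} {k : Type*} [Field k]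
    {res : D →+* k} (h : CoefRing D ϖ res) (d : ℕ) [IsLocalRing (MvPowerSeries (Fin d) D)] :
    maximalIdeal (MvPowerSeries (Fin d) D) = NN ϖ (Fin d) := by
  have h1 : NN ϖ (Fin d) = JJ ϖ (Fin d) 1 := by rw [← NN_pow, pow_one]
  refine le_antisymm ?_ (le_maximalIdeal ?_)
  · intro s hs
    rw [h1]
    intro α
    by_cases hα : α = 0
    · subst hα
      simp only [map_zero, Nat.sub_zero, pow_one]
      rw [← h.hker]
      by_contra hne
      have h2 := h.isUnit hne
      rw [mem_maximalIdeal, mem_nonunits_iff, MvPowerSeries.isUnit_iff_constantCoeff] at hs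
      exact hs h2
    · have : 1 - α.degree = 0 := by
        have : α.degree ≠ 0 := fun h => hα ((Finsupp.degree_eq_zero_iff α).1 h)
        omega
      rw [this]; simp
  · rw [Ideal.ne_top_iff_one, h1]
    intro h2
    have := h2 0
    simp at this
    exact h.irreducible.not_isUnit (isUnit_of_dvd_one this)

end Izumi

set_option linter.unusedSectionVars false
set_option linter.style.haveILetI false

namespace Izumi

open IsLocalRing

theorem dim_mv {D : Type*} [CommRing D] [IsDomain D] {ϖ : D} {k : Type*} [Field k]
    {res : D →+* k} (h : CoefRing D ϖ res) (d : ℕ) [IsLocalRing (MvPowerSeries (Fin d) D)]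
    [IsNoetherianRing (MvPowerSeries (Fin d) D)] :
    ringKrullDim (MvPowerSeries (Fin d) D) ≤ ((d + 1 : ℕ) : WithBot ℕ∞) := by
  refine (ringKrullDim_le_spanFinrank_maximalIdeal _).trans ?_
  rw [maximalIdeal_eq_NN h]
  have h1 : (NN ϖ (Fin d)).spanFinrank ≤ d + 1 := by
    refine (Submodule.spanFinrank_span_le_ncard_of_finite
      ((Set.finite_range _).insert _)).trans ?_
    refine (Set.ncard_insert_le _ _).trans ?_
    refine Nat.add_le_add_right ?_ 1
    rw [← Set.image_univ]
    refine (Set.ncard_image_le Set.finite_univ).trans ?_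
    simp
  exact_mod_cast h1

theorem izumi_complete {A : Type u} [CommRing A] [IsDomain A] [IsNoetherianRing A]
    [IsLocalRing A] [IsAdicComplete (maximalIdeal A) A] :
    ∃ c : ℕ, ∀ (n : ℕ) (a b : A), a * b ∈ maximalIdeal A ^ (c * (n + 1)) →
      a ∈ maximalIdeal A ^ n ∨ b ∈ maximalIdeal A ^ n := by
  by_cases hA : maximalIdeal A = ⊥
  · refine ⟨1, fun n a b hab => ?_⟩
    rw [one_mul, hA, pow_succ', Ideal.bot_mul, Ideal.mem_bot, mul_eq_zero] at hab
    rcases hab with rfl | rfl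
    · exact Or.inl (zero_mem _)
    · exact Or.inr (zero_mem _)
  obtain ⟨D, _, _, ϖ, ψ, hD, hϖ⟩ := exists_coef hA
  have hϖm : ψ ϖ ∈ maximalIdeal A := by
    rw [← residue_eq_zero_iff]
    exact (hD.hker ϖ).2 dvd_rfl
  haveI : IsDiscreteValuationRing D := hD.isDVR
  -- parameters
  obtain ⟨d, r, x, hxm, hxr, hdim⟩ : ∃ (d r : ℕ) (x : Fin d → A),
      (∀ i, x i ∈ maximalIdeal A) ∧
      maximalIdeal A ^ r ≤ Ideal.span (insert (ψ ϖ) (Set.range x)) ∧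
      ((d + 1 : ℕ) : WithBot ℕ∞) ≤ ringKrullDim A := by
    let J := Ideal.span {ψ ϖ}
    have hJ : J ≤ maximalIdeal A := by
      rw [Ideal.span_singleton_le_iff_mem]; exact hϖm
    haveI : Nontrivial (A ⧸ J) := Ideal.Quotient.nontrivial_iff.2 (fun h => by
      rw [h] at hJ
      exact (maximalIdeal.isMaximal A).ne_top (top_le_iff.1 hJ))
    haveI : IsLocalRing (A ⧸ J) :=
      IsLocalRing.of_surjective' (Ideal.Quotient.mk J) Ideal.Quotient.mk_surjective
    haveI : IsLocalHom (Ideal.Quotient.mk J) :=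
      IsLocalHom.of_surjective _ Ideal.Quotient.mk_surjective
    obtain ⟨d, r, y, h1, h2, h3⟩ := exists_params (B := A ⧸ J)
    choose x hx using fun i => Ideal.Quotient.mk_surjective (y i)
    refine ⟨d, r, x, fun i => ?_, ?_, ?_⟩
    · have := h2 i
      rw [← hx i] at this
      rw [mem_maximalIdeal, mem_nonunits_iff] at this ⊢
      exact fun hu => this (hu.map _)
    · intro a ha
      have h4 : Ideal.Quotient.mk J a ∈ maximalIdeal (A ⧸ J) ^ r := by
        have h5 : Ideal.map (Ideal.Quotient.mk J) (maximalIdeal A) ≤ maximalIdeal (A ⧸ J) := by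
          rw [Ideal.map_le_iff_le_comap]
          intro z hz
          rw [Ideal.mem_comap]
          rw [mem_maximalIdeal, mem_nonunits_iff] at hz ⊢
          exact fun hu => hz (isUnit_of_map_unit _ _ hu)
        refine Ideal.pow_right_mono h5 r ?_
        rw [← Ideal.map_pow]
        exact Ideal.mem_map_of_mem _ ha
      have h6 : Ideal.span (Set.range y) =
          Ideal.map (Ideal.Quotient.mk J) (Ideal.span (Set.range x)) := by
        rw [Ideal.map_span, ← Set.range_comp]
        congr 2
        funext i
        exact (hx i).symm
      have h7 := h3 h4
      rw [h6, Ideal.mem_map_iff_of_surjective _ Ideal.Quotient.mk_surjective] at h7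
      obtain ⟨b, hb, hba⟩ := h7
      have h8 : a - b ∈ J := by rw [← Ideal.Quotient.eq, hba]
      rw [Ideal.span_insert]
      have : a = (a - b) + b := by ring
      rw [this]
      exact Submodule.add_mem_sup h8 hb
    · have := ringKrullDim_quotient_succ_le_of_nonZeroDivisor
        (mem_nonZeroDivisors_of_ne_zero hϖ)
      rw [h1] at this
      exact_mod_cast this
  obtain ⟨φ, hφC, hφX⟩ := exists_eval (maximalIdeal A) ψ x hxm
  letI : Algebra (MvPowerSeries (Fin d) D) A := φ.toAlgebra
  have hB := hD.adicBase (Fin d)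
  haveI : IsNoetherianRing (MvPowerSeries (Fin d) D) := inferInstance
  have hQ : (NN ϖ (Fin d)).map (algebraMap (MvPowerSeries (Fin d) D) A) =
      Ideal.span (insert (ψ ϖ) (Set.range x)) := by
    change (NN ϖ (Fin d)).map φ = _
    rw [NN, Ideal.map_span, Set.image_insert_eq, hφC, ← Set.range_comp]
    congr 3
    funext i
    exact hφX i
  have hQm : (NN ϖ (Fin d)).map (algebraMap (MvPowerSeries (Fin d) D) A) ≤ maximalIdeal A := by
    rw [hQ, Ideal.span_le]
    rintro _ (rfl | ⟨i, rfl⟩)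
    · exact hϖm
    · exact hxm i
  rw [← hQ] at hxr
  haveI : IsPrecomplete (NN ϖ (Fin d)) (MvPowerSeries (Fin d) D) := by
    constructor
    intro f hf
    obtain ⟨l, hl⟩ := hB.complete f (fun n => by
      have := hf (Nat.le_succ n)
      rw [SModEq.sub_mem, smul_eq_mul, Ideal.mul_top, ← neg_sub, neg_mem_iff] at this
      exact this)
    refine ⟨l, fun n => ?_⟩
    rw [SModEq.sub_mem, smul_eq_mul, Ideal.mul_top, ← neg_sub, neg_mem_iff]
    exact hl n
  haveI hfin : Module.Finite (MvPowerSeries (Fin d) D) A := by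
    refine finite_of_complete (NN ϖ (Fin d)) r hxr hQm (fun a => ?_)
    obtain ⟨c, hc⟩ := hD.hsurj (residue A a)
    refine ⟨MvPowerSeries.C c, ?_⟩
    rw [← residue_eq_zero_iff, map_sub, sub_eq_zero, ← hc]
    exact (congrArg (residue A) (hφC c)).symm
  have hinj : Function.Injective (algebraMap (MvPowerSeries (Fin d) D) A) := by
    rw [injective_iff_map_eq_zero]
    intro f hf
    by_contra hf0
    let ρ : MvPowerSeries (Fin d) D ⧸ Ideal.span {f} →+* A :=
      Ideal.Quotient.lift _ (algebraMap (MvPowerSeries (Fin d) D) A) (by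
        intro a ha
        obtain ⟨b, rfl⟩ := Ideal.mem_span_singleton.1 ha
        rw [map_mul, hf, zero_mul])
    letI : Algebra (MvPowerSeries (Fin d) D ⧸ Ideal.span {f}) A := ρ.toAlgebra
    haveI : IsScalarTower (MvPowerSeries (Fin d) D) (MvPowerSeries (Fin d) D ⧸ Ideal.span {f}) A :=
      ⟨fun s q a => by
        obtain ⟨q, rfl⟩ := Ideal.Quotient.mk_surjective q
        change φ (s * q) * a = φ s * (φ q * a)
        rw [map_mul, mul_assoc]⟩
    haveI : Module.Finite (MvPowerSeries (Fin d) D ⧸ Ideal.span {f}) A :=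
      Module.Finite.of_restrictScalars_finite (MvPowerSeries (Fin d) D) _ _
    have h1 : ringKrullDim A ≤ ringKrullDim (MvPowerSeries (Fin d) D ⧸ Ideal.span {f}) :=
      dim_le_of_finite
    have h2 := ringKrullDim_quotient_succ_le_of_nonZeroDivisor (mem_nonZeroDivisors_of_ne_zero hf0)
    have h3 := dim_mv hD d
    have h4 : ((d + 1 : ℕ) : WithBot ℕ∞) + 1 ≤ ((d + 1 : ℕ) : WithBot ℕ∞) :=
      (add_le_add_left (hdim.trans h1) 1).trans (h2.trans h3)
    have h5 : d + 1 + 1 ≤ d + 1 := by exact_mod_cast h4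
    omega
  haveI : IsDomain (MvPowerSeries (Fin d) D) := NoZeroDivisors.to_isDomain _
  obtain ⟨c, hc⟩ := hB.izumi hinj
  refine ⟨r * c, fun n a b hab => ?_⟩
  rw [mul_assoc, pow_mul] at hab
  rcases hc n a b (Ideal.pow_right_mono hxr _ hab) with h | h
  · exact Or.inl (Ideal.pow_right_mono hQm n h)
  · exact Or.inr (Ideal.pow_right_mono hQm n h)

end Izumi
set_option linter.unusedSectionVars false
set_option linter.style.haveILetI false

namespace Izumi
open IsLocalRing

theorem noeth_completion (R : Type*) [CommRing R] [IsNoetherianRing R] [IsLocalRing R] :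
    IsNoetherianRing (AdicCompletion (maximalIdeal R) R) := by
  classical
  obtain ⟨s, hs⟩ := (IsNoetherian.noetherian (maximalIdeal R))
  set A := AdicCompletion (maximalIdeal R) R with hA
  have hmap : (maximalIdeal R).map (algebraMap R A) = maximalIdeal A :=
    (AdicCompletion.maximalIdeal_eq_map (R := R)).symm
  have hsm : ∀ i : s, algebraMap R A i ∈ maximalIdeal A := by
    intro i
    rw [← hmap]
    apply Ideal.mem_map_of_mem
    rw [← hs]
    exact Submodule.subset_span i.2
  obtain ⟨φ, hφC, hφX⟩ := exists_eval (σ := s) (maximalIdeal A) (algebraMap R A)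
    (fun i => algebraMap R A i) hsm
  have hI : (Ideal.span (Set.range (MvPowerSeries.X : s → MvPowerSeries s R))).map φ
      = maximalIdeal A := by
    have hs2 : (Ideal.span (s : Set R)).map (algebraMap R A) = maximalIdeal A := by
      rw [← hmap]
      exact congrArg (Ideal.map (algebraMap R A)) hs
    rw [Ideal.map_span, ← hs2, Ideal.map_span]
    congr 1
    ext y
    constructor
    · rintro ⟨_, ⟨i, rfl⟩, rfl⟩
      exact ⟨i, i.2, (hφX i).symm⟩
    · rintro ⟨i, hi, rfl⟩
      exact ⟨_, ⟨⟨i, hi⟩, rfl⟩, hφX ⟨i, hi⟩⟩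
  haveI : IsHausdorff ((Ideal.span (Set.range
      (MvPowerSeries.X : s → MvPowerSeries s R))).map φ) A := by
    rw [hI]; infer_instance
  have hsurj : Function.Surjective φ := by
    apply surjective_of_mk_map_comp_surjective (f := φ)
      (I := Ideal.span (Set.range (MvPowerSeries.X : s → MvPowerSeries s R)))
    intro y
    obtain ⟨y, rfl⟩ := Ideal.Quotient.mk_surjective y
    obtain ⟨z, hz⟩ := (AdicCompletion.residueField_map_bijective (R := R)).2
      (residue A y)
    obtain ⟨r, rfl⟩ := residue_surjective z
    refine ⟨MvPowerSeries.C r, ?_⟩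
    rw [RingHom.comp_apply, hφC, Ideal.Quotient.eq, hI]
    have : residue A (algebraMap R A r) = residue A y := by
      rw [← hz]; rfl
    exact Ideal.Quotient.eq.1 this
  exact isNoetherianRing_of_surjective _ _ φ hsurj

theorem completion_mem_pow {R : Type*} [CommRing R] [IsNoetherianRing R] [IsLocalRing R]
    (n : ℕ) (x : R) :
    algebraMap R (AdicCompletion (maximalIdeal R) R) x
      ∈ maximalIdeal (AdicCompletion (maximalIdeal R) R) ^ n ↔ x ∈ maximalIdeal R ^ n := by
  rw [AdicCompletion.maximalIdeal_eq_map, ← Ideal.map_pow]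
  constructor
  · intro h
    have h2 : (maximalIdeal R ^ n).map (algebraMap R (AdicCompletion (maximalIdeal R) R))
        ≤ RingHom.ker (AdicCompletion.evalₐ (maximalIdeal R) n) := by
      rw [Ideal.map_le_iff_le_comap]
      intro y hy
      rw [Ideal.mem_comap, RingHom.mem_ker, AlgHom.commutes]
      exact Ideal.Quotient.eq_zero_iff_mem.2 hy
    have h3 := h2 h
    rw [RingHom.mem_ker, AlgHom.commutes] at h3
    exact Ideal.Quotient.eq_zero_iff_mem.1 h3
  · exact Ideal.mem_map_of_mem _

theorem izumi (R : Type*) [CommRing R] [IsNoetherianRing R] [IsLocalRing R]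
    (hirr : IsDomain (AdicCompletion (maximalIdeal R) R)) :
    ∃ c : ℕ, ∀ (n : ℕ) (a b : R), a * b ∈ maximalIdeal R ^ (c * (n + 1)) →
      a ∈ maximalIdeal R ^ n ∨ b ∈ maximalIdeal R ^ n := by
  haveI := hirr
  haveI := noeth_completion R
  obtain ⟨c, hc⟩ := izumi_complete (A := AdicCompletion (maximalIdeal R) R)
  refine ⟨c, fun n a b h => ?_⟩
  rw [← completion_mem_pow, map_mul] at h
  simpa only [completion_mem_pow] using hc n _ _ h

theorem pow_bound (R : Type*) [CommRing R] [IsLocalRing R] (c : ℕ)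
    (hc : ∀ (n : ℕ) (a b : R), a * b ∈ maximalIdeal R ^ (c * (n + 1)) →
      a ∈ maximalIdeal R ^ n ∨ b ∈ maximalIdeal R ^ n) (k : ℕ) :
    ∃ C : ℕ, 1 ≤ C ∧ ∀ n : ℕ, 1 ≤ n → ∀ a : R, a ^ k ∈ maximalIdeal R ^ (C * n) →
      k ≠ 0 ∧ a ∈ maximalIdeal R ^ n := by
  induction k with
  | zero =>
    refine ⟨1, le_rfl, fun n hn a h => ?_⟩
    exfalso
    rw [pow_zero] at h
    exact (Ideal.ne_top_iff_one _).1 (maximalIdeal.isMaximal R).ne_top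
      (Ideal.pow_le_self (by omega) h)
  | succ k ih =>
    obtain ⟨C, hC, h⟩ := ih
    refine ⟨2 * c * C + 1, by omega, fun n hn a ha => ⟨by omega, ?_⟩⟩
    have hCn : 1 ≤ C * n := Nat.mul_pos hC hn
    rw [pow_succ] at ha
    rcases hc (C * n) _ _ (Ideal.pow_le_pow_right (by nlinarith) ha) with h1 | h1
    · exact (h n hn a h1).2
    · exact Ideal.pow_le_pow_right (by nlinarith) h1

theorem prod_bound (R : Type*) [CommRing R] [IsLocalRing R] (c : ℕ)
    (hc : ∀ (n : ℕ) (a b : R), a * b ∈ maximalIdeal R ^ (c * (n + 1)) →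
      a ∈ maximalIdeal R ^ n ∨ b ∈ maximalIdeal R ^ n) {ι : Type*} (α : ι → ℕ)
    (s : Finset ι) :
    ∃ C : ℕ, 1 ≤ C ∧ ∀ n : ℕ, 1 ≤ n → ∀ a : ι → R,
      (∏ j ∈ s, a j ^ α j) ∈ maximalIdeal R ^ (C * n) →
      ∃ j, α j ≠ 0 ∧ a j ∈ maximalIdeal R ^ n := by
  classical
  induction s using Finset.induction_on with
  | empty =>
    refine ⟨1, le_rfl, fun n hn a h => ?_⟩
    exfalso
    rw [Finset.prod_empty] at h
    exact (Ideal.ne_top_iff_one _).1 (maximalIdeal.isMaximal R).ne_top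
      (Ideal.pow_le_self (by omega) h)
  | insert i s his ih =>
    obtain ⟨C, hC, h⟩ := ih
    obtain ⟨D, hD, h'⟩ := pow_bound R c hc (α i)
    refine ⟨2 * c * (C * D) + 1, by omega, fun n hn a ha => ?_⟩
    have hCD : 1 ≤ C * D := Nat.mul_pos hC hD
    have hCn : 1 ≤ C * D * n := Nat.mul_pos hCD hn
    rw [Finset.prod_insert his] at ha
    rcases hc (C * D * n) _ _ (Ideal.pow_le_pow_right (by nlinarith) ha) with h1 | h1
    · refine ⟨i, h' n hn _ (Ideal.pow_le_pow_right ?_ h1)⟩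
      exact Nat.mul_le_mul_right _ (Nat.le_mul_of_pos_left _ hC)
    · refine h n hn a (Ideal.pow_le_pow_right ?_ h1)
      exact Nat.mul_le_mul_right _ (Nat.le_mul_of_pos_right _ hD)

theorem final (R : Type*) [CommRing R] [IsNoetherianRing R] [IsLocalRing R]
    (hirr : IsDomain (AdicCompletion (maximalIdeal R) R)) (N : ℕ)
    (α : Fin N → ℕ) (hα : α ≠ 0) :
    ∃ c : ℕ, ∀ n : ℕ, ∀ a : Fin N → R,
      (∏ j, a j ^ α j) ∈ maximalIdeal R ^ (c * n) →
      ∃ b : Fin N → R, (∏ j, b j ^ α j) = 0 ∧ ∀ j, a j - b j ∈ maximalIdeal R ^ n := by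
  obtain ⟨c, hc⟩ := izumi R hirr
  obtain ⟨C, -, h⟩ := prod_bound R c hc α Finset.univ
  refine ⟨C, fun n a ha => ?_⟩
  have key : ∃ j, α j ≠ 0 ∧ a j ∈ maximalIdeal R ^ n := by
    rcases Nat.eq_zero_or_pos n with rfl | hn
    · obtain ⟨j, hj⟩ := Function.ne_iff.1 hα
      exact ⟨j, hj, by simp⟩
    · exact h n hn a ha
  obtain ⟨j, hj, haj⟩ := key
  refine ⟨Function.update a j 0, ?_, fun i => ?_⟩
  · apply Finset.prod_eq_zero (Finset.mem_univ j)
    simp [hj]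
  · by_cases hij : i = j
    · subst hij; simpa using haj
    · simp [hij]

end Izumi
open IsLocalRing

/-- **Lemma.** Let `(R, m)` be an analytically irreducible Noetherian local domain.  Then for
each nonzero multi-index `α` there is `c ∈ ℕ`, independent of `n`, such that for every `n` and
every `a ∈ R^N` with `a^α ∈ m^(c n)`, there is `b ∈ R^N` with `b^α = 0` and
`a ≡ b (mod mⁿ R^N)`; that is, `β_n(X^α) ≤ c n`. -/
theorem monomial_linear_bound_of_analyticallyIrreducible
    (R : Type*) [CommRing R] [IsDomain R] [IsNoetherianRing R] [IsLocalRing R]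
    (hirr : IsDomain (AdicCompletion (maximalIdeal R) R))
    (N : ℕ) (α : Fin N → ℕ) (hα : α ≠ 0) :
    ∃ c : ℕ, ∀ n : ℕ, ∀ a : Fin N → R,
      (∏ j, a j ^ α j) ∈ maximalIdeal R ^ (c * n) →
      ∃ b : Fin N → R, (∏ j, b j ^ α j) = 0 ∧ ∀ j, a j - b j ∈ maximalIdeal R ^ n := by
  exact Izumi.final R hirr N α hα
end

section
/- Let (R,m) be a regular local ring of Krull dimension at least 1 and let α ∈ ℤ^N_{≥0} be a nonzero multi-index with |α| = i₁ + … + i_N. Then for every n ≥ 1 the Artin function of the single monomial X^α satisfies β_n(X^α) = |α|n − |α| + 1. Explicitly: (a) every a ∈ R^N with a^α ∈ m^{|α|n − |α| + 1} admits b ∈ R^N with b^α = 0 and a ≡ b (mod m^n R^N); and (b) there exists a ∈ R^N with a^α ∈ m^{|α|n − |α|} such that no b ∈ R^N with b^α = 0 satisfies a ≡ b (mod m^n R^N). -/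
open IsLocalRing

/-- A Noetherian local ring is regular if its maximal ideal is generated by
`Krull dimension`-many elements. -/
def IsRegularLocal (R : Type*) [CommRing R] [IsLocalRing R] : Prop :=
  IsNoetherianRing R ∧ ∃ s : Finset R, Ideal.span (s : Set R) = maximalIdeal R ∧
    (s.card : WithBot ℕ∞) = ringKrullDim R

theorem eval₂_scale {σ A B : Type*} [CommRing A] [CommRing B] (f : A →+* B)
    (F : MvPolynomial σ A) (p : ℕ) (hF : F.IsHomogeneous p) (r : B) (c : σ → B) :
    F.eval₂ f (fun i => r * c i) = r ^ p * F.eval₂ f c := by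
  classical
  rw [MvPolynomial.eval₂_eq, MvPolynomial.eval₂_eq, Finset.mul_sum]
  refine Finset.sum_congr rfl fun d hd => ?_
  have h : d.degree = p := by
    have := hF (MvPolynomial.mem_support_iff.mp hd)
    rw [Finsupp.degree_eq_weight_one]; exact this
  simp only [mul_pow, Finset.prod_mul_distrib, Finset.prod_pow_eq_pow_sum]
  rw [← h, Finsupp.degree_apply]
  ring

theorem analytic_indep {R : Type*} [CommRing R] [IsLocalRing R] [IsNoetherianRing R]
    {σ : Type*} [Fintype σ] [Nonempty σ] (x : σ → R)
    (hx : Ideal.span (Set.range x) = maximalIdeal R)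
    (hd : (Fintype.card σ : ℕ∞) ≤ (maximalIdeal R).height)
    (F G : MvPolynomial σ R) (p : ℕ) (hF : F.IsHomogeneous p) (hG : G.IsHomogeneous (p + 1))
    (hFG : F.eval x = G.eval x) : F.map (residue R) = 0 := by
  classical
  by_contra hne
  obtain ⟨i₀⟩ := ‹Nonempty σ›
  let φ : Polynomial R →+* Polynomial (ResidueField R) := Polynomial.mapRingHom (residue R)
  have hφs : Function.Surjective φ := Polynomial.map_surjective _ residue_surjective
  let P : Ideal (Polynomial R) := (maximalIdeal R).map Polynomial.C
  have hker : ∀ y, y ∈ P ↔ φ y = 0 := by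
    intro y
    rw [← RingHom.mem_ker, Polynomial.ker_mapRingHom, ker_residue]
  have hPp : P.IsPrime := Ideal.isPrime_map_C_of_isPrime
  have hne' : ((F.map (residue R)) * MvPolynomial.X i₀).map
      (Polynomial.C : ResidueField R →+* _) ≠ 0 := by
    rw [Ne, map_eq_zero_iff _ (MvPolynomial.map_injective _ Polynomial.C_injective)]
    exact mul_ne_zero hne (MvPolynomial.X_ne_zero i₀)
  obtain ⟨cb, hcb⟩ : ∃ cb : σ → Polynomial (ResidueField R),
      MvPolynomial.eval cb (((F.map (residue R)) * MvPolynomial.X i₀).map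
      (Polynomial.C : ResidueField R →+* _)) ≠ 0 := by
    by_contra! h
    exact hne' (MvPolynomial.funext (fun y => by rw [h y, map_zero]))
  choose c hc using fun i => hφs (cb i)
  have hcbF : φ (F.eval₂ Polynomial.C c * c i₀) ≠ 0 := by
    convert hcb using 1
    rw [map_mul, map_mul, map_mul, MvPolynomial.map_X, MvPolynomial.eval_X, hc,
      MvPolynomial.map_map, MvPolynomial.eval_map, MvPolynomial.hom_eval₂]
    congr 2
    · ext a; simp [φ]
    · ext1 i; exact hc i
  rw [Ne, ← hker] at hcbF
  have hFc : F.eval₂ Polynomial.C c ∉ P := fun h => hcbF (P.mul_mem_right _ h)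
  have hc0 : c i₀ ∉ P := fun h => hcbF (P.mul_mem_left _ h)
  let X : σ → Polynomial R := fun i => Polynomial.C (x i)
  have hXP : ∀ i, X i ∈ P := fun i => Ideal.mem_map_of_mem _ (hx ▸ Ideal.subset_span ⟨i, rfl⟩)
  let y : σ → Polynomial R := fun i => c i₀ * X i - X i₀ * c i
  let s : Finset (Polynomial R) := (Finset.univ.erase i₀).image y
  have hys : ∀ i, y i ∈ Ideal.span (s : Set (Polynomial R)) := by
    intro i
    by_cases h : i = i₀
    · have : y i = 0 := by simp only [y, h]; ring
      rw [this]; exact zero_mem _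
    · exact Ideal.subset_span (by
        simp only [s, Finset.coe_image, Set.mem_image]
        exact ⟨i, by simp [h], rfl⟩)
  have key : ∀ (H : MvPolynomial σ R) (q : ℕ), H.IsHomogeneous q →
      c i₀ ^ q * Polynomial.C (H.eval x) - X i₀ ^ q * H.eval₂ Polynomial.C c
        ∈ Ideal.span (s : Set (Polynomial R)) := by
    intro H q hH
    have e : Polynomial.C (H.eval x) = H.eval₂ Polynomial.C X := by
      rw [MvPolynomial.eval, MvPolynomial.coe_eval₂Hom, MvPolynomial.hom_eval₂]
      rfl
    rw [e, ← eval₂_scale _ H q hH, ← eval₂_scale _ H q hH, ← Ideal.Quotient.eq,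
      MvPolynomial.hom_eval₂, MvPolynomial.hom_eval₂]
    congr 1
    ext1 i
    exact Ideal.Quotient.eq.mpr (hys i)
  have hmin : P ∈ (Ideal.span (s : Set (Polynomial R))).minimalPrimes := by
    refine ⟨⟨hPp, ?_⟩, ?_⟩
    · rw [Ideal.span_le]
      intro z hz
      simp only [s, Finset.coe_image, Set.mem_image] at hz
      obtain ⟨i, -, rfl⟩ := hz
      exact P.sub_mem (P.mul_mem_left _ (hXP i)) (P.mul_mem_right _ (hXP i₀))
    · rintro Q ⟨hQp, hQ⟩ hQP
      have h1 := key F p hF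
      have h2 := key G (p + 1) hG
      rw [← hFG] at h2
      have h3 : X i₀ ^ p * (c i₀ * F.eval₂ Polynomial.C c - X i₀ * G.eval₂ Polynomial.C c) ∈ Q := by
        have := Q.sub_mem (hQ h2) (Q.mul_mem_left (c i₀) (hQ h1))
        convert this using 1
        ring
      have h4 : X i₀ ∈ Q := by
        rcases hQp.mem_or_mem h3 with h | h
        · exact hQp.mem_of_pow_mem _ h
        · exfalso
          have h5 : c i₀ * F.eval₂ Polynomial.C c ∈ P := by
            have := P.add_mem (hQP h) (P.mul_mem_right (G.eval₂ Polynomial.C c) (hXP i₀))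
            simpa using this
          exact (hPp.mem_or_mem h5).elim hc0 hFc
      change (maximalIdeal R).map Polynomial.C ≤ Q
      rw [← hx, Ideal.map_span, Ideal.span_le]
      rintro _ ⟨_, ⟨i, rfl⟩, rfl⟩
      have h6 : c i₀ * X i ∈ Q := by
        have := Q.add_mem (hQ (hys i)) (Q.mul_mem_right (c i) h4)
        simpa [y] using this
      exact (hQp.mem_or_mem h6).resolve_left fun h => hc0 (hQP h)
  have hh := Ideal.height_le_card_of_mem_minimalPrimes_span_finset hmin
  have hP : P.height = (maximalIdeal R).height := Polynomial.height_map_C _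
  rw [hP] at hh
  have h7 : Fintype.card σ ≤ s.card := by exact_mod_cast hd.trans hh
  have h8 : s.card ≤ Fintype.card σ - 1 := by
    refine Finset.card_image_le.trans ?_
    rw [Finset.card_erase_of_mem (Finset.mem_univ _), Finset.card_univ]
  have : 0 < Fintype.card σ := Fintype.card_pos_iff.mpr ⟨i₀⟩
  omega

theorem exists_order {R : Type*} [CommRing R] (I : Ideal R) (a : R) (p : ℕ)
    (h : a ∉ I ^ (p + 1)) : ∃ q ≤ p, a ∈ I ^ q ∧ a ∉ I ^ (q + 1) := by
  induction p with
  | zero => exact ⟨0, le_rfl, by simp, h⟩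
  | succ p ih =>
    by_cases hh : a ∈ I ^ (p + 1)
    · exact ⟨p + 1, le_rfl, hh, h⟩
    · obtain ⟨q, hq, h2⟩ := ih hh
      exact ⟨q, by omega, h2⟩

theorem mul_order {R : Type*} [CommRing R] [IsLocalRing R] (hreg : IsRegularLocal R)
    (hdim : (1 : WithBot ℕ∞) ≤ ringKrullDim R) (a b : R) (p q : ℕ)
    (ha : a ∉ maximalIdeal R ^ (p + 1)) (hb : b ∉ maximalIdeal R ^ (q + 1)) :
    a * b ∉ maximalIdeal R ^ (p + q + 1) := by
  obtain ⟨hN, s, hs, hcard⟩ := hreg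
  obtain ⟨p₁, hp, ha1, ha2⟩ := exists_order _ _ _ ha
  obtain ⟨q₁, hq, hb1, hb2⟩ := exists_order _ _ _ hb
  intro hab
  replace hab : a * b ∈ maximalIdeal R ^ (p₁ + q₁ + 1) :=
    Ideal.pow_le_pow_right (by omega) hab
  let x : s → R := fun i => i
  have hx : Ideal.span (Set.range x) = maximalIdeal R := by
    rw [← hs]; congr 1; simp [x]
  have hne : Nonempty s := by
    rw [Finset.nonempty_coe_sort, Finset.nonempty_iff_ne_empty]
    rintro rfl
    rw [← hcard] at hdim
    rw [Finset.card_empty] at hdim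
    have h01 : (1 : ℕ∞) ≤ 0 := by exact_mod_cast hdim
    simp at h01
  have hd : (Fintype.card s : ℕ∞) ≤ (maximalIdeal R).height := by
    rw [Fintype.card_coe]
    have := hcard.trans_le (maximalIdeal_height_eq_ringKrullDim (R := R)).ge
    exact_mod_cast this
  have rep : ∀ (n : ℕ) (z : R), z ∈ maximalIdeal R ^ n →
      ∃ F : MvPolynomial s R, F.IsHomogeneous n ∧ F.eval x = z := by
    intro n z hz
    rw [← hx] at hz
    exact (Ideal.mem_span_pow_iff_exists_isHomogeneous _ _).mp hz
  have nz : ∀ (n : ℕ) (F : MvPolynomial s R), F.IsHomogeneous n →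
      F.eval x ∉ maximalIdeal R ^ (n + 1) → F.map (residue R) ≠ 0 := by
    intro n F hF h h0
    apply h
    rw [MvPolynomial.eval_eq]
    refine Ideal.sum_mem _ fun d hd => ?_
    have hdeg : d.degree = n := by
      have := hF (MvPolynomial.mem_support_iff.mp hd)
      rw [Finsupp.degree_eq_weight_one]; exact this
    rw [pow_succ']
    refine Ideal.mul_mem_mul ?_ ?_
    · have := congrArg (MvPolynomial.coeff d) h0
      rw [MvPolynomial.coeff_map, MvPolynomial.coeff_zero] at this
      exact (residue_eq_zero_iff _).mp this
    · rw [← hdeg, Finsupp.degree_apply, ← Finset.prod_pow_eq_pow_sum]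
      exact Ideal.prod_mem_prod fun i _ =>
        Ideal.pow_mem_pow (hx ▸ Ideal.subset_span ⟨i, rfl⟩) _
  obtain ⟨F, hF, rfl⟩ := rep _ _ ha1
  obtain ⟨G, hG, rfl⟩ := rep _ _ hb1
  obtain ⟨H, hH, hHe⟩ := rep _ _ hab
  have := analytic_indep x hx hd (F * G) H _ (hF.mul hG) hH (by rw [hHe, map_mul])
  rw [map_mul] at this
  exact mul_ne_zero (nz _ F hF ha2) (nz _ G hG hb2) this

theorem pow_order {R : Type*} [CommRing R] [IsLocalRing R] (hreg : IsRegularLocal R)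
    (hdim : (1 : WithBot ℕ∞) ≤ ringKrullDim R) (a : R) (p k : ℕ)
    (ha : a ∉ maximalIdeal R ^ (p + 1)) : a ^ k ∉ maximalIdeal R ^ (k * p + 1) := by
  induction k with
  | zero => simp
  | succ k ih =>
    rw [pow_succ a, Nat.succ_mul]
    exact mul_order hreg hdim _ _ _ _ ih ha

theorem prod_order {R : Type*} [CommRing R] [IsLocalRing R] (hreg : IsRegularLocal R)
    (hdim : (1 : WithBot ℕ∞) ≤ ringKrullDim R) {ι : Type*} (s : Finset ι) (a : ι → R)
    (α : ι → ℕ) (p : ℕ) (ha : ∀ j ∈ s, α j ≠ 0 → a j ∉ maximalIdeal R ^ (p + 1)) :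
    ∏ j ∈ s, a j ^ α j ∉ maximalIdeal R ^ ((∑ j ∈ s, α j) * p + 1) := by
  classical
  induction s using Finset.induction_on with
  | empty => simp
  | insert i s hi ih =>
    have ihs := ih fun j hj => ha j (Finset.mem_insert_of_mem hj)
    rw [Finset.prod_insert hi, Finset.sum_insert hi]
    by_cases h0 : α i = 0
    · simpa [h0] using ihs
    · rw [add_mul]
      exact mul_order hreg hdim _ _ _ _
        (pow_order hreg hdim _ _ _ (ha i (Finset.mem_insert_self _ _) h0)) ihs

/-- **Lemma.** Let `(R, m)` be a regular local ring of Krull dimension at least `1` and `α` a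
nonzero multi-index.  Then for every `n ≥ 1`, `β_n(X^α) = |α| n − |α| + 1`: (a) every `a ∈ R^N`
with `a^α ∈ m^(|α|n − |α| + 1)` is congruent mod `mⁿ` to a `b` with `b^α = 0`, and (b) there is
an `a ∈ R^N` with `a^α ∈ m^(|α|n − |α|)` congruent mod `mⁿ` to no `b` with `b^α = 0`. -/
theorem monomial_artin_function_regular
    (R : Type*) [CommRing R] [IsLocalRing R] (hreg : IsRegularLocal R)
    (hdim : (1 : WithBot ℕ∞) ≤ ringKrullDim R)
    (N : ℕ) (α : Fin N → ℕ) (hα : α ≠ 0) (n : ℕ) (hn : 1 ≤ n) :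
    (∀ a : Fin N → R, (∏ j, a j ^ α j) ∈ maximalIdeal R ^ ((∑ j, α j) * n - (∑ j, α j) + 1) →
      ∃ b : Fin N → R, (∏ j, b j ^ α j) = 0 ∧ ∀ j, a j - b j ∈ maximalIdeal R ^ n) ∧
    (∃ a : Fin N → R, (∏ j, a j ^ α j) ∈ maximalIdeal R ^ ((∑ j, α j) * n - (∑ j, α j)) ∧
      ∀ b : Fin N → R, (∏ j, b j ^ α j) = 0 → ∃ j, a j - b j ∉ maximalIdeal R ^ n) := by
  obtain ⟨m, rfl⟩ : ∃ m, n = m + 1 := ⟨n - 1, by omega⟩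
  have hS : (∑ j, α j) * (m + 1) - (∑ j, α j) = (∑ j, α j) * m := by
    rw [Nat.mul_succ, Nat.add_sub_cancel]
  rw [hS]
  constructor
  · intro a ha
    have : ∃ j, α j ≠ 0 ∧ a j ∈ maximalIdeal R ^ (m + 1) := by
      by_contra! h
      exact prod_order hreg hdim Finset.univ a α m (fun j _ => h j) ha
    obtain ⟨j, hj, haj⟩ := this
    refine ⟨Function.update a j 0, ?_, ?_⟩
    · exact Finset.prod_eq_zero (Finset.mem_univ j) (by simp [hj])
    · intro i
      by_cases h : i = j
      · subst h; simpa using haj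
      · simp [h]
  · have : IsNoetherianRing R := hreg.1
    have hnf : ¬ IsField R := by
      intro h
      rw [ringKrullDim_eq_zero_of_isField h] at hdim
      have h01 : (1 : ℕ∞) ≤ 0 := by exact_mod_cast hdim
      simp at h01
    obtain ⟨x, hx1, hx2⟩ := Set.exists_of_ssubset ((maximalIdeal_sq_lt_maximalIdeal R).mpr hnf)
    have hxm : x ^ m ∉ maximalIdeal R ^ (m + 1) := by
      simpa using pow_order hreg hdim x 1 m hx2
    refine ⟨fun _ => x ^ m, ?_, ?_⟩
    · rw [Finset.prod_pow_eq_pow_sum, ← pow_mul, mul_comm]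
      exact Ideal.pow_mem_pow hx1 _
    · intro b hb
      by_contra! h
      refine prod_order hreg hdim Finset.univ b α m (fun j _ _ hbj => hxm ?_)
        (by rw [hb]; exact zero_mem _)
      simpa using Ideal.add_mem _ (h j) hbj
end
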